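/- Let A, B ∈ ℤ with 0 < A ≤ B, B ≥ 2, 2A − B = 3 and A ≠ B (so A ≥ 4 and B = 2A − 3 ≥ 5), let M = [[0, −B], [1, −A]] acting on ℝ², and let T be the tile for M and digits {0, …, B−1}·e₁. Then: (a) T is connected and for every x ∈ T the set T ∖ {x} is preconnected (T has no cut point); (b) the interior of T is not preconnected; and (c) for every connected component U of the interior of T, the closure of U is homeomorphic to the closed unit disk {p ∈ ℝ² : ‖p‖ ≤ 1}. -/

import Mathlib

noncomputable section

/-- The matrix `[[0, -B], [1, -A]]` as a real matrix. -/
def M' (A B : ℤ) : Matrix (Fin 2) (Fin 2) ℝ := !![0, -(B : ℝ); 1, -(A : ℝ)]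

/-- `e₁ = (1, 0) ∈ ℝ²`. -/
def e1 : Fin 2 → ℝ := ![1, 0]

section TileAuxiliary

open Set Filter Topology Metric Complex

/-- The function `h` has a continuous logarithm on `S`. -/
def HasLog (h : ℂ → ℂ) (S : Set ℂ) : Prop :=
  ∃ l : ℂ → ℂ, ContinuousOn l S ∧ ∀ z ∈ S, exp (l z) = h z

theorem HasLog.mono {h : ℂ → ℂ} {S S' : Set ℂ} (H : HasLog h S) (hs : S' ⊆ S) : HasLog h S' := by
  obtain ⟨l, hl, he⟩ := H
  exact ⟨l, hl.mono hs, fun z hz => he z (hs hz)⟩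

theorem HasLog.congr {h h' : ℂ → ℂ} {S : Set ℂ} (H : HasLog h S) (hh : ∀ z ∈ S, h z = h' z) :
    HasLog h' S := by
  obtain ⟨l, hl, he⟩ := H
  exact ⟨l, hl, fun z hz => (he z hz).trans (hh z hz)⟩

theorem HasLog.mul {h h' : ℂ → ℂ} {S : Set ℂ} (H : HasLog h S) (H' : HasLog h' S) :
    HasLog (fun z => h z * h' z) S := by
  obtain ⟨l, hl, he⟩ := H
  obtain ⟨l', hl', he'⟩ := H'
  exact ⟨fun z => l z + l' z, hl.add hl', fun z hz => by rw [exp_add, he z hz, he' z hz]⟩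

theorem HasLog.inv {h : ℂ → ℂ} {S : Set ℂ} (H : HasLog h S) :
    HasLog (fun z => (h z)⁻¹) S := by
  obtain ⟨l, hl, he⟩ := H
  exact ⟨fun z => - l z, hl.neg, fun z hz => by rw [exp_neg, he z hz]⟩

theorem hasLog_of_norm_sub_one_lt {h : ℂ → ℂ} {S : Set ℂ} (hc : ContinuousOn h S)
    (hs : ∀ z ∈ S, ‖h z - 1‖ < 1) : HasLog h S := by
  have key : ∀ z ∈ S, 0 < (h z).re := by
    intro z hz
    have := (abs_re_le_norm (h z - 1)).trans_lt (hs z hz)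
    rw [abs_lt] at this
    simp at this
    linarith
  refine ⟨fun z => log (h z), hc.clog fun z hz => Or.inl (key z hz), fun z hz => exp_log ?_⟩
  intro h0
  have := key z hz
  simp [h0] at this

/-- Two logarithms of the same function on a preconnected set differ by a constant. -/
theorem exists_int_of_exp_eq {X : Type*} [TopologicalSpace X] {S : Set X} (hS : IsPreconnected S)
    {l l' : X → ℂ} (hl : ContinuousOn l S) (hl' : ContinuousOn l' S)
    (h : ∀ z ∈ S, exp (l z) = exp (l' z)) :
    ∃ n : ℤ, ∀ z ∈ S, l z = l' z + n * (2 * Real.pi * I) := by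
  rcases S.eq_empty_or_nonempty with rfl | ⟨z₀, hz₀⟩
  · exact ⟨0, by simp⟩
  have h2 : ∀ z ∈ S, ∃ n : ℤ, l z = l' z + n * (2 * Real.pi * I) := fun z hz =>
    exp_eq_exp_iff_exists_int.1 (h z hz)
  obtain ⟨n, hn⟩ := h2 z₀ hz₀
  refine ⟨n, fun z hz => ?_⟩
  let g : X → ℝ := fun z => ((l z - l' z).im) / (2 * Real.pi)
  have hg : ContinuousOn g S :=
    (Complex.continuous_im.comp_continuousOn (hl.sub hl')).div_const _
  have hgi : ∀ z ∈ S, ∀ n : ℤ, l z = l' z + n * (2 * Real.pi * I) → g z = n := by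
    intro z hz n hn
    have : (2 * Real.pi : ℝ) ≠ 0 := by positivity
    simp only [g, hn]
    simp
  have him : IsPreconnected (g '' S) := hS.image g hg
  obtain ⟨m, hm⟩ := h2 z hz
  have hgz := hgi z hz m hm
  have hgz0 := hgi z₀ hz₀ n hn
  have : m = n := by
    by_contra hne
    have hoc : OrdConnected (g '' S) := him.ordConnected
    have hhalf : ∀ k : ℤ, ((k : ℝ) + 1 / 2) ∉ g '' S := by
      rintro k ⟨y, hy, hyk⟩
      obtain ⟨j, hj⟩ := h2 y hy
      have hj' := hgi y hy j hj
      rw [hj'] at hyk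
      have : (2 * j : ℝ) = 2 * k + 1 := by linarith
      have : 2 * j = 2 * k + 1 := by exact_mod_cast this
      omega
    rcases lt_or_gt_of_ne hne with hlt | hlt
    · refine hhalf m (hoc.out ⟨z, hz, hgz⟩ ⟨z₀, hz₀, hgz0⟩ ⟨by linarith, ?_⟩)
      have : (m : ℝ) + 1 ≤ n := by exact_mod_cast hlt
      linarith
    · refine hhalf n (hoc.out ⟨z₀, hz₀, hgz0⟩ ⟨z, hz, hgz⟩ ⟨by linarith, ?_⟩)
      have : (n : ℝ) + 1 ≤ m := by exact_mod_cast hlt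
      linarith
  rw [hm, this]

theorem HasLog.union {h : ℂ → ℂ} {S S' : Set ℂ} (hS : IsClosed S) (hS' : IsClosed S')
    (hi : IsPreconnected (S ∩ S')) (H : HasLog h S) (H' : HasLog h S') : HasLog h (S ∪ S') := by
  classical
  obtain ⟨l, hl, he⟩ := H
  obtain ⟨l', hl', he'⟩ := H'
  obtain ⟨n, hn⟩ := exists_int_of_exp_eq hi (hl.mono inter_subset_left)
    (hl'.mono inter_subset_right) (fun z hz => (he z hz.1).trans (he' z hz.2).symm)
  have key : ∀ z ∈ S', (if z ∈ S then l z else l' z + n * (2 * Real.pi * I))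
      = l' z + n * (2 * Real.pi * I) := by
    intro z hz
    split_ifs with h
    · exact hn z ⟨h, hz⟩
    · rfl
  refine ⟨fun z => if z ∈ S then l z else l' z + n * (2 * Real.pi * I), ?_, ?_⟩
  · refine ContinuousOn.union_of_isClosed ?_ ?_ hS hS'
    · exact hl.congr fun z hz => by simp [hz]
    · exact (hl'.add continuousOn_const).congr fun z hz => key z hz
  · rintro z (hz | hz)
    · simp [hz, he z hz]
    · dsimp only
      rw [key z hz, exp_periodic.int_mul n, he' z hz]

/-- A set at positive distance from a preconnected set `P` carries a logarithm of
`(z - w) / (z - w')` for all `w, w' ∈ P`. -/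
theorem hasLog_div_of_isPreconnected {P F : Set ℂ} (hP : IsPreconnected P) {δ : ℝ} (hδ : 0 < δ)
    (hd : ∀ z ∈ F, ∀ p ∈ P, δ ≤ dist z p) {w w' : ℂ} (hw : w ∈ P) (hw' : w' ∈ P) :
    HasLog (fun z => (z - w) / (z - w')) F := by
  have hne : ∀ z ∈ F, ∀ p ∈ P, z - p ≠ 0 := by
    intro z hz p hp h
    have := hd z hz p hp
    rw [dist_eq_norm, h, norm_zero] at this
    linarith
  refine hP.induction₂ (fun w w' => HasLog (fun z => (z - w) / (z - w')) F) ?_ ?_ ?_ hw hw'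
  · intro x hx
    have : ball x δ ∈ 𝓝[P] x := mem_nhdsWithin_of_mem_nhds (ball_mem_nhds x hδ)
    filter_upwards [this, self_mem_nhdsWithin] with y hy hyP
    refine hasLog_of_norm_sub_one_lt ?_ ?_
    · exact (continuousOn_id.sub continuousOn_const).div (continuousOn_id.sub continuousOn_const)
        fun z hz => hne z hz y hyP
    · intro z hz
      have h0 := hne z hz y hyP
      have : (z - x) / (z - y) - 1 = (y - x) / (z - y) := by field_simp; ring
      rw [this, norm_div, div_lt_one (norm_pos_iff.2 h0)]
      have h1 := hd z hz y hyP
      rw [mem_ball, dist_eq_norm] at hy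
      rw [dist_eq_norm] at h1
      linarith
  · intro x y z hx hy hz hxy hyz
    refine (hxy.mul hyz).congr fun u hu => ?_
    have := hne u hu y hy
    have := hne u hu z hz
    field_simp
  · intro x y hx hy hxy
    exact hxy.inv.congr fun u hu => by rw [inv_div]

theorem hasLog_div_of_isCompact {P F : Set ℂ} (hP : IsPreconnected P) (hPc : IsClosed P)
    (hF : IsCompact F) (hd : Disjoint F P) {w w' : ℂ} (hw : w ∈ P) (hw' : w' ∈ P) :
    HasLog (fun z => (z - w) / (z - w')) F := by
  obtain ⟨δ, hδ, h⟩ := hd.exists_thickenings hF hPc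
  refine hasLog_div_of_isPreconnected hP hδ (fun z hz p hp => ?_) hw hw'
  by_contra hlt
  push Not at hlt
  refine Set.disjoint_left.1 h (self_subset_thickening hδ _ hz) ?_
  exact mem_thickening_iff.2 ⟨p, hp, hlt⟩

theorem hasLog_div_of_isClosed {P F : Set ℂ} (hP : IsPreconnected P) (hPc : IsCompact P)
    (hF : IsClosed F) (hd : Disjoint F P) {w w' : ℂ} (hw : w ∈ P) (hw' : w' ∈ P) :
    HasLog (fun z => (z - w) / (z - w')) F := by
  obtain ⟨δ, hδ, h⟩ := hd.symm.exists_thickenings hPc hF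
  refine hasLog_div_of_isPreconnected hP hδ (fun z hz p hp => ?_) hw hw'
  by_contra hlt
  push Not at hlt
  refine Set.disjoint_left.1 h ?_ (self_subset_thickening hδ _ hz)
  exact mem_thickening_iff.2 ⟨p, hp, hlt⟩

/-- The function `z ↦ (z - w) / (z - w₀)` has no logarithm on the frontier of a bounded open set
which separates `w` from `w₀`. -/
theorem not_hasLog_frontier {W : Set ℂ} (hWb : Bornology.IsBounded W) {w w₀ : ℂ}
    (hw : w ∈ W) (hw₀ : w₀ ∉ closure W) :
    ¬ HasLog (fun z => (z - w) / (z - w₀)) (frontier W) := by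
  classical
  rintro ⟨l, hl, he⟩
  obtain ⟨L, hL⟩ := ContinuousMap.exists_restrict_eq (isClosed_frontier (s := W))
    ⟨(frontier W).domRestrict l, continuousOn_iff_continuous_domRestrict.1 hl⟩
  have hL' : ∀ z ∈ frontier W, L z = l z := fun z hz => by
    exact congrArg (fun f => f ⟨z, hz⟩) hL
  let G : ℂ → ℂ := W.piecewise (fun z => (z - w₀) * exp (L z)) (fun z => z - w)
  have hG : Continuous G := by
    refine Continuous.piecewise (fun z hz => ?_) (by fun_prop) (by fun_prop)
    have : z - w₀ ≠ 0 := fun h => hw₀ (sub_eq_zero.1 h ▸ frontier_subset_closure hz)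
    rw [hL' z hz, he z hz]
    field_simp
  have hG0 : (0 : ℂ) ∉ G '' univ := by
    rintro ⟨z, -, hz⟩
    by_cases hzW : z ∈ W
    · have : z - w₀ ≠ 0 := fun h => hw₀ (sub_eq_zero.1 h ▸ subset_closure hzW)
      simp [G, hzW, this] at hz
    · have : z - w ≠ 0 := fun h => hzW (sub_eq_zero.1 h ▸ hw)
      simp [G, hzW, this] at hz
  have hsc : IsSimplyConnected (univ : Set ℂ) := by
    have : ContractibleSpace (univ : Set ℂ) :=
      (Homeomorph.Set.univ ℂ).contractibleSpace_iff.2 inferInstance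
    exact SimplyConnectedSpace.ofContractible _
  obtain ⟨f, hfc, hf⟩ := exists_continuousOn_eqOn_exp_comp hsc isOpen_univ hG.continuousOn hG0
  rw [continuousOn_univ] at hfc
  obtain ⟨R, hR⟩ := hWb.subset_ball w
  have hR0 : 0 < R := by simpa using hR hw
  let c : ℝ → ℂ := circleMap w R
  have hcW : ∀ t, c t ∉ W := fun t ht => by
    have := hR ht
    simp [c, abs_of_pos hR0, dist_eq_norm] at this
  obtain ⟨n, hn⟩ := exists_int_of_exp_eq (S := (univ : Set ℝ)) isPreconnected_univ
    (l := fun t => f (c t)) (l' := fun t => Real.log R + t * I)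
    (hfc.comp (continuous_circleMap w R)).continuousOn (by fun_prop) (fun t _ => by
      have h1 := hf (mem_univ (c t))
      simp only [Function.comp] at h1
      rw [h1]
      simp only [G, piecewise_eq_of_notMem _ _ _ (hcW t), exp_add, ← ofReal_exp,
        Real.exp_log hR0]
      simp [c, circleMap])
  have h0 := hn 0 (mem_univ _)
  have h1 := hn (2 * Real.pi) (mem_univ _)
  have hc : c (2 * Real.pi) = c 0 := by simp [c, circleMap]
  rw [hc, h0] at h1
  have : (2 * Real.pi * I : ℂ) = 0 := by
    push_cast at h1
    linear_combination -h1
  simp [Real.pi_ne_zero] at this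

theorem hasLog_of_forall_isCompact {V : Set ℂ} (hV : IsOpen V) (hVc : IsConnected V) {h : ℂ → ℂ}
    (hK : ∀ K ⊆ V, IsCompact K → HasLog h K) : HasLog h V := by
  obtain ⟨z₀, hz₀⟩ := hVc.nonempty
  have hp : IsPathConnected V := hV.isConnected_iff_isPathConnected.1 hVc
  have h0 : h z₀ ≠ 0 := by
    obtain ⟨l, -, hl⟩ := hK {z₀} (by simpa) isCompact_singleton
    rw [← hl z₀ rfl]
    exact exp_ne_zero _
  have hnorm : ∀ K ⊆ V, IsCompact K → z₀ ∈ K → ∃ l : ℂ → ℂ, ContinuousOn l K ∧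
      (∀ z ∈ K, exp (l z) = h z) ∧ l z₀ = log (h z₀) := by
    intro K hKV hKc hzK
    obtain ⟨l, hl, he⟩ := hK K hKV hKc
    have : exp (log (h z₀)) = exp (l z₀) := by rw [exp_log h0, he z₀ hzK]
    obtain ⟨n, hn⟩ := exp_eq_exp_iff_exists_int.1 this
    refine ⟨fun z => l z + n * (2 * Real.pi * I), hl.add continuousOn_const, fun z hz => ?_,
      hn.symm⟩
    rw [exp_periodic.int_mul n, he z hz]
  have hcover : ∀ z ∈ V, ∃ K ⊆ V, IsCompact K ∧ IsPreconnected K ∧ z₀ ∈ K ∧ K ∈ 𝓝 z := by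
    intro z hz
    obtain ⟨γ, hγ⟩ := hp.joinedIn z₀ hz₀ z hz
    obtain ⟨ε, hε, hεV⟩ := Metric.nhds_basis_closedBall.mem_iff.1 (hV.mem_nhds hz)
    refine ⟨range γ ∪ closedBall z ε, union_subset ?_ hεV,
      (isCompact_range γ.continuous).union (isCompact_closedBall z ε), ?_,
      Or.inl ⟨0, by simp⟩, mem_of_superset (closedBall_mem_nhds z hε) subset_union_right⟩
    · rintro _ ⟨t, rfl⟩
      exact hγ t
    · exact IsPreconnected.union z ⟨1, by simp⟩ (mem_closedBall_self hε.le)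
        (isPreconnected_range γ.continuous) (convex_closedBall z ε).isPreconnected
  choose! K hKV hKc hKp hzK hKn using hcover
  have hl : ∀ z ∈ V, ∃ l : ℂ → ℂ, ContinuousOn l (K z) ∧
      (∀ w ∈ K z, exp (l w) = h w) ∧ l z₀ = log (h z₀) := fun z hz =>
    hnorm _ (hKV z hz) (hKc z hz) (hzK z hz)
  choose! l hlc hle hl0 using hl
  have hagree : ∀ z ∈ V, ∀ w ∈ V, w ∈ K z → l w w = l z w := by
    intro z hz w hw hwz
    obtain ⟨m, hmc, hme, hm0⟩ := hnorm (K z ∪ K w) (union_subset (hKV z hz) (hKV w hw))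
      ((hKc z hz).union (hKc w hw)) (Or.inl (hzK z hz))
    have huniq : ∀ v ∈ V, K v ⊆ K z ∪ K w → ∀ y ∈ K v, l v y = m y := by
      intro v hv hvK y hy
      obtain ⟨n, hn⟩ := exists_int_of_exp_eq (hKp v hv) (hlc v hv) (hmc.mono hvK)
        (fun x hx => (hle v hv x hx).trans (hme x (hvK hx)).symm)
      have h1 := hn z₀ (hzK v hv)
      rw [hl0 v hv, hm0] at h1
      have h2 : (n : ℂ) * (2 * Real.pi * I) = 0 := by linear_combination -h1
      rw [hn y hy, h2, add_zero]
    rw [huniq w hw subset_union_right w (mem_of_mem_nhds (hKn w hw)),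
      huniq z hz subset_union_left w hwz]
  refine ⟨fun z => l z z, fun z hz => ?_, fun z hz => hle z hz z (mem_of_mem_nhds (hKn z hz))⟩
  have hc : ContinuousAt (l z) z := (hlc z hz).continuousAt (hKn z hz)
  refine (hc.congr ?_).continuousWithinAt
  filter_upwards [hKn z hz, hV.mem_nhds hz] with w hw hwV
  exact (hagree z hz w hwV hw).symm

/-- The involutive-up-to-sign disc automorphism sending `a` to `0`. -/
def discShift (a z : ℂ) : ℂ := (z - a) / (1 - (starRingEnd ℂ) a * z)

theorem one_sub_conj_mul_ne_zero {a z : ℂ} (ha : ‖a‖ < 1) (hz : ‖z‖ ≤ 1) :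
    1 - (starRingEnd ℂ) a * z ≠ 0 := by
  intro h
  have : ‖(starRingEnd ℂ) a * z‖ < 1 := by
    rw [norm_mul, RCLike.norm_conj]
    nlinarith [norm_nonneg a, norm_nonneg z]
  rw [← sub_eq_zero.1 h] at this
  simp at this

theorem normSq_discShift (a z : ℂ) :
    normSq (1 - (starRingEnd ℂ) a * z) - normSq (z - a) = (1 - normSq a) * (1 - normSq z) := by
  simp only [normSq_apply, sub_re, sub_im, mul_re, mul_im, conj_re, conj_im, one_re, one_im]
  ring

theorem norm_discShift_le {a z : ℂ} (ha : ‖a‖ < 1) (hz : ‖z‖ ≤ 1) : ‖discShift a z‖ ≤ 1 := by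
  have h0 := one_sub_conj_mul_ne_zero ha hz
  rw [discShift, norm_div, div_le_one (norm_pos_iff.2 h0)]
  have := normSq_discShift a z
  simp only [normSq_eq_norm_sq] at this
  have h1 : 0 ≤ (1 - ‖a‖ ^ 2) * (1 - ‖z‖ ^ 2) := by
    apply mul_nonneg <;> nlinarith [norm_nonneg a, norm_nonneg z]
  exact abs_le_of_sq_le_sq' (by linarith) (norm_nonneg _) |>.2

theorem norm_discShift_lt {a z : ℂ} (ha : ‖a‖ < 1) (hz : ‖z‖ < 1) : ‖discShift a z‖ < 1 := by
  have h0 := one_sub_conj_mul_ne_zero ha hz.le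
  rw [discShift, norm_div, div_lt_one (norm_pos_iff.2 h0)]
  have := normSq_discShift a z
  simp only [normSq_eq_norm_sq] at this
  have h1 : 0 < (1 - ‖a‖ ^ 2) * (1 - ‖z‖ ^ 2) := by
    apply mul_pos <;> nlinarith [norm_nonneg a, norm_nonneg z]
  exact abs_lt_of_sq_lt_sq' (by linarith) (norm_nonneg _) |>.2

theorem discShift_neg_discShift {a z : ℂ} (ha : ‖a‖ < 1) (hz : ‖z‖ ≤ 1) :
    discShift (-a) (discShift a z) = z := by
  have h0 := one_sub_conj_mul_ne_zero ha hz
  have h1 := one_sub_conj_mul_ne_zero (a := -a) (by simpa) (norm_discShift_le ha hz)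
  have e : discShift a z * (1 - (starRingEnd ℂ) a * z) = z - a := div_mul_cancel₀ _ h0
  rw [discShift, div_eq_iff h1, map_neg]
  apply mul_right_cancel₀ h0
  linear_combination (1 - z * (starRingEnd ℂ) a) * e

theorem hasDerivAt_discShift {a z : ℂ} (ha : ‖a‖ < 1) (hz : ‖z‖ ≤ 1) :
    HasDerivAt (discShift a) ((1 - (starRingEnd ℂ) a * a) / (1 - (starRingEnd ℂ) a * z) ^ 2) z := by
  have h0 := one_sub_conj_mul_ne_zero ha hz
  have h1 : HasDerivAt (fun z => z - a) 1 z := (hasDerivAt_id z).sub_const a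
  have h2 : HasDerivAt (fun z => 1 - (starRingEnd ℂ) a * z) (-((starRingEnd ℂ) a)) z := by
    simpa using ((hasDerivAt_id z).const_mul ((starRingEnd ℂ) a)).const_sub 1
  exact (h1.fun_div h2 h0).congr_deriv (by ring)

/-- Connected open subsets of the unit disc with connected complement. -/
structure GoodDomain (V : Set ℂ) : Prop where
  isOpen : IsOpen V
  isConnected : IsConnected V
  subset_ball : V ⊆ ball 0 1
  isPreconnected_compl : IsPreconnected (closedBall 0 1 \ V)

theorem GoodDomain.image_discShift {V : Set ℂ} (hV : GoodDomain V) {a : ℂ} (ha : ‖a‖ < 1) :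
    GoodDomain (discShift a '' V) := by
  have hle : ∀ z ∈ V, ‖z‖ < 1 := fun z hz => by simpa using hV.subset_ball hz
  have ha' : ‖-a‖ < 1 := by simpa
  have hc : ∀ a : ℂ, ‖a‖ < 1 → ContinuousOn (discShift a) (closedBall 0 1) := fun a ha z hz =>
    (hasDerivAt_discShift ha (by simpa using hz)).continuousAt.continuousWithinAt
  have himg : discShift a '' V = ball 0 1 ∩ discShift (-a) ⁻¹' V := by
    ext w
    constructor
    · rintro ⟨z, hz, rfl⟩
      refine ⟨by simpa using norm_discShift_lt ha (hle z hz), ?_⟩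
      rwa [mem_preimage, discShift_neg_discShift ha (hle z hz).le]
    · rintro ⟨hw, hwV⟩
      refine ⟨_, hwV, ?_⟩
      have := discShift_neg_discShift ha' (z := w) (by simpa using (mem_ball_zero_iff.1 hw).le)
      simpa using this
  refine ⟨?_, ?_, ?_, ?_⟩
  · rw [himg]
    exact ((hc _ ha').mono ball_subset_closedBall).isOpen_inter_preimage isOpen_ball hV.isOpen
  · exact hV.isConnected.image _ ((hc a ha).mono (hV.subset_ball.trans ball_subset_closedBall))
  · rw [himg]; exact inter_subset_left
  · have : closedBall 0 1 \ discShift a '' V = discShift a '' (closedBall 0 1 \ V) := by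
      ext w
      constructor
      · rintro ⟨hw, hwV⟩
        rw [mem_closedBall_zero_iff] at hw
        have h1 := discShift_neg_discShift ha' hw
        rw [neg_neg] at h1
        exact ⟨_, ⟨by simpa using norm_discShift_le ha' hw, fun h => hwV ⟨_, h, h1⟩⟩, h1⟩
      · rintro ⟨z, ⟨hz, hzV⟩, rfl⟩
        rw [mem_closedBall_zero_iff] at hz
        refine ⟨by simpa using norm_discShift_le ha hz, ?_⟩
        rintro ⟨y, hy, hyz⟩
        have := discShift_neg_discShift ha (hle y hy).le
        rw [hyz, discShift_neg_discShift ha hz] at this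
        exact hzV (this ▸ hy)
    rw [this]
    exact hV.isPreconnected_compl.image _ ((hc a ha).mono sdiff_subset)

theorem image_mem_nhds_of_deriv_ne_zero {V : Set ℂ} (hV : IsOpen V) {f : ℂ → ℂ}
    (hf : DifferentiableOn ℂ f V) {z : ℂ} (hz : z ∈ V) (h0 : deriv f z ≠ 0) :
    f '' V ∈ 𝓝 (f z) := by
  have hs : HasStrictDerivAt f (deriv f z) z :=
    (hf.analyticAt (hV.mem_nhds hz)).hasStrictDerivAt
  rw [← hs.map_nhds_eq h0]
  exact image_mem_map (hV.mem_nhds hz)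

theorem isOpen_image_of_deriv_ne_zero {V : Set ℂ} (hV : IsOpen V) {f : ℂ → ℂ}
    (hf : DifferentiableOn ℂ f V) (h0 : ∀ z ∈ V, deriv f z ≠ 0) : IsOpen (f '' V) := by
  rw [isOpen_iff_mem_nhds]
  rintro _ ⟨z, hz, rfl⟩
  exact image_mem_nhds_of_deriv_ne_zero hV hf hz (h0 z hz)

theorem isPreconnected_preimage_sq {C : Set ℂ} (hC : IsPreconnected C) (hCc : IsCompact C)
    (h0 : (0 : ℂ) ∈ C) : IsPreconnected ((fun z : ℂ => z ^ 2) ⁻¹' C) := by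
  set q : ℂ → ℂ := fun z => z ^ 2
  have hq : Continuous q := by fun_prop
  have hsurj : ∀ c, ∃ b, q b = c := fun c => IsAlgClosed.exists_pow_nat_eq c two_pos
  have hcp : IsCompact (q ⁻¹' C) := by
    refine isCompact_of_isClosed_isBounded (hCc.isClosed.preimage hq) ?_
    obtain ⟨R, hR⟩ := hCc.isBounded.exists_norm_le
    refine (isBounded_iff_forall_norm_le).2 ⟨R + 1, fun z hz => ?_⟩
    have := hR _ hz
    simp only [q, norm_pow] at this
    nlinarith [norm_nonneg z, sq_nonneg (‖z‖ - 1)]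
  have key : ∀ t t' : Set ℂ, IsClosed t → IsClosed t' → q ⁻¹' C ⊆ t ∪ t' → (0 : ℂ) ∈ t →
      (q ⁻¹' C ∩ t').Nonempty → (q ⁻¹' C ∩ (t ∩ t')).Nonempty := by
    rintro t t' ht ht' hcov h0t ⟨x, hxC, hxt⟩
    by_contra hemp
    have hdis : ∀ b, q b ∈ C → b ∈ t → b ∈ t' → False := fun b hb h1 h2 =>
      hemp ⟨b, hb, h1, h2⟩
    have hn1 : IsClosed ((-·) ⁻¹' t : Set ℂ) := ht.preimage continuous_neg
    have hn2 : IsClosed ((-·) ⁻¹' t' : Set ℂ) := ht'.preimage continuous_neg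
    have hq' : ∀ b, q (-b) = q b := fun b => by simp [q]
    have hsub := isPreconnected_closed_iff.1 hC (q '' (q ⁻¹' C ∩ (t ∩ (-·) ⁻¹' t)))
      (q '' (q ⁻¹' C ∩ (t' ∪ (-·) ⁻¹' t')))
      ((hcp.inter_right (ht.inter hn1)).image hq).isClosed
      ((hcp.inter_right (ht'.union hn2)).image hq).isClosed
      (by
        intro c hc
        obtain ⟨b, rfl⟩ := hsurj c
        by_cases h : b ∈ t' ∨ -b ∈ t'
        · exact Or.inr ⟨b, ⟨hc, h⟩, rfl⟩
        · push Not at h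
          refine Or.inl ⟨b, ⟨hc, (hcov hc).resolve_right h.1, (hcov ?_).resolve_right h.2⟩, rfl⟩
          simpa [hq'] using hc)
      ⟨0, h0, 0, ⟨by simpa [q] using h0, h0t, by simpa using h0t⟩, by simp [q]⟩
      ⟨q x, hxC, x, ⟨hxC, Or.inl hxt⟩, rfl⟩
    obtain ⟨c, hc, ⟨y, ⟨hyC, hy1, hy2⟩, hyc⟩, ⟨z, ⟨hzC, hz⟩, hzc⟩⟩ := hsub
    have hyz : z = y ∨ z = -y := sq_eq_sq_iff_eq_or_eq_neg.1 (hzc.trans hyc.symm)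
    have hyC' : q (-y) ∈ C := by rw [hq']; exact hyC
    rcases hyz with rfl | rfl <;> rcases hz with hz | hz
    · exact hdis _ hyC hy1 hz
    · exact hdis _ hyC' hy2 hz
    · exact hdis _ hyC' hy2 hz
    · exact hdis _ hyC hy1 (by simpa using hz)
  rw [isPreconnected_closed_iff]
  intro t t' ht ht' hcov h1 h2
  rcases hcov (show (0 : ℂ) ∈ q ⁻¹' C by simpa [q] using h0) with h | h
  · exact key t t' ht ht' hcov h h2
  · rw [inter_comm t]
    exact key t' t ht' ht (by rwa [union_comm]) h h1

theorem GoodDomain.exists_sqrt {V : Set ℂ} (hV : GoodDomain V) (h0 : (0 : ℂ) ∉ V) :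
    ∃ s : ℂ → ℂ, (∀ z ∈ V, s z ^ 2 = z) ∧ (∀ z ∈ V, HasDerivAt s (2 * s z)⁻¹ z) ∧
      GoodDomain (s '' V) := by
  have hlog : HasLog (fun z => z) V := by
    refine hasLog_of_forall_isCompact hV.isOpen hV.isConnected fun K hKV hK => ?_
    have h1 : (1 : ℂ) ∉ V := fun h => by simpa using hV.subset_ball h
    have hd := hasLog_div_of_isCompact hV.isPreconnected_compl
      (isClosed_closedBall.sdiff hV.isOpen) hK
      (Set.disjoint_left.2 fun z hz hz' => hz'.2 (hKV hz)) (w := 0) (w' := 1)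
      ⟨by simp, h0⟩ ⟨by simp, h1⟩
    have h2 : HasLog (fun z => 1 - z) K := hasLog_of_norm_sub_one_lt (by fun_prop) fun z hz => by
      simpa using hV.subset_ball (hKV hz)
    have h3 : HasLog (fun _ => (-1 : ℂ)) K :=
      ⟨fun _ => Real.pi * I, continuousOn_const, fun z _ => exp_pi_mul_I⟩
    refine ((hd.mul h2).mul h3).congr fun z hz => ?_
    have : z - 1 ≠ 0 := fun h => h1 (sub_eq_zero.1 h ▸ hKV hz)
    field_simp
    ring
  obtain ⟨l, hl, hle⟩ := hlog
  set s : ℂ → ℂ := fun z => exp (l z / 2) with hs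
  have hsq : ∀ z ∈ V, s z ^ 2 = z := fun z hz => by
    rw [hs, ← exp_nat_mul]
    push_cast
    rw [mul_div_cancel₀ _ two_ne_zero, hle z hz]
  have hsne : ∀ z, s z ≠ 0 := fun z => exp_ne_zero _
  have hder : ∀ z ∈ V, HasDerivAt s (2 * s z)⁻¹ z := fun z hz => by
    refine HasDerivAt.of_local_left_inverse (f := fun z => z ^ 2) ?_ ?_ ?_ ?_
    · have := hl.continuousAt (hV.isOpen.mem_nhds hz)
      exact (this.div_const 2).cexp
    · simpa using hasDerivAt_pow 2 (s z)
    · exact mul_ne_zero two_ne_zero (hsne z)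
    · filter_upwards [hV.isOpen.mem_nhds hz] with w hw using hsq w hw
  have hsc : ContinuousOn s V := fun z hz => (hder z hz).continuousAt.continuousWithinAt
  have hball : ∀ z ∈ V, ‖s z‖ < 1 := fun z hz => by
    have h1 : ‖z‖ < 1 := by simpa using hV.subset_ball hz
    rw [← hsq z hz, norm_pow] at h1
    nlinarith [norm_nonneg (s z)]
  have hopen : IsOpen (s '' V) := isOpen_image_of_deriv_ne_zero hV.isOpen
    (fun z hz => (hder z hz).differentiableAt.differentiableWithinAt)
    (fun z hz => by rw [(hder z hz).deriv]; simp [hsne z])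
  refine ⟨s, hsq, hder, hopen, hV.isConnected.image _ hsc, ?_, ?_⟩
  · rintro _ ⟨z, hz, rfl⟩
    simpa using hball z hz
  set S : Set ℂ := (fun z => -s z) '' V with hSdef
  have hSp : IsPreconnected S := hV.isConnected.isPreconnected.image _ hsc.neg
  have hSo : IsOpen S := by
    have : S = (-·) ⁻¹' (s '' V) := by
      ext b
      constructor
      · rintro ⟨z, hz, rfl⟩
        exact ⟨z, hz, by simp⟩
      · rintro ⟨z, hz, h⟩
        exact ⟨z, hz, by simp [h]⟩
    rw [this]
    exact hopen.preimage continuous_neg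
  have hSb : S ⊆ ball 0 1 := by
    rintro _ ⟨z, hz, rfl⟩
    simpa using hball z hz
  have hdis : Disjoint (s '' V) S := by
    rw [Set.disjoint_left]
    rintro _ ⟨z, hz, rfl⟩ ⟨w, hw, hwz⟩
    have h1 : z = w := by
      rw [← hsq z hz, ← hsq w hw, ← hwz]
      ring
    subst h1
    exact hsne z (by linear_combination -hwz / 2)
  set C : Set ℂ := closedBall 0 1 \ V with hC
  have hCc : IsCompact C := (isCompact_closedBall 0 1).diff hV.isOpen
  have hC' := isPreconnected_preimage_sq hV.isPreconnected_compl hCc ⟨by simp, h0⟩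
  have hmem : ∀ b : ℂ, ‖b ^ 2‖ ≤ 1 ↔ ‖b‖ ≤ 1 := fun b => by
    rw [norm_pow, sq_le_one_iff₀ (norm_nonneg b)]
  have heq : closedBall 0 1 \ s '' V = (fun z : ℂ => z ^ 2) ⁻¹' C ∪ S := by
    ext b
    constructor
    · rintro ⟨hb, hbV⟩
      by_cases h : b ^ 2 ∈ V
      · have := hsq _ h
        rcases sq_eq_sq_iff_eq_or_eq_neg.1 this with h' | h'
        · exact absurd ⟨_, h, h'⟩ hbV
        · exact Or.inr ⟨_, h, by simp [h']⟩
      · exact Or.inl ⟨by simpa [hmem] using hb, h⟩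
    · rintro (⟨hb, hbV⟩ | hb)
      · refine ⟨by simpa [hmem] using hb, ?_⟩
        rintro ⟨z, hz, rfl⟩
        simp only [hsq z hz] at hbV
        exact hbV hz
      · exact ⟨ball_subset_closedBall (hSb hb), fun h => Set.disjoint_left.1 hdis h hb⟩
  have hfr : (frontier S).Nonempty := by
    rw [nonempty_frontier_iff]
    refine ⟨hV.isConnected.nonempty.image _, fun h => ?_⟩
    have : (1 : ℂ) ∈ S := h ▸ mem_univ _
    simpa using hSb this
  obtain ⟨b, hb⟩ := hfr
  have hbS : b ∉ S := by
    rw [hSo.frontier_eq] at hb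
    exact hb.2
  have hbc : b ∈ closure S := frontier_subset_closure hb
  rw [heq]
  have h1 : IsPreconnected (insert b S) := hSp.subset_closure (subset_insert _ _)
    (insert_subset hbc subset_closure)
  have hbC : b ∈ (fun z : ℂ => z ^ 2) ⁻¹' C := by
    refine ⟨?_, fun h => ?_⟩
    · have : b ∈ closedBall (0 : ℂ) 1 :=
        closure_minimal (hSb.trans ball_subset_closedBall) isClosed_closedBall hbc
      simpa [hmem] using this
    · rcases sq_eq_sq_iff_eq_or_eq_neg.1 (hsq _ h) with h' | h'
      · exact Set.disjoint_left.1 (hdis.closure_right hopen) ⟨_, h, h'⟩ hbc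
      · exact hbS ⟨_, h, by simp [h']⟩
  have := IsPreconnected.union b hbC (mem_insert b S) hC' h1
  rwa [union_insert, insert_eq_of_mem (mem_union_left _ hbC)] at this

theorem norm_one_sub_conj_mul_self {a : ℂ} (ha : ‖a‖ < 1) :
    ‖1 - (starRingEnd ℂ) a * a‖ = 1 - ‖a‖ ^ 2 := by
  rw [← normSq_eq_conj_mul_self, normSq_eq_norm_sq, ← ofReal_one, ← ofReal_sub, norm_real,
    Real.norm_of_nonneg]
  nlinarith [norm_nonneg a]

theorem GoodDomain.exists_koebe {V : Set ℂ} (hV : GoodDomain V) (h0 : (0 : ℂ) ∈ V) {a : ℂ}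
    (ha : ‖a‖ < 1) (haV : a ∉ V) :
    ∃ φ : ℂ → ℂ, DifferentiableOn ℂ φ V ∧ InjOn φ V ∧ (∀ z ∈ V, deriv φ z ≠ 0) ∧ φ 0 = 0 ∧
      GoodDomain (φ '' V) ∧ 2 * √‖a‖ * ‖deriv φ 0‖ = 1 + ‖a‖ := by
  have hle : ∀ z ∈ V, ‖z‖ ≤ 1 := fun z hz => by simpa using ball_subset_closedBall (hV.subset_ball hz)
  have hinj : InjOn (discShift a) V := fun z hz w hw h => by
    rw [← discShift_neg_discShift ha (hle z hz), h, discShift_neg_discShift ha (hle w hw)]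
  have haa : discShift a a = 0 := by simp [discShift]
  have ha1 : a ≠ 0 := fun h => haV (h ▸ h0)
  obtain ⟨s, hsq, hs, hsV⟩ := (hV.image_discShift ha).exists_sqrt (by
    rintro ⟨z, hz, hz0⟩
    have := discShift_neg_discShift ha (hle z hz)
    rw [hz0, ← haa, discShift_neg_discShift ha ha.le] at this
    exact haV (this ▸ hz))
  obtain ⟨b, hb⟩ : ∃ b, b = s (discShift a 0) := ⟨_, rfl⟩
  have hab : discShift a 0 = -a := by simp [discShift]
  have h0V : discShift a 0 ∈ discShift a '' V := ⟨0, h0, rfl⟩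
  have hb2 : b ^ 2 = -a := by rw [hb, hsq _ h0V, hab]
  have hbn : ‖b‖ ^ 2 = ‖a‖ := by rw [← norm_pow, hb2, norm_neg]
  have hb1 : ‖b‖ < 1 := by simpa [← hb] using hsV.subset_ball ⟨_, h0V, rfl⟩
  have hb0 : b ≠ 0 := fun h => ha1 (by simpa [h] using hb2)
  have hsinj : InjOn s (discShift a '' V) := fun z hz w hw h => by
    rw [← hsq z hz, h, hsq w hw]
  have hsle : ∀ z ∈ s '' (discShift a '' V), ‖z‖ ≤ 1 := fun z hz => by
    simpa using ball_subset_closedBall (hsV.subset_ball hz)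
  have hder : ∀ z ∈ V, HasDerivAt (fun z => discShift b (s (discShift a z)))
      ((1 - (starRingEnd ℂ) b * b) / (1 - (starRingEnd ℂ) b * s (discShift a z)) ^ 2 *
        ((2 * s (discShift a z))⁻¹ *
          ((1 - (starRingEnd ℂ) a * a) / (1 - (starRingEnd ℂ) a * z) ^ 2))) z := fun z hz =>
    HasDerivAt.comp (h₂ := discShift b) z
      (hasDerivAt_discShift hb1 (hsle _ ⟨_, ⟨z, hz, rfl⟩, rfl⟩))
      (HasDerivAt.comp z (hs _ ⟨z, hz, rfl⟩) (hasDerivAt_discShift ha (hle z hz)))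
  refine ⟨fun z => discShift b (s (discShift a z)),
    fun z hz => (hder z hz).differentiableAt.differentiableWithinAt, ?_, ?_, ?_, ?_, ?_⟩
  · intro z hz w hw h
    dsimp only at h
    refine hinj hz hw (hsinj ⟨z, hz, rfl⟩ ⟨w, hw, rfl⟩ ?_)
    rw [← discShift_neg_discShift hb1 (hsle _ ⟨_, ⟨z, hz, rfl⟩, rfl⟩), h,
      discShift_neg_discShift hb1 (hsle _ ⟨_, ⟨w, hw, rfl⟩, rfl⟩)]
  · intro z hz
    rw [(hder z hz).deriv]
    have h1 := one_sub_conj_mul_ne_zero hb1 hb1.le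
    have h2 := one_sub_conj_mul_ne_zero hb1 (hsle _ ⟨_, ⟨z, hz, rfl⟩, rfl⟩)
    have h3 := one_sub_conj_mul_ne_zero ha ha.le
    have h4 := one_sub_conj_mul_ne_zero ha (hle z hz)
    have h5 : s (discShift a z) ≠ 0 := fun h => by
      have h6 := hsq _ ⟨z, hz, rfl⟩
      rw [h] at h6
      have := discShift_neg_discShift ha (hle z hz)
      rw [← h6, zero_pow two_ne_zero, ← haa, discShift_neg_discShift ha ha.le] at this
      exact haV (this ▸ hz)
    exact mul_ne_zero (div_ne_zero h1 (pow_ne_zero 2 h2)) (mul_ne_zero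
      (inv_ne_zero (mul_ne_zero two_ne_zero h5)) (div_ne_zero h3 (pow_ne_zero 2 h4)))
  · simp only [← hb]
    simp [discShift]
  · have := hsV.image_discShift hb1
    rwa [image_image, image_image] at this
  · rw [(hder 0 h0).deriv, ← hb]
    have h1 : 0 < ‖b‖ := norm_pos_iff.2 hb0
    have h2 : 0 < 1 - ‖b‖ ^ 2 := by nlinarith
    simp only [norm_mul, norm_div, norm_pow, norm_inv, norm_one_sub_conj_mul_self hb1,
      norm_one_sub_conj_mul_self ha, mul_zero, sub_zero, norm_one, norm_ofNat]
    rw [← hbn, Real.sqrt_sq h1.le]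
    field_simp
    ring

theorem exists_tendstoLocallyUniformlyOn {V : Set ℂ} (F : ℕ → ℂ → ℂ)
    (u : Ultrafilter ℕ) {C : ℝ} (h : ∀ z ∈ V, ∃ r > 0, ball z r ⊆ V ∧
      ∀ᶠ n in (u : Filter ℕ), DifferentiableOn ℂ (F n) (ball z r) ∧ ∀ w ∈ ball z r, ‖F n w‖ ≤ C) :
    ∃ G : ℂ → ℂ, DifferentiableOn ℂ G V ∧ TendstoLocallyUniformlyOn F G u V := by
  have hlim : ∀ z ∈ V, ∃ y, Tendsto (fun n => F n z) u (𝓝 y) := by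
    intro z hz
    obtain ⟨r, hr, -, hn⟩ := h z hz
    obtain ⟨y, -, hy⟩ := (isCompact_closedBall (0 : ℂ) C).ultrafilter_le_nhds
      (u.map (fun n => F n z)) (by
        rw [le_principal_iff, Ultrafilter.mem_coe, Ultrafilter.mem_map]
        filter_upwards [hn] with n hn
        simpa using hn.2 z (mem_ball_self hr))
    exact ⟨y, hy⟩
  choose! G hG using hlim
  have hloc : TendstoLocallyUniformlyOn F G u V := by
    rw [Metric.tendstoLocallyUniformlyOn_iff]
    intro ε hε z hz
    obtain ⟨r, hr, hrV, hn⟩ := h z hz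
    have hC : 0 ≤ C := by
      obtain ⟨n, hn⟩ := hn.exists
      exact (norm_nonneg _).trans (hn.2 z (mem_ball_self hr))
    set K := (2 * C) / r
    have hK : 0 ≤ K := by positivity
    have hlip : ∀ᶠ n in (u : Filter ℕ), ∀ w ∈ ball z r, dist (F n w) (F n z) ≤ K * dist w z := by
      filter_upwards [hn] with n hn w hw
      refine dist_le_div_mul_dist_of_mapsTo_ball hn.1 (fun x hx => ?_) hw
      rw [mem_closedBall, dist_eq_norm]
      linarith [norm_sub_le (F n x) (F n z), hn.2 x hx, hn.2 z (mem_ball_self hr)]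
    have hGlip : ∀ w ∈ ball z r, dist (G w) (G z) ≤ K * dist w z := by
      intro w hw
      refine le_of_tendsto ((hG w (hrV hw)).dist (hG z hz)) ?_
      filter_upwards [hlip] with n hn using hn w hw
    refine ⟨ball z (min r (ε / (3 * (K + 1)))), mem_nhdsWithin_of_mem_nhds
      (ball_mem_nhds z (by positivity)), ?_⟩
    have hz3 : ∀ᶠ n in (u : Filter ℕ), dist (F n z) (G z) < ε / 3 :=
      (Metric.tendsto_nhds.1 (hG z hz)) _ (by positivity)
    filter_upwards [hlip, hz3] with n hl h3 w hw
    have hwr : w ∈ ball z r := ball_subset_ball (min_le_left _ _) hw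
    have hd : dist w z < ε / (3 * (K + 1)) := ball_subset_ball (min_le_right _ _) hw
    have hKd : K * dist w z ≤ ε / 3 := by
      rw [lt_div_iff₀ (by positivity)] at hd
      nlinarith [dist_nonneg (x := w) (y := z)]
    have h1 := hGlip w hwr
    have h2 := hl w hwr
    rw [dist_comm] at h2 h3
    have := dist_triangle4 (G w) (G z) (F n z) (F n w)
    linarith
  refine ⟨G, fun z hz => ?_, hloc⟩
  obtain ⟨r, hr, hrV, hn⟩ := h z hz
  have := (hloc.mono hrV).differentiableOn (hn.mono fun n hn => hn.1) isOpen_ball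
  exact (this.differentiableAt (ball_mem_nhds z hr)).differentiableWithinAt

theorem eventually_exists_zero {u : Filter ℕ} [u.NeBot] {F : ℕ → ℂ → ℂ} {G : ℂ → ℂ} {p : ℂ} {R : ℝ}
    (hR : 0 < R) (hF : ∀ᶠ n in u, DifferentiableOn ℂ (F n) (ball p R))
    (hFG : TendstoLocallyUniformlyOn F G u (ball p R)) (hp : G p = 0)
    (hG : ¬ ∀ᶠ z in 𝓝 p, G z = 0) : ∀ᶠ n in u, ∃ w ∈ ball p R, F n w = 0 := by
  have hGd : DifferentiableOn ℂ G (ball p R) := hFG.differentiableOn hF isOpen_ball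
  have hGa : AnalyticAt ℂ G p := hGd.analyticAt (ball_mem_nhds p hR)
  have hne := hGa.eventually_eq_zero_or_eventually_ne_zero.resolve_left hG
  rw [eventually_nhdsWithin_iff] at hne
  obtain ⟨r, hr, hrne⟩ := Metric.eventually_nhds_iff_ball.1 hne
  set ρ := min r R / 2
  have hρ : 0 < ρ := by positivity
  have hρr : ρ < r := by have := min_le_left r R; simp only [ρ]; linarith [lt_min hr hR]
  have hρR : ρ < R := by have := min_le_right r R; simp only [ρ]; linarith [lt_min hr hR]
  have hsub : closedBall p ρ ⊆ ball p R := closedBall_subset_ball hρR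
  have hcG : ContinuousOn (fun z => ‖G z‖) (sphere p ρ) :=
    (hGd.continuousOn.mono (sphere_subset_closedBall.trans hsub)).norm
  obtain ⟨x, hx, hxmin⟩ := (isCompact_sphere p ρ).exists_isMinOn
    (NormedSpace.sphere_nonempty.2 hρ.le) hcG
  have hm : 0 < ‖G x‖ := norm_pos_iff.2 (hrne x (sphere_subset_closedBall.trans
    (closedBall_subset_ball hρr) hx) (ne_of_mem_sphere hx hρ.ne'))
  have hunif := (tendstoLocallyUniformlyOn_iff_forall_isCompact isOpen_ball).1 hFG
    _ hsub (isCompact_closedBall p ρ)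
  rw [Metric.tendstoUniformlyOn_iff] at hunif
  filter_upwards [hF, hunif (‖G x‖ / 2) (by positivity)] with n hn hclose
  by_contra hno
  push Not at hno
  have hsph : ∀ z ∈ sphere p ρ, ‖G x‖ / 2 ≤ ‖F n z‖ := by
    intro z hz
    have h1 := hclose z (sphere_subset_closedBall hz)
    have h2 : ‖G x‖ ≤ ‖G z‖ := hxmin hz
    rw [dist_eq_norm] at h1
    have := norm_sub_norm_le (G z) (F n z)
    linarith
  have hd : DiffContOnCl ℂ (fun z => (F n z)⁻¹) (ball p ρ) := by
    have : DifferentiableOn ℂ (fun z => (F n z)⁻¹) (ball p R) := hn.inv hno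
    refine (this.mono ?_).diffContOnCl
    exact closure_ball_subset_closedBall.trans hsub
  have := Complex.norm_le_of_forall_mem_frontier_norm_le isBounded_ball hd (C := (‖G x‖ / 2)⁻¹)
    (fun z hz => by
      rw [frontier_ball p hρ.ne'] at hz
      rw [norm_inv]
      exact inv_anti₀ (by positivity) (hsph z hz)) (subset_closure (mem_ball_self hρ))
  rw [norm_inv] at this
  have hFp : F n p ≠ 0 := hno p (mem_ball_self hR)
  have h1 := (inv_le_inv₀ (norm_pos_iff.2 hFp) (by positivity)).1 this
  have h2 := hclose p (mem_closedBall_self hρ.le)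
  rw [hp, dist_zero_left] at h2
  linarith

/-- Admissible maps in the extremal problem of the Riemann mapping theorem. -/
structure IsRiemannCandidate (U : Set ℂ) (z₀ : ℂ) (f : ℂ → ℂ) : Prop where
  diff : DifferentiableOn ℂ f U
  inj : InjOn f U
  deriv_ne : ∀ z ∈ U, deriv f z ≠ 0
  map_zero : f z₀ = 0
  good : GoodDomain (f '' U)

theorem exists_isRiemannCandidate {U : Set ℂ} (hUo : IsOpen U) (hUc : IsConnected U)
    (hUb : Bornology.IsBounded U) (hcompl : IsPreconnected Uᶜ) (z₀ : ℂ) (hz₀ : z₀ ∈ U) :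
    ∃ f, IsRiemannCandidate U z₀ f := by
  obtain ⟨R, hR⟩ := hUb.subset_ball z₀
  have hR0 : 0 < R := by simpa using hR hz₀
  have hRc : (R : ℂ) ≠ 0 := by exact_mod_cast hR0.ne'
  set f : ℂ → ℂ := fun z => (z - z₀) / R with hf
  have hd : ∀ z, HasDerivAt f (1 / R) z := fun z => ((hasDerivAt_id z).sub_const z₀).div_const _
  have hdiff : DifferentiableOn ℂ f U := fun z _ => (hd z).differentiableAt.differentiableWithinAt
  have hinj : Function.Injective f := fun z w h => by
    simp only [hf] at h
    field_simp at h
    linear_combination h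
  have hne : ∀ z ∈ U, deriv f z ≠ 0 := fun z _ => by
    rw [(hd z).deriv]
    exact one_div_ne_zero hRc
  have hball : f '' U ⊆ ball 0 1 := by
    rintro _ ⟨z, hz, rfl⟩
    have := hR hz
    rw [mem_ball, dist_eq_norm] at this
    simp only [hf, mem_ball_zero_iff, norm_div, norm_real, Real.norm_of_nonneg hR0.le]
    rwa [div_lt_one hR0]
  have hfc : Continuous f := by fun_prop
  refine ⟨f, hdiff, hinj.injOn, hne, by simp [hf], isOpen_image_of_deriv_ne_zero hUo hdiff hne,
    hUc.image _ hdiff.continuousOn, hball, ?_⟩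
  have : closedBall 0 1 \ f '' U = (fun z => ((max 1 ‖f z‖ : ℝ) : ℂ)⁻¹ * f z) '' Uᶜ := by
    ext w
    constructor
    · rintro ⟨hw, hwU⟩
      have hfw : f (w * R + z₀) = w := by simp only [hf]; field_simp; ring
      refine ⟨w * R + z₀, fun h => hwU ⟨_, h, hfw⟩, ?_⟩
      have : ‖w‖ ≤ 1 := by simpa using hw
      simp [hfw, this]
    · rintro ⟨z, hz, rfl⟩
      have hz' : f z ∉ f '' U := fun h => hz (hinj.mem_set_image.1 h)
      rcases le_or_gt ‖f z‖ 1 with h | h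
      · simpa [h] using hz'
      · have h1 : ‖((max 1 ‖f z‖ : ℝ) : ℂ)⁻¹ * f z‖ = 1 := by
          rw [max_eq_right h.le, norm_mul, norm_inv, norm_real, norm_norm,
            inv_mul_cancel₀ (by positivity)]
        refine ⟨by simp only [mem_closedBall_zero_iff, h1, le_refl], fun hm => ?_⟩
        have := hball hm
        rw [mem_ball_zero_iff, h1] at this
        exact lt_irrefl _ this
  rw [this]
  refine hcompl.image _ (Continuous.continuousOn ?_)
  refine Continuous.mul (Continuous.inv₀ (by fun_prop) fun z => ?_) hfc
  have : 0 < max 1 ‖f z‖ := by positivity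
  exact_mod_cast this.ne'

theorem IsRiemannCandidate.exists_koebe {U : Set ℂ} {z₀ : ℂ} {f : ℂ → ℂ} (hUo : IsOpen U)
    (hz₀ : z₀ ∈ U) (hf : IsRiemannCandidate U z₀ f) {a : ℂ} (ha : ‖a‖ < 1) (haU : a ∉ f '' U) :
    ∃ g, IsRiemannCandidate U z₀ g ∧ 2 * √‖a‖ * ‖deriv g z₀‖ = (1 + ‖a‖) * ‖deriv f z₀‖ := by
  obtain ⟨φ, h1, h2, h3, h4, h5, h6⟩ := hf.good.exists_koebe ⟨z₀, hz₀, hf.map_zero⟩ ha haU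
  have hd : ∀ z ∈ U, HasDerivAt (φ ∘ f) (deriv φ (f z) * deriv f z) z := fun z hz =>
    ((h1.differentiableAt (hf.good.isOpen.mem_nhds ⟨z, hz, rfl⟩)).hasDerivAt).comp z
      ((hf.diff.differentiableAt (hUo.mem_nhds hz)).hasDerivAt)
  refine ⟨φ ∘ f, ⟨fun z hz => (hd z hz).differentiableAt.differentiableWithinAt,
    h2.comp hf.inj (mapsTo_image _ _), fun z hz => ?_, by simp [hf.map_zero, h4], ?_⟩, ?_⟩
  · rw [(hd z hz).deriv]
    exact mul_ne_zero (h3 _ ⟨z, hz, rfl⟩) (hf.deriv_ne z hz)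
  · rwa [image_comp]
  · rw [(hd z₀ hz₀).deriv, hf.map_zero, norm_mul, ← mul_assoc, h6]

theorem exists_seq_isRiemannCandidate {U : Set ℂ} (hUo : IsOpen U) (hUc : IsConnected U)
    (hUb : Bornology.IsBounded U) (hcompl : IsPreconnected Uᶜ) (z₀ : ℂ) (hz₀ : z₀ ∈ U) :
    ∃ (f : ℕ → ℂ → ℂ) (C : ℝ), (∀ n, IsRiemannCandidate U z₀ (f n)) ∧
      (∀ n, ‖deriv (f n) z₀‖ ≤ C) ∧ ∀ r < 1, ∀ᶠ n in atTop, ball 0 r ⊆ f n '' U := by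
  set S : Set ℝ := {x | ∃ f, IsRiemannCandidate U z₀ f ∧ x = ‖deriv f z₀‖} with hS
  obtain ⟨f₀, hf₀⟩ := exists_isRiemannCandidate hUo hUc hUb hcompl z₀ hz₀
  have hSne : S.Nonempty := ⟨_, f₀, hf₀, rfl⟩
  obtain ⟨ε, hε, hεU⟩ := Metric.isOpen_iff.1 hUo z₀ hz₀
  have hSb : BddAbove S := by
    refine ⟨1 / ε, ?_⟩
    rintro _ ⟨f, hf, rfl⟩
    refine Complex.norm_deriv_le_div_of_mapsTo_ball (hf.diff.mono hεU) (fun z hz => ?_) hε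
    rw [hf.map_zero]
    exact ball_subset_closedBall (hf.good.subset_ball ⟨z, hεU hz, rfl⟩)
  obtain ⟨x, -, hxlim, hxS⟩ := exists_seq_tendsto_sSup hSne hSb
  choose f hf hfx using hxS
  have hle : ∀ n, ‖deriv (f n) z₀‖ ≤ sSup S := fun n => le_csSup hSb ⟨f n, hf n, rfl⟩
  refine ⟨f, sSup S, hf, hle, fun r hr => ?_⟩
  rcases le_or_gt r 0 with hr0 | hr0
  · simp [ball_eq_empty.2 hr0]
  set M := sSup S
  have hM : 0 < M := (norm_pos_iff.2 ((hf 0).deriv_ne z₀ hz₀)).trans_le (hle 0)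
  set s := √r
  have hs : 0 < s := Real.sqrt_pos.2 hr0
  have hsr : s ^ 2 = r := Real.sq_sqrt hr0.le
  have hs1 : s < 1 := by nlinarith
  have hlt : M * (2 * s) / (1 + s ^ 2) < M := by
    rw [div_lt_iff₀ (by positivity)]
    nlinarith [mul_pos hM (pow_pos (sub_pos.2 hs1) 2)]
  filter_upwards [hxlim.eventually (lt_mem_nhds hlt)] with n hn a ha
  by_contra haU
  have har : ‖a‖ < r := by simpa using ha
  obtain ⟨g, hg, hgd⟩ := (hf n).exists_koebe hUo hz₀ (har.trans hr) haU
  have hgM : ‖deriv g z₀‖ ≤ M := le_csSup hSb ⟨g, hg, rfl⟩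
  rw [hfx n, div_lt_iff₀ (by positivity)] at hn
  set t := √‖a‖
  have ht : 0 ≤ t := Real.sqrt_nonneg _
  have htr : t ^ 2 = ‖a‖ := Real.sq_sqrt (norm_nonneg a)
  have hts : t < s := Real.sqrt_lt_sqrt (norm_nonneg a) har
  rw [← htr] at hgd
  set d := ‖deriv (f n) z₀‖
  have h1 : (1 + t ^ 2) * d ≤ 2 * t * M := by rw [← hgd]; gcongr
  have h2 : (1 + t ^ 2) * (M * (2 * s)) < (1 + t ^ 2) * (d * (1 + s ^ 2)) := by gcongr
  have h3 : (1 + t ^ 2) * d * (1 + s ^ 2) ≤ 2 * t * M * (1 + s ^ 2) := by gcongr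
  have h4 : 0 ≤ M * ((s - t) * (1 - s * t)) := by
    have : s * t ≤ 1 := by nlinarith
    exact mul_nonneg hM.le (mul_nonneg (by linarith) (by linarith))
  nlinarith

/-- The Riemann mapping theorem for bounded domains with connected complement. -/
theorem exists_riemann_map {U : Set ℂ} (hUo : IsOpen U) (hUc : IsConnected U)
    (hUb : Bornology.IsBounded U) (hcompl : IsPreconnected Uᶜ) :
    ∃ g : ℂ → ℂ, DifferentiableOn ℂ g (ball 0 1) ∧ InjOn g (ball 0 1) ∧ g '' ball 0 1 = U := by
  obtain ⟨z₀, hz₀⟩ := hUc.nonempty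
  obtain ⟨f, C, hf, hfC, hfr⟩ := exists_seq_isRiemannCandidate hUo hUc hUb hcompl z₀ hz₀
  set u : Ultrafilter ℕ := hyperfilter ℕ
  have hu : (u : Filter ℕ) ≤ atTop := Nat.hyperfilter_le_atTop
  have hfball : ∀ n, ∀ z ∈ U, ‖f n z‖ < 1 := fun n z hz => by
    simpa using (hf n).good.subset_ball ⟨z, hz, rfl⟩
  obtain ⟨F, hFd, hFl⟩ := exists_tendstoLocallyUniformlyOn (V := U) f u (C := 1) (fun z hz => by
    obtain ⟨ε, hε, hεU⟩ := Metric.isOpen_iff.1 hUo z hz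
    exact ⟨ε, hε, hεU, Eventually.of_forall fun n =>
      ⟨(hf n).diff.mono hεU, fun w hw => (hfball n w (hεU hw)).le⟩⟩)
  have hFlim : ∀ z ∈ U, Tendsto (fun n => f n z) u (𝓝 (F z)) := fun z hz =>
    hFl.tendsto_at hz
  have hFle : ∀ z ∈ U, ‖F z‖ ≤ 1 := fun z hz =>
    le_of_tendsto (hFlim z hz).norm (Eventually.of_forall fun n => (hfball n z hz).le)
  have hF0 : F z₀ = 0 := tendsto_nhds_unique (hFlim z₀ hz₀) (by
    simp only [(hf _).map_zero]
    exact tendsto_const_nhds)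
  have hFlt : ∀ z ∈ U, ‖F z‖ < 1 := by
    intro z hz
    refine lt_of_le_of_ne (hFle z hz) fun h => ?_
    have hmax : IsMaxOn (norm ∘ F) U z := fun w hw => by
      simpa [h] using hFle w hw
    have := Complex.eqOn_of_isPreconnected_of_isMaxOn_norm hUc.isPreconnected hUo hFd hz hmax hz₀
    simp only [hF0, Function.const_apply] at this
    rw [← this, norm_zero] at h
    exact zero_ne_one h
  set g : ℕ → ℂ → ℂ := fun n => Function.invFunOn (f n) U with hg
  have hgU : ∀ n, ∀ w ∈ f n '' U, g n w ∈ U := fun n w hw => Function.invFunOn_mem hw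
  have hfg : ∀ n, ∀ w ∈ f n '' U, f n (g n w) = w := fun n w hw => Function.invFunOn_eq hw
  have hgf : ∀ n, ∀ z ∈ U, g n (f n z) = z := fun n z hz =>
    (hf n).inj.leftInvOn_invFunOn hz
  have hgder : ∀ n, ∀ w ∈ f n '' U, HasDerivAt (g n) (deriv (f n) (g n w))⁻¹ w := by
    rintro n _ ⟨z, hz, rfl⟩
    have hs : HasStrictDerivAt (f n) (deriv (f n) z) z :=
      ((hf n).diff.analyticAt (hUo.mem_nhds hz)).hasStrictDerivAt
    have hc : ContinuousAt (g n) (f n z) := by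
      rw [ContinuousAt, hgf n z hz, ← hs.map_nhds_eq ((hf n).deriv_ne z hz), tendsto_map'_iff]
      refine tendsto_id.congr' ?_
      filter_upwards [hUo.mem_nhds hz] with w hw
      exact (hgf n w hw).symm
    refine HasDerivAt.of_local_left_inverse (f := f n) hc ?_ ?_ ?_
    · rw [hgf n z hz]
      exact hs.hasDerivAt
    · rw [hgf n z hz]
      exact (hf n).deriv_ne z hz
    · filter_upwards [(hf n).good.isOpen.mem_nhds ⟨z, hz, rfl⟩] with w hw using hfg n w hw
  have hgd : ∀ n, DifferentiableOn ℂ (g n) (f n '' U) := fun n w hw =>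
    (hgder n w hw).differentiableAt.differentiableWithinAt
  obtain ⟨D, hD⟩ := hUb.exists_norm_le
  have hball : ∀ z ∈ ball (0 : ℂ) 1, ∃ r > 0, ball z r ⊆ ball 0 1 ∧
      ∀ᶠ n in (u : Filter ℕ), ball z r ⊆ f n '' U := by
    intro z hz
    have hz1 : ‖z‖ < 1 := by simpa using hz
    refine ⟨(1 - ‖z‖) / 2, by linarith, ?_, ?_⟩
    · refine ball_subset_ball' ?_
      rw [dist_zero_right]
      linarith
    · filter_upwards [hu (hfr ((1 + ‖z‖) / 2) (by linarith))] with n hn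
      refine (ball_subset_ball' ?_).trans hn
      rw [dist_zero_right]
      linarith
  obtain ⟨G, hGd, hGl⟩ := exists_tendstoLocallyUniformlyOn (V := ball 0 1) g u (C := D)
    (fun z hz => by
      obtain ⟨r, hr, hr1, hn⟩ := hball z hz
      refine ⟨r, hr, hr1, ?_⟩
      filter_upwards [hn] with n hn
      exact ⟨(hgd n).mono hn, fun w hw => hD _ (hgU n w (hn hw))⟩)
  have hGlim : ∀ z ∈ ball (0 : ℂ) 1, Tendsto (fun n => g n z) u (𝓝 (G z)) := fun z hz =>
    hGl.tendsto_at hz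
  have h0 : (0 : ℂ) ∈ ball (0 : ℂ) 1 := by simp
  have hderiv : deriv G 0 ≠ 0 := by
    obtain ⟨r, hr, hr1, hn⟩ := hball 0 h0
    have hl := (hGl.mono hr1).deriv (hn.mono fun n hn => (hgd n).mono hn) isOpen_ball
    have ht := (hl.tendsto_at (mem_ball_self hr)).norm
    have hC : 0 < C := (norm_pos_iff.2 ((hf 0).deriv_ne z₀ hz₀)).trans_le (hfC 0)
    have : C⁻¹ ≤ ‖deriv G 0‖ := ge_of_tendsto ht (by
      filter_upwards [hn] with n hn
      have h0n := hn (mem_ball_self hr)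
      have hg0 : g n 0 = z₀ := by
        have := hgf n z₀ hz₀
        rwa [(hf n).map_zero] at this
      simp only [Function.comp, (hgder n 0 h0n).deriv, hg0, norm_inv]
      exact inv_anti₀ (norm_pos_iff.2 ((hf n).deriv_ne z₀ hz₀)) (hfC n))
    exact norm_pos_iff.1 ((inv_pos.2 hC).trans_le this)
  have hnonconst : ∀ p ∈ ball (0 : ℂ) 1, ∀ v, ¬ ∀ᶠ z in 𝓝 p, G z - v = 0 := by
    intro p hp v hv
    have heq : EqOn G (fun _ => v) (ball 0 1) :=
      (hGd.analyticOnNhd isOpen_ball).eqOn_of_preconnected_of_eventuallyEq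
        analyticOnNhd_const (convex_ball 0 1).isPreconnected hp
        (hv.mono fun z hz => sub_eq_zero.1 hz)
    refine hderiv ?_
    rw [(heq.eventuallyEq_of_mem (ball_mem_nhds 0 one_pos)).deriv_eq, deriv_const]
  have hlsub : ∀ p ∈ ball (0 : ℂ) 1, ∀ r, ball p r ⊆ ball 0 1 → ∀ (c : ℕ → ℂ) (v : ℂ),
      Tendsto c u (𝓝 v) → TendstoLocallyUniformlyOn (fun n z => g n z - c n)
        (fun z => G z - v) u (ball p r) := by
    intro p hp r hr c v hc
    rw [Metric.tendstoLocallyUniformlyOn_iff]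
    intro ε hε x hx
    obtain ⟨t, ht, htn⟩ := Metric.tendstoLocallyUniformlyOn_iff.1 (hGl.mono hr) (ε / 2)
      (half_pos hε) x hx
    refine ⟨t, ht, ?_⟩
    filter_upwards [htn, Metric.tendsto_nhds.1 hc _ (half_pos hε)] with n h1 h2 y hy
    have h3 := h1 y hy
    rw [dist_comm] at h2
    exact (dist_sub_sub_le _ _ _ _).trans_lt (by linarith)
  refine ⟨G, hGd, ?_, ?_⟩
  · intro p hp q hq hpq
    by_contra hne
    obtain ⟨r, hr, hr1, hn⟩ := hball p hp
    obtain ⟨r', hr', hr1', hn'⟩ := hball q hq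
    set ρ := min r (dist p q)
    have hρ : 0 < ρ := lt_min hr (dist_pos.2 hne)
    have hρr : ball p ρ ⊆ ball p r := ball_subset_ball (min_le_left _ _)
    have hz := eventually_exists_zero hρ (u := (u : Filter ℕ)) (F := fun n z => g n z - g n q)
      (G := fun z => G z - G q)
      (hn.mono fun n hn => ((hgd n).mono (hρr.trans hn)).sub_const _)
      (hlsub p hp ρ (hρr.trans hr1) _ _ (hGlim q hq)) (by simp [hpq]) (hnonconst p hp _)
    obtain ⟨n, ⟨w, hw, hwz⟩, h1, h2⟩ := (hz.and (hn.and hn')).exists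
    have hwq : w = q := by
      rw [← hfg n w (h1 (hρr hw)), sub_eq_zero.1 hwz, hfg n q (h2 (mem_ball_self hr'))]
    rw [hwq, mem_ball, dist_comm] at hw
    exact absurd (min_le_right r (dist p q)) (not_le.2 hw)
  · apply Subset.antisymm
    · rintro _ ⟨p, hp, rfl⟩
      by_contra hnot
      obtain ⟨r, hr, hr1, hn⟩ := hball p hp
      have hz := eventually_exists_zero hr (u := (u : Filter ℕ)) (F := fun n z => g n z - G p)
        (G := fun z => G z - G p) (hn.mono fun n hn => ((hgd n).mono hn).sub_const _)
        (hlsub p hp r hr1 _ _ tendsto_const_nhds) (by simp) (hnonconst p hp _)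
      obtain ⟨n, ⟨w, hw, hwz⟩, h1⟩ := (hz.and hn).exists
      exact hnot (sub_eq_zero.1 hwz ▸ hgU n w (h1 hw))
    · intro z hz
      have hFz : F z ∈ ball (0 : ℂ) 1 := by simpa using hFlt z hz
      refine ⟨F z, hFz, ?_⟩
      have hev : ∀ᶠ n in (u : Filter ℕ), f n z ∈ ball (0 : ℂ) 1 :=
        Eventually.of_forall fun n => by simpa using hfball n z hz
      have := hGl.tendsto_comp (hGd.continuousOn.continuousWithinAt hFz) hFz
        (tendsto_nhdsWithin_iff.2 ⟨hFlim z hz, hev⟩)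
      simp only [hgf _ z hz] at this
      exact tendsto_nhds_unique this tendsto_const_nhds

open MeasureTheory in
theorem lintegral_enorm_deriv_sq_eq {h : ℂ → ℂ} {D : Set ℂ} (hD : IsOpen D)
    (hd : DifferentiableOn ℂ h D) (hi : InjOn h D) :
    ∫⁻ z in D, ‖deriv h z‖ₑ ^ 2 = volume (h '' D) := by
  rw [← lintegral_abs_det_fderiv_eq_addHaar_image volume hD.measurableSet
    (f' := fun z => (ContinuousLinearMap.toSpanSingleton ℂ (deriv h z)).restrictScalars ℝ)
    (fun z hz => ?_) hi]
  · refine lintegral_congr fun z => ?_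
    have : ((ContinuousLinearMap.toSpanSingleton ℂ (deriv h z)).restrictScalars ℝ).det
        = Algebra.norm ℝ (deriv h z) := by
      rw [Algebra.norm_apply, ContinuousLinearMap.det]
      congr 1
      ext x
      simp [mul_comm x]
    rw [this, Algebra.norm_complex_apply, normSq_eq_norm_sq, abs_of_nonneg (by positivity),
      ENNReal.ofReal_pow (norm_nonneg _), ofReal_norm]
  · exact ((hd.differentiableAt (hD.mem_nhds hz)).hasDerivAt.hasFDerivAt.restrictScalars
      ℝ).hasFDerivWithinAt

open MeasureTheory in
theorem lintegral_ofReal_const_div {η r₀ : ℝ} (hη : 0 < η) (hr₀ : 0 < r₀) :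
    ∫⁻ r in Ioo 0 r₀, ENNReal.ofReal (η / r) = ⊤ := by
  by_contra hne
  have h1 : IntegrableOn (fun r : ℝ => η / r) (Ioo 0 r₀) := by
    refine ⟨by fun_prop, ?_⟩
    rw [hasFiniteIntegral_iff_ofReal]
    · exact lt_top_iff_ne_top.2 hne
    · filter_upwards [ae_restrict_mem measurableSet_Ioo] with r hr
      exact div_nonneg hη.le hr.1.le
  have h2 : IntervalIntegrable (fun r : ℝ => r⁻¹) volume 0 r₀ := by
    rw [intervalIntegrable_iff_integrableOn_Ioo_of_le hr₀.le]
    refine IntegrableOn.congr_fun (f := fun r => η⁻¹ * (η / r)) (h1.const_mul η⁻¹)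
      (fun r hr => ?_) measurableSet_Ioo
    simp only []
    field_simp
  rw [intervalIntegrable_inv_iff] at h2
  rcases h2 with h2 | h2
  · exact hr₀.ne h2
  · exact h2 (by simp)

open MeasureTheory in
/-- The length–area principle: there are arbitrarily small circular arcs around the boundary
point `0` of the disk `ball 1 1` whose image under `h` is short. -/
theorem exists_dist_le_of_norm_eq {h : ℂ → ℂ} (hd : DifferentiableOn ℂ h (ball 1 1))
    (hi : InjOn h (ball 1 1)) (hb : Bornology.IsBounded (h '' ball 1 1)) {ε r₀ : ℝ} (hε : 0 < ε)
    (hr₀ : 0 < r₀) :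
    ∃ r ∈ Ioo 0 r₀, ∀ z₁ ∈ ball (1 : ℂ) 1, ∀ z₂ ∈ ball (1 : ℂ) 1, ‖z₁‖ = r → ‖z₂‖ = r →
      dist (h z₁) (h z₂) ≤ ε := by
  set D : Set ℂ := ball 1 1
  have hD : IsOpen D := isOpen_ball
  let F : ℂ → ENNReal := D.indicator fun z => ‖deriv h z‖ₑ ^ 2
  have hF : Measurable F := by
    refine Measurable.indicator ?_ hD.measurableSet
    exact (measurable_deriv h).enorm.pow_const 2
  let t : ℝ := ε / (2 * Real.pi)
  have ht : 0 < t := by positivity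
  have hfin : ∫⁻ r in Ioi (0 : ℝ), ∫⁻ θ in Ioo (-Real.pi) Real.pi,
      ENNReal.ofReal r * F (Complex.polarCoord.symm (r, θ)) ≠ ⊤ := by
    have h1 := Complex.lintegral_comp_polarCoord_symm F
    rw [lintegral_indicator hD.measurableSet, lintegral_enorm_deriv_sq_eq hD hd hi,
      polarCoord_target, Measure.volume_eq_prod, setLIntegral_prod] at h1
    · simp only [smul_eq_mul] at h1
      rw [h1]
      exact hb.measure_lt_top.ne
    · have : Measurable fun p : ℝ × ℝ => Complex.polarCoord.symm p := by
        simp only [Complex.polarCoord_symm_apply]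
        fun_prop
      refine Measurable.aemeasurable ?_
      exact (ENNReal.measurable_ofReal.comp measurable_fst).smul (hF.comp this)
  obtain ⟨r, hr, hrε⟩ : ∃ r ∈ Ioo 0 r₀, ∫⁻ θ in Ioo (-Real.pi) Real.pi,
      F (Complex.polarCoord.symm (r, θ)) < ENNReal.ofReal (t * ε / r ^ 2) := by
    by_contra! hcon
    refine hfin (top_le_iff.1 ?_)
    rw [← lintegral_ofReal_const_div (mul_pos ht hε) hr₀]
    refine (setLIntegral_mono' measurableSet_Ioo fun r hr => ?_).trans
      (lintegral_mono_set Ioo_subset_Ioi_self)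
    rw [lintegral_const_mul']
    · refine le_trans (le_of_eq ?_) (mul_le_mul_right (hcon r hr) _)
      rw [← ENNReal.ofReal_mul hr.1.le]
      congr 1
      have := hr.1.ne'
      field_simp
    · exact ENNReal.ofReal_ne_top
  refine ⟨r, hr, ?_⟩
  let c : ℝ → ℂ := fun θ => r * exp (θ * I)
  have hcp : ∀ θ, Complex.polarCoord.symm (r, θ) = c θ := fun θ => by
    simp [c, Complex.polarCoord_symm_apply, exp_mul_I]
  have hcD : ∀ θ, c θ ∈ D ↔ r / 2 < Real.cos θ := by
    intro θ
    have h1 : ‖c θ - 1‖ ^ 2 = r ^ 2 - 2 * r * Real.cos θ + 1 := by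
      rw [← normSq_eq_norm_sq, normSq_apply]
      have hre : (c θ).re = r * Real.cos θ := by simp [c, exp_ofReal_mul_I_re]
      have him : (c θ).im = r * Real.sin θ := by simp [c, exp_ofReal_mul_I_im]
      simp only [sub_re, sub_im, hre, him, one_re, one_im]
      nlinarith [Real.sin_sq_add_cos_sq θ]
    rw [mem_ball, dist_eq_norm, ← sq_lt_one_iff₀ (norm_nonneg _), h1]
    have := hr.1
    constructor <;> intro h2
    · by_contra! h3
      nlinarith
    · nlinarith
  have main : ∀ θ₁ ∈ Ioo (-Real.pi) Real.pi, ∀ θ₂ ∈ Ioo (-Real.pi) Real.pi, θ₁ ≤ θ₂ → c θ₁ ∈ D →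
      c θ₂ ∈ D → dist (h (c θ₂)) (h (c θ₁)) ≤ ε := by
    intro θ₁ h₁ θ₂ h₂ hle hc₁ hc₂
    have hmem : ∀ θ ∈ Icc θ₁ θ₂, c θ ∈ D := by
      intro θ hθ
      rw [hcD] at hc₁ hc₂ ⊢
      have hab : |θ| ≤ max |θ₁| |θ₂| := abs_le_max_abs_abs hθ.1 hθ.2
      rcases le_max_iff.1 hab with h3 | h3
      · refine hc₁.trans_le ?_
        rw [← Real.cos_abs θ, ← Real.cos_abs θ₁]
        exact Real.cos_le_cos_of_nonneg_of_le_pi (abs_nonneg _) (abs_lt.2 h₁).le h3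
      · refine hc₂.trans_le ?_
        rw [← Real.cos_abs θ, ← Real.cos_abs θ₂]
        exact Real.cos_le_cos_of_nonneg_of_le_pi (abs_nonneg _) (abs_lt.2 h₂).le h3
    have hder : ∀ θ ∈ Icc θ₁ θ₂, HasDerivAt (fun θ => h (c θ)) (deriv h (c θ) * (c θ * I)) θ := by
      intro θ hθ
      have h3 : HasDerivAt c (c θ * I) θ := by
        have h4 : HasDerivAt (fun z : ℂ => r * exp (z * I)) (r * (exp (θ * I) * (1 * I))) (θ : ℂ) :=
          (((hasDerivAt_id _).mul_const I).cexp).const_mul _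
        refine h4.comp_ofReal.congr_deriv ?_
        simp [c, mul_assoc]
      exact (hd.differentiableAt (hD.mem_nhds (hmem θ hθ))).hasDerivAt.comp θ h3
    have hcd : ContDiffOn ℝ 1 (fun θ => h (c θ)) (Icc θ₁ θ₂) := by
      have h3 : ContDiffOn ℝ 1 h D := (hd.contDiffOn hD).restrict_scalars ℝ
      have h4 : ContDiff ℝ 1 c := by
        simp only [c]
        exact contDiff_const.mul ((ofRealCLM.contDiff.mul contDiff_const).cexp)
      exact h3.comp h4.contDiffOn hmem
    have h5 := enorm_sub_le_lintegral_deriv_of_contDiffOn_Icc hcd hle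
    have hnc : ∀ θ, ‖c θ‖ = r := fun θ => by
      simp [c, abs_of_pos hr.1, norm_exp_ofReal_mul_I]
    have h6 : ‖h (c θ₂) - h (c θ₁)‖ₑ ≤ ENNReal.ofReal ε := by
      refine h5.trans ?_
      have h7 : ∀ θ ∈ Icc θ₁ θ₂, ‖deriv (fun θ => h (c θ)) θ‖ₑ
          ≤ ENNReal.ofReal (t / 2) + ENNReal.ofReal (r ^ 2 / (2 * t)) * F (c θ) := by
        intro θ hθ
        rw [(hder θ hθ).deriv]
        simp only [F, indicator_of_mem (hmem θ hθ)]
        rw [← ofReal_norm, ← ofReal_norm, ← ENNReal.ofReal_pow (norm_nonneg _),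
          ← ENNReal.ofReal_mul (by positivity), ← ENNReal.ofReal_add (by positivity)
          (by positivity), norm_mul, norm_mul, hnc, norm_I]
        refine ENNReal.ofReal_le_ofReal ?_
        have h8 : 0 ≤ (t - r * ‖deriv h (c θ)‖) ^ 2 / (2 * t) := by positivity
        have h9 : (t - r * ‖deriv h (c θ)‖) ^ 2 / (2 * t) = t / 2 + r ^ 2 / (2 * t) *
            ‖deriv h (c θ)‖ ^ 2 - ‖deriv h (c θ)‖ * (r * 1) := by
          field_simp
          ring
        linarith
      calc ∫⁻ θ in Icc θ₁ θ₂, ‖deriv (fun θ => h (c θ)) θ‖ₑ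
          ≤ ∫⁻ θ in Icc θ₁ θ₂, (ENNReal.ofReal (t / 2)
              + ENNReal.ofReal (r ^ 2 / (2 * t)) * F (c θ)) :=
            setLIntegral_mono' measurableSet_Icc h7
        _ ≤ ∫⁻ θ in Ioo (-Real.pi) Real.pi, (ENNReal.ofReal (t / 2)
              + ENNReal.ofReal (r ^ 2 / (2 * t)) * F (c θ)) :=
            lintegral_mono_set fun θ hθ => ⟨h₁.1.trans_le hθ.1, hθ.2.trans_lt h₂.2⟩
        _ = ENNReal.ofReal (t / 2) * ENNReal.ofReal (2 * Real.pi)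
              + ENNReal.ofReal (r ^ 2 / (2 * t)) * ∫⁻ θ in Ioo (-Real.pi) Real.pi, F (c θ) := by
            rw [lintegral_add_left measurable_const, lintegral_const_mul' _ _ ENNReal.ofReal_ne_top,
              setLIntegral_const, Real.volume_Ioo]
            congr 3
            ring
        _ ≤ ENNReal.ofReal (t / 2) * ENNReal.ofReal (2 * Real.pi)
              + ENNReal.ofReal (r ^ 2 / (2 * t)) * ENNReal.ofReal (t * ε / r ^ 2) := by
            simp only [hcp] at hrε
            gcongr
        _ = ENNReal.ofReal ε := by
            rw [← ENNReal.ofReal_mul (by positivity), ← ENNReal.ofReal_mul (by positivity),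
              ← ENNReal.ofReal_add (by positivity) (by have := hr.1; positivity)]
            congr 1
            have := hr.1.ne'
            simp only [t]
            field_simp
            ring
    rw [dist_eq_norm]
    rw [← ofReal_norm] at h6
    exact (ENNReal.ofReal_le_ofReal_iff hε.le).1 h6
  have hpol : ∀ z ∈ D, ‖z‖ = r → c (arg z) = z ∧ arg z ∈ Ioo (-Real.pi) Real.pi := by
    intro z hz hzr
    have h1 : c (arg z) = z := by
      simp only [c]
      rw [← hzr, norm_mul_exp_arg_mul_I]
    refine ⟨h1, neg_pi_lt_arg z, lt_of_le_of_ne (arg_le_pi z) fun h2 => ?_⟩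
    have h3 := (hcD (arg z)).1 (h1.symm ▸ hz)
    rw [h2, Real.cos_pi] at h3
    linarith [hr.1]
  intro z₁ hz₁ z₂ hz₂ h₁ h₂
  obtain ⟨hp₁, hm₁⟩ := hpol z₁ hz₁ h₁
  obtain ⟨hp₂, hm₂⟩ := hpol z₂ hz₂ h₂
  rw [← hp₁, ← hp₂]
  rcases le_total (arg z₁) (arg z₂) with hle | hle
  · rw [dist_comm]
    exact main _ hm₁ _ hm₂ hle (hp₁.symm ▸ hz₁) (hp₂.symm ▸ hz₂)
  · exact main _ hm₂ _ hm₁ hle (hp₂.symm ▸ hz₂) (hp₁.symm ▸ hz₁)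

/-- Nearby points of `Y` lie in a small connected subset of `Y`. -/
def UniformlyLocallyConnected (Y : Set ℂ) : Prop :=
  ∀ ε > 0, ∃ δ > 0, ∀ p ∈ Y, ∀ q ∈ Y, dist p q < δ →
    ∃ K ⊆ Y, IsPreconnected K ∧ p ∈ K ∧ q ∈ K ∧ K ⊆ closedBall p ε

theorem hasLog_const {c : ℂ} (hc : c ≠ 0) (S : Set ℂ) : HasLog (fun _ => c) S :=
  ⟨fun _ => log c, continuousOn_const, fun _ _ => exp_log hc⟩

theorem hasLog_sub_of_notMem_closedBall {p w : ℂ} {ε : ℝ} (hw : w ∉ closedBall p ε) :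
    HasLog (fun z => z - w) (closedBall p ε) := by
  rw [mem_closedBall, not_le] at hw
  rcases lt_or_ge ε 0 with hε | hε
  · rw [closedBall_eq_empty.2 hε]
    exact ⟨fun _ => 0, continuousOn_empty _, by simp⟩
  have hne : p - w ≠ 0 := by
    intro h
    rw [sub_eq_zero.1 h, dist_self] at hw
    linarith
  refine ((hasLog_of_norm_sub_one_lt (h := fun z => (z - w) / (p - w)) (by fun_prop)
    fun z hz => ?_).mul (hasLog_const hne _)).congr fun z hz => by field_simp
  have : (z - w) / (p - w) - 1 = (z - p) / (p - w) := by field_simp; ring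
  rw [this, norm_div, div_lt_one (norm_pos_iff.2 hne), ← dist_eq_norm, ← dist_eq_norm, dist_comm p]
  exact (mem_closedBall.1 hz).trans_lt hw

theorem hasLog_div_of_mem_open {U F : Set ℂ} (hU : IsOpen U) (hUc : IsPreconnected U) {w w' : ℂ}
    (hw : w ∈ U) (hw' : w' ∈ U) (hF : IsClosed F) (hd : Disjoint F U) :
    HasLog (fun z => (z - w) / (z - w')) F := by
  obtain ⟨γ, hγ⟩ := (hU.isConnected_iff_isPathConnected.1 ⟨⟨w, hw⟩, hUc⟩).joinedIn w hw w' hw'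
  refine hasLog_div_of_isClosed (isPreconnected_range γ.continuous) (isCompact_range γ.continuous)
    hF ?_ ⟨0, γ.source⟩ ⟨1, γ.target⟩
  exact hd.mono_right (range_subset_iff.2 hγ)

theorem isOpen_image_of_injOn {h : ℂ → ℂ} {D N : Set ℂ} (hD : IsOpen D) (hN : IsOpen N)
    (hND : N ⊆ D) (hd : DifferentiableOn ℂ h D) (hi : InjOn h D) : IsOpen (h '' N) := by
  rw [isOpen_iff_mem_nhds]
  rintro _ ⟨z, hz, rfl⟩
  have han : AnalyticAt ℂ h z := hd.analyticAt (hD.mem_nhds (hND hz))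
  rcases han.eventually_constant_or_nhds_le_map_nhds with h1 | h1
  · exfalso
    obtain ⟨r, hr, hr'⟩ := Metric.eventually_nhds_iff.1 (h1.and (hD.mem_nhds (hND hz)))
    have h2 := hr' (y := z + (r / 2 : ℝ)) (by
      rw [dist_eq_norm]
      simp [abs_of_pos hr, show 0 < r from hr])
    have h3 := hi h2.2 (hND hz) h2.1
    have : (r / 2 : ℝ) = 0 := by exact_mod_cast (by simpa using h3 : ((r / 2 : ℝ) : ℂ) = 0)
    linarith
  · exact h1 (image_mem_map (hN.mem_nhds hz))

/-- Boundary behaviour: images of points leaving the domain leave the image. -/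
theorem notMem_image_of_tendsto {h : ℂ → ℂ} {D : Set ℂ} (hD : IsOpen D)
    (hd : DifferentiableOn ℂ h D) (hi : InjOn h D) {l : Filter ℂ} [l.NeBot] (hl : ∀ᶠ z in l, z ∈ D)
    {ζ y : ℂ} (hζ : ζ ∉ D) (hlζ : Tendsto id l (𝓝 ζ)) (hy : Tendsto h l (𝓝 y)) : y ∉ h '' D := by
  rintro ⟨z, hz, rfl⟩
  have hne : ζ ≠ z := fun h => hζ (h ▸ hz)
  obtain ⟨u, v, hu, hv, hζu, hzv, huv⟩ := t2_separation hne
  have h1 : h '' (v ∩ D) ∈ 𝓝 (h z) :=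
    (isOpen_image_of_injOn hD (hv.inter hD) inter_subset_right hd hi).mem_nhds ⟨z, ⟨hzv, hz⟩, rfl⟩
  obtain ⟨x, hxD, hxu, ⟨x', hx', hxx'⟩⟩ :=
    (hl.and ((hlζ.eventually (hu.mem_nhds hζu)).and (hy.eventually h1))).exists
  have : x' = x := hi hx'.2 hxD hxx'
  exact disjoint_left.1 huv hxu (this ▸ hx'.1)

theorem frontier_image_subset {h : ℂ → ℂ} {D V : Set ℂ} (hD : IsOpen D) (hV : IsOpen V)
    (hd : DifferentiableOn ℂ h D) (hi : InjOn h D) :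
    frontier (h '' (D ∩ V)) ⊆ (closure (h '' D) \ h '' D) ∪ h '' (D ∩ frontier V) := by
  have ho := isOpen_image_of_injOn hD (hD.inter hV) inter_subset_left hd hi
  intro y hy
  rw [ho.frontier_eq] at hy
  by_cases hyD : y ∈ h '' D
  · right
    obtain ⟨z, hz, rfl⟩ := hyD
    refine ⟨z, ⟨hz, ?_⟩, rfl⟩
    rw [hV.frontier_eq]
    refine ⟨?_, fun hzV => hy.2 ⟨z, ⟨hz, hzV⟩, rfl⟩⟩
    by_contra hzc
    have h1 : h '' (D ∩ (closure V)ᶜ) ∈ 𝓝 (h z) :=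
      (isOpen_image_of_injOn hD (hD.inter isClosed_closure.isOpen_compl) inter_subset_left hd
        hi).mem_nhds ⟨z, ⟨hz, hzc⟩, rfl⟩
    obtain ⟨_, ⟨x, hx, rfl⟩, ⟨x', hx', hxx'⟩⟩ := mem_closure_iff_nhds.1 hy.1 _ h1
    exact hx.2 (subset_closure (hi hx'.1 hx.1 hxx' ▸ hx'.2))
  · exact Or.inl ⟨closure_mono (image_mono inter_subset_left) hy.1, hyD⟩

theorem exists_image_subset_closedBall {h : ℂ → ℂ} {U Y : Set ℂ} (hUo : IsOpen U)
    (hUc : IsConnected U) (hUb : Bornology.IsBounded U) (hY : IsClosed Y) (hUY : Disjoint U Y)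
    (hfr : closure U \ U ⊆ Y) (hYl : UniformlyLocallyConnected Y)
    (hd : DifferentiableOn ℂ h (ball 1 1)) (hi : InjOn h (ball 1 1)) (him : h '' ball 1 1 = U)
    {ε : ℝ} (hε : 0 < ε) (hε' : 2 * ε < dist (h 1) (h (3 / 2))) :
    ∃ r > 0, ∃ p, h '' (ball 1 1 ∩ ball 0 r) ⊆ closedBall p ε := by
  obtain ⟨δ, hδ, hYδ⟩ := hYl ε hε
  obtain ⟨r, ⟨hr0, hr1⟩, hr⟩ := exists_dist_le_of_norm_eq hd hi (him.symm ▸ hUb)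
    (ε := min (δ / 2) ε) (by positivity) (r₀ := 1 / 2) (by norm_num)
  set γ := closure (h '' (ball 1 1 ∩ sphere 0 r)) with hγ
  have hγd : ∀ p ∈ γ, ∀ q ∈ γ, dist p q ≤ min (δ / 2) ε := by
    intro p hp q hq
    have h1 : (p, q) ∈ closure ((h '' (ball 1 1 ∩ sphere 0 r)) ×ˢ
        (h '' (ball 1 1 ∩ sphere 0 r))) := by
      rw [closure_prod_eq]
      exact ⟨hp, hq⟩
    refine closure_minimal (t := {x : ℂ × ℂ | dist x.1 x.2 ≤ min (δ / 2) ε}) ?_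
      (isClosed_le (by fun_prop) continuous_const) h1
    rintro ⟨_, _⟩ ⟨⟨x, hx, rfl⟩, ⟨y, hy, rfl⟩⟩
    exact hr x hx.1 y hy.1 (by simpa using hx.2) (by simpa using hy.2)
  have hrγ : h r ∈ γ := by
    refine subset_closure ⟨r, ⟨?_, ?_⟩, rfl⟩
    · rw [mem_ball, dist_eq_norm, ← ofReal_one, ← ofReal_sub, norm_real, Real.norm_eq_abs, abs_lt]
      constructor <;> linarith
    · simp [abs_of_pos hr0]
  obtain ⟨p, K, hKY, hK, hKc, hγK, hγp, hKp⟩ : ∃ p K, K ⊆ Y ∧ IsPreconnected K ∧ IsClosed K ∧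
      γ ∩ Y ⊆ K ∧ γ ⊆ closedBall p ε ∧ K ⊆ closedBall p ε := by
    by_cases hne : ∃ p, p ∈ γ ∩ Y
    · obtain ⟨p, hpγ, hpY⟩ := hne
      have hq : ∀ q ∈ γ ∩ Y, ∃ K ⊆ Y, IsPreconnected K ∧ p ∈ K ∧ q ∈ K ∧ K ⊆ closedBall p ε :=
        fun q hq => hYδ p hpY q hq.2 (((hγd p hpγ q hq.1).trans (min_le_left _ _)).trans_lt
          (half_lt_self hδ))
      choose! K h1 h2 h3 h4 h5 using hq
      refine ⟨p, closure (⋃ q ∈ γ ∩ Y, K q), ?_, ?_, isClosed_closure, ?_, ?_, ?_⟩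
      · exact closure_minimal (iUnion₂_subset h1) hY
      · refine IsPreconnected.closure ?_
        rw [← sUnion_image]
        refine isPreconnected_sUnion p _ ?_ ?_ <;> rintro _ ⟨q, hq, rfl⟩
        exacts [h3 q hq, h2 q hq]
      · exact fun q hq => subset_closure (mem_biUnion hq (h4 q hq))
      · intro q hq
        rw [mem_closedBall, dist_comm]
        exact (hγd p hpγ q hq).trans (min_le_right _ _)
      · exact closure_minimal (iUnion₂_subset h5) isClosed_closedBall
    · refine ⟨h r, ∅, empty_subset _, isPreconnected_empty, isClosed_empty,
        fun q hq => (hne ⟨q, hq⟩).elim, fun q hq => ?_, empty_subset _⟩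
      exact (hγd q hq _ hrγ).trans (min_le_right _ _)
  refine ⟨r, hr0, p, ?_⟩
  by_contra hnot
  obtain ⟨_, ⟨v, hv, rfl⟩, hvp⟩ := not_subset.1 hnot
  obtain ⟨z₀, hz₀, hz₀p, hz₀r⟩ : ∃ z₀ ∈ ball (1 : ℂ) 1, h z₀ ∉ closedBall p ε ∧ r < ‖z₀‖ := by
    by_contra! hcon
    have h1 : h 1 ∈ closedBall p ε := by
      by_contra h2
      have := hcon 1 (by simp) h2
      simp at this
      linarith
    have h2 : h (3 / 2) ∈ closedBall p ε := by
      by_contra h2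
      have := hcon (3 / 2) (by rw [mem_ball, dist_eq_norm]; norm_num) h2
      norm_num at this
      linarith
    rw [mem_closedBall] at h1 h2
    linarith [dist_triangle_right (h 1) (h (3 / 2)) p]
  have hvU : h v ∈ U := him ▸ mem_image_of_mem h hv.1
  have hzU : h z₀ ∈ U := him ▸ mem_image_of_mem h hz₀
  refine not_hasLog_frontier (W := h '' (ball 1 1 ∩ ball 0 r)) (w := h v) (w₀ := h z₀)
    (hUb.subset (him ▸ image_mono inter_subset_left)) ⟨v, hv, rfl⟩ ?_ ?_
  · intro hcl
    have h1 : h '' (ball 1 1 ∩ (closedBall 0 r)ᶜ) ∈ 𝓝 (h z₀) :=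
      (isOpen_image_of_injOn isOpen_ball (isOpen_ball.inter isClosed_closedBall.isOpen_compl)
        inter_subset_left hd hi).mem_nhds ⟨z₀, ⟨hz₀, by simpa using hz₀r⟩, rfl⟩
    obtain ⟨_, ⟨x, hx, rfl⟩, ⟨x', hx', hxx'⟩⟩ := mem_closure_iff_nhds.1 hcl _ h1
    exact hx.2 (ball_subset_closedBall (hi hx'.1 hx.1 hxx' ▸ hx'.2))
  · have hfrs : frontier (h '' (ball 1 1 ∩ ball 0 r)) ⊆ (γ ∪ K) ∪ Y := by
      refine (frontier_image_subset isOpen_ball isOpen_ball hd hi).trans ?_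
      rw [him, frontier_ball _ hr0.ne', union_comm]
      exact union_subset_union (subset_closure.trans subset_union_left) hfr
    refine HasLog.mono ?_ hfrs
    refine HasLog.union (isClosed_closure.union hKc) hY ?_ ?_ ?_
    · rw [union_inter_distrib_right, inter_eq_left.2 hKY, union_eq_right.2 hγK]
      exact hK
    · refine HasLog.mono (S := closedBall p ε) ?_ (union_subset hγp hKp)
      exact ((hasLog_sub_of_notMem_closedBall hvp).mul
        (hasLog_sub_of_notMem_closedBall hz₀p).inv).congr fun z _ => by rw [div_eq_mul_inv]
    · exact hasLog_div_of_mem_open hUo hUc.isPreconnected hvU hzU hY hUY.symm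

theorem exists_tendsto_nhdsWithin_zero {h : ℂ → ℂ} {U Y : Set ℂ} (hUo : IsOpen U)
    (hUc : IsConnected U) (hUb : Bornology.IsBounded U) (hY : IsClosed Y) (hUY : Disjoint U Y)
    (hfr : closure U \ U ⊆ Y) (hYl : UniformlyLocallyConnected Y)
    (hd : DifferentiableOn ℂ h (ball 1 1)) (hi : InjOn h (ball 1 1)) (him : h '' ball 1 1 = U) :
    ∃ y, Tendsto h (𝓝[ball 1 1] 0) (𝓝 y) := by
  have : (𝓝[ball (1 : ℂ) 1] 0).NeBot := by
    rw [← mem_closure_iff_nhdsWithin_neBot, closure_ball _ one_ne_zero]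
    simp
  refine CompleteSpace.complete (Metric.cauchy_iff.2 ⟨this.map h, fun ε hε => ?_⟩)
  have hne : 0 < dist (h 1) (h (3 / 2)) := by
    refine dist_pos.2 fun h1 => ?_
    have h2 := hi (by simp) (by rw [mem_ball, dist_eq_norm]; norm_num) h1
    norm_num at h2
  obtain ⟨r, hr, p, hrp⟩ := exists_image_subset_closedBall hUo hUc hUb hY hUY hfr hYl hd hi him
    (ε := min (ε / 3) (dist (h 1) (h (3 / 2)) / 3)) (by positivity)
    (by linarith [min_le_right (ε / 3) (dist (h 1) (h (3 / 2)) / 3)])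
  refine ⟨h '' (ball 1 1 ∩ ball 0 r), image_mem_map ?_, fun x hx y hy => ?_⟩
  · exact inter_mem self_mem_nhdsWithin (mem_nhdsWithin_of_mem_nhds (ball_mem_nhds _ hr))
  · have h1 := (mem_closedBall.1 (hrp hx)).trans (min_le_left _ _)
    have h2 := (mem_closedBall.1 (hrp hy)).trans (min_le_left _ _)
    linarith [dist_triangle_right x y p]

theorem exists_tendsto_of_norm_eq_one {g : ℂ → ℂ} {U Y : Set ℂ} (hUo : IsOpen U)
    (hUc : IsConnected U) (hUb : Bornology.IsBounded U) (hY : IsClosed Y) (hUY : Disjoint U Y)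
    (hfr : closure U \ U ⊆ Y) (hYl : UniformlyLocallyConnected Y)
    (hd : DifferentiableOn ℂ g (ball 0 1)) (hi : InjOn g (ball 0 1)) (him : g '' ball 0 1 = U)
    {ζ : ℂ} (hζ : ‖ζ‖ = 1) : ∃ y, Tendsto g (𝓝[ball 0 1] ζ) (𝓝 y) := by
  have hζ0 : ζ ≠ 0 := norm_ne_zero_iff.1 (hζ ▸ one_ne_zero)
  have hmaps : MapsTo (fun z => ζ * (1 - z)) (ball 1 1) (ball 0 1) := fun z hz => by
    rw [mem_ball, dist_comm, dist_eq_norm] at hz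
    simpa [hζ] using hz
  have hmaps' : MapsTo (fun z => 1 - z / ζ) (ball 0 1) (ball 1 1) := fun z hz => by
    rw [mem_ball_zero_iff] at hz
    simpa [dist_eq_norm, hζ] using hz
  obtain ⟨y, hy⟩ := exists_tendsto_nhdsWithin_zero (h := fun z => g (ζ * (1 - z))) hUo hUc hUb hY
    hUY hfr hYl (hd.comp (by fun_prop) hmaps) (fun z hz w hw hzw => by
      have := hi (hmaps hz) (hmaps hw) hzw
      have := mul_left_cancel₀ hζ0 this
      linear_combination -this) (by
      rw [← him]
      apply Subset.antisymm
      · rintro _ ⟨z, hz, rfl⟩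
        exact ⟨_, hmaps hz, rfl⟩
      · rintro _ ⟨z, hz, rfl⟩
        exact ⟨_, hmaps' hz, congrArg g (by field_simp; ring)⟩)
  refine ⟨y, ?_⟩
  have h1 : Tendsto (fun z => 1 - z / ζ) (𝓝[ball 0 1] ζ) (𝓝[ball 1 1] 0) := by
    refine tendsto_nhdsWithin_iff.2 ⟨?_, ?_⟩
    · have h2 : ContinuousAt (fun z => 1 - z / ζ) ζ := by fun_prop
      have h3 := h2.tendsto
      simp only [div_self hζ0, sub_self] at h3
      exact h3.mono_left nhdsWithin_le_nhds
    · filter_upwards [self_mem_nhdsWithin] with z hz using hmaps' hz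
  refine (hy.comp h1).congr fun z => ?_
  simp only [Function.comp]
  congr 1
  field_simp
  ring

theorem closure_connectedComponentIn_diff_subset {X : Type*} [TopologicalSpace X] {S : Set X}
    {x : X} (hx : x ∈ S) :
    closure (connectedComponentIn S x) \ connectedComponentIn S x ⊆ Sᶜ := by
  rintro y ⟨hy, hy'⟩ hyS
  refine hy' (IsPreconnected.subset_connectedComponentIn (s := insert y (connectedComponentIn S x))
    (isPreconnected_connectedComponentIn.subset_closure (subset_insert _ _)
      (insert_subset hy subset_closure)) (mem_insert_of_mem _ (mem_connectedComponentIn hx))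
    (insert_subset hyS (connectedComponentIn_subset _ _)) (mem_insert _ _))

theorem isPreconnected_compl_connectedComponentIn_compl {Y : Set ℂ} (hY : IsClosed Y)
    (hYc : IsConnected Y) (x : ℂ) : IsPreconnected (connectedComponentIn Yᶜ x)ᶜ := by
  obtain ⟨y₀, hy₀⟩ := hYc.nonempty
  refine isPreconnected_of_forall y₀ fun y hy => ?_
  have hYU : Y ⊆ (connectedComponentIn Yᶜ x)ᶜ := fun z hz hz' =>
    connectedComponentIn_subset _ _ hz' hz
  by_cases hyY : y ∈ Y
  · exact ⟨Y, hYU, hy₀, hyY, hYc.isPreconnected⟩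
  have hyC : y ∈ connectedComponentIn Yᶜ y := mem_connectedComponentIn hyY
  refine ⟨Y ∪ closure (connectedComponentIn Yᶜ y), union_subset hYU ?_, Or.inl hy₀,
    Or.inr (subset_closure hyC), ?_⟩
  · refine Disjoint.subset_compl_right (Disjoint.closure_left ?_ hY.isOpen_compl.connectedComponentIn)
    refine disjoint_left.2 fun z hz hz' => hy ?_
    rw [connectedComponentIn_eq hz', ← connectedComponentIn_eq hz]
    exact hyC
  · have hne : (frontier (connectedComponentIn Yᶜ y)).Nonempty := by
      refine nonempty_frontier_iff.2 ⟨⟨y, hyC⟩, fun h => ?_⟩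
      exact connectedComponentIn_subset Yᶜ y (h ▸ mem_univ y₀) hy₀
    obtain ⟨z, hz⟩ := hne
    rw [hY.isOpen_compl.connectedComponentIn.frontier_eq] at hz
    have := closure_connectedComponentIn_diff_subset hyY hz
    rw [compl_compl] at this
    exact hYc.isPreconnected.union z this hz.1 isPreconnected_connectedComponentIn.closure

/-- A function on the closed disk, holomorphic inside, that is constant on an arc of the boundary
takes this value at the center. -/
theorem eq_center_of_eqOn_arc {G : ℂ → ℂ} (hG : ContinuousOn G (closedBall 0 1))
    (hd : DifferentiableOn ℂ G (ball 0 1)) {O : Set ℂ} (hO : IsOpen O) {ζ x : ℂ} (hζ : ‖ζ‖ = 1)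
    (hζO : ζ ∈ O) (hx : ∀ z ∈ O, ‖z‖ = 1 → G z = x) : G 0 = x := by
  let V : Set Circle := (fun c : Circle => (c : ℂ)) ⁻¹' O
  have hV : IsOpen V := hO.preimage continuous_subtype_val
  obtain ⟨t, ht⟩ := compact_covered_by_mul_left_translates (K := (univ : Set Circle)) (V := V)
    isCompact_univ ⟨⟨ζ, mem_sphere_zero_iff_norm.2 hζ⟩, by rw [hV.interior_eq]; exact hζO⟩
  let Φ : ℂ → ℂ := fun z => ∏ g ∈ t, (G (g * z) - x)
  have hball : ∀ g : Circle, MapsTo (fun z : ℂ => g * z) (ball 0 1) (ball 0 1) := fun g z hz => by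
    simpa [Circle.norm_coe] using hz
  have hcball : ∀ g : Circle, MapsTo (fun z : ℂ => g * z) (closedBall 0 1) (closedBall 0 1) :=
    fun g z hz => by
    simpa [Circle.norm_coe] using hz
  have hΦ : DiffContOnCl ℂ Φ (ball 0 1) := by
    refine ⟨?_, ?_⟩
    · refine DifferentiableOn.fun_finsetProd fun g _ => ?_
      exact (hd.comp (by fun_prop) (hball g)).sub_const _
    · rw [closure_ball _ one_ne_zero]
      refine continuousOn_finsetProd _ fun g _ => ?_
      exact (hG.comp (by fun_prop) (hcball g)).sub continuousOn_const
  have h0 : ‖Φ 0‖ ≤ 0 := by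
    refine norm_le_of_forall_mem_frontier_norm_le isBounded_ball hΦ (fun z hz => ?_)
      (subset_closure (by simp))
    rw [frontier_ball _ one_ne_zero] at hz
    obtain ⟨g, hg, hgz⟩ := mem_iUnion₂.1 (ht (mem_univ (⟨z, hz⟩ : Circle)))
    have h1 : G (g * z) = x := hx _ hgz (by simpa [Circle.norm_coe] using hz)
    rw [norm_le_zero_iff]
    exact Finset.prod_eq_zero hg (by rw [h1, sub_self])
  obtain ⟨g, -, hg⟩ := Finset.prod_eq_zero_iff.1 (norm_le_zero_iff.1 h0)
  simpa [sub_eq_zero] using hg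

/-- The chord functional: its zero set is the line through `ζ₁` and `ζ₂`. -/
def chordSide (ζ₁ ζ₂ z : ℂ) : ℝ := ((z - ζ₁) * (starRingEnd ℂ) (ζ₂ - ζ₁)).im

theorem continuous_chordSide (ζ₁ ζ₂ : ℂ) : Continuous (chordSide ζ₁ ζ₂) := by
  unfold chordSide
  fun_prop

theorem chordSide_swap (ζ₁ ζ₂ z : ℂ) : chordSide ζ₂ ζ₁ z = - chordSide ζ₁ ζ₂ z := by
  simp [chordSide]
  ring

theorem exists_chordSide_pos {ζ₁ ζ₂ : ℂ} (h₁ : ‖ζ₁‖ = 1) (h₂ : ‖ζ₂‖ = 1) (hne : ζ₁ ≠ ζ₂) :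
    ∃ ζ, ‖ζ‖ = 1 ∧ 0 < chordSide ζ₁ ζ₂ ζ := by
  have hd : 0 < ‖ζ₂ - ζ₁‖ := norm_pos_iff.2 (sub_ne_zero.2 hne.symm)
  refine ⟨I * (ζ₂ - ζ₁) / ‖ζ₂ - ζ₁‖, by simp [hd.ne'], ?_⟩
  have e1 : ζ₁.re ^ 2 + ζ₁.im ^ 2 = 1 := by
    have := normSq_eq_norm_sq ζ₁
    rw [normSq_apply, h₁] at this
    linarith
  have e2 : ζ₂.re ^ 2 + ζ₂.im ^ 2 = 1 := by
    have := normSq_eq_norm_sq ζ₂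
    rw [normSq_apply, h₂] at this
    linarith
  have e3 : ‖ζ₂ - ζ₁‖ ^ 2 = (ζ₂.re - ζ₁.re) ^ 2 + (ζ₂.im - ζ₁.im) ^ 2 := by
    rw [← normSq_eq_norm_sq, normSq_apply, sub_re, sub_im]
    ring
  set r := ‖ζ₂ - ζ₁‖
  have e4 : chordSide ζ₁ ζ₂ (I * (ζ₂ - ζ₁) / r) = r - (ζ₁.im * ζ₂.re - ζ₁.re * ζ₂.im) := by
    simp only [chordSide, map_sub, mul_im, sub_re, sub_im, conj_re, conj_im, div_ofReal_re,
      div_ofReal_im, mul_re, I_re, I_im]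
    field_simp
    nlinarith [e3]
  rw [e4]
  by_contra! hcon
  have hr2 : 0 < r ^ 2 := by positivity
  nlinarith [sq_nonneg (ζ₁.im * ζ₂.re - ζ₁.re * ζ₂.im),
    sq_nonneg (ζ₁.re * ζ₂.re + ζ₁.im * ζ₂.im - 1)]

theorem eq_or_eq_of_chordSide_eq_zero {ζ₁ ζ₂ z : ℂ} (h₁ : ‖ζ₁‖ = 1) (h₂ : ‖ζ₂‖ = 1)
    (hne : ζ₁ ≠ ζ₂) (hz : ‖z‖ = 1) (h : chordSide ζ₁ ζ₂ z = 0) : z = ζ₁ ∨ z = ζ₂ := by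
  have hd : ζ₂ - ζ₁ ≠ 0 := sub_ne_zero.2 hne.symm
  have hnorm : ∀ w : ℂ, ‖w‖ = 1 → (starRingEnd ℂ) w = w⁻¹ := fun w hw => by
    rw [inv_def, normSq_eq_norm_sq, hw]
    simp
  have hn0 : ∀ w : ℂ, ‖w‖ = 1 → w ≠ 0 := fun w hw => norm_ne_zero_iff.1 (hw ▸ one_ne_zero)
  have h3 := conj_eq_iff_im.2 h
  rw [map_mul, conj_conj] at h3
  simp only [map_sub, hnorm z hz, hnorm ζ₁ h₁, hnorm ζ₂ h₂] at h3
  have := hn0 _ hz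
  have := hn0 _ h₁
  have := hn0 _ h₂
  field_simp at h3
  have h4 : (z - ζ₁) * (z - ζ₂) * (ζ₂ - ζ₁) = 0 := by
    linear_combination h3
  rcases mul_eq_zero.1 h4 with h5 | h5
  · rcases mul_eq_zero.1 h5 with h6 | h6
    · exact Or.inl (sub_eq_zero.1 h6)
    · exact Or.inr (sub_eq_zero.1 h6)
  · exact (hd h5).elim

theorem exists_mem_closure_chordSide {G : ℂ → ℂ} {U Y : Set ℂ} (hUY : Disjoint U Y)
    (hG : ContinuousOn G (closedBall 0 1)) (hd : DifferentiableOn ℂ G (ball 0 1))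
    (him : G '' ball 0 1 = U) (hsph : ∀ z, ‖z‖ = 1 → G z ∈ Y) {ζ₁ ζ₂ x : ℂ} (h₁ : ‖ζ₁‖ = 1)
    (h₂ : ‖ζ₂‖ = 1) (hne : ζ₁ ≠ ζ₂) (hx : x ∈ Y) :
    ∃ y ∈ Y \ {x}, y ∈ closure (G '' (ball 0 1 ∩ {z | 0 < chordSide ζ₁ ζ₂ z})) := by
  have hO : IsOpen {z | 0 < chordSide ζ₁ ζ₂ z} :=
    isOpen_lt continuous_const (continuous_chordSide _ _)
  obtain ⟨ζ, hζ, hζO⟩ := exists_chordSide_pos h₁ h₂ hne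
  by_contra! hcon
  have h0 : G 0 = x := by
    refine eq_center_of_eqOn_arc hG hd hO hζ hζO fun z hzO hz => ?_
    by_contra hzx
    refine hcon (G z) ⟨hsph z hz, hzx⟩ ?_
    refine ContinuousWithinAt.mem_closure_image
      ((hG z (by simp [hz])).mono (inter_subset_left.trans ball_subset_closedBall)) ?_
    rw [inter_comm]
    refine hO.inter_closure ⟨hzO, ?_⟩
    rw [closure_ball _ one_ne_zero]
    simp [hz]
  exact disjoint_left.1 hUY (him ▸ mem_image_of_mem G (by simp)) (h0 ▸ hx)

theorem injOn_sphere_of_isPreconnected_diff {G : ℂ → ℂ} {U Y : Set ℂ} (hUo : IsOpen U)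
    (hUc : IsConnected U) (hUb : Bornology.IsBounded U) (hY : IsClosed Y) (hUY : Disjoint U Y)
    (hfr : closure U \ U ⊆ Y) (hcut : ∀ x ∈ Y, IsPreconnected (Y \ {x}))
    (hG : ContinuousOn G (closedBall 0 1)) (hd : DifferentiableOn ℂ G (ball 0 1))
    (hi : InjOn G (ball 0 1)) (him : G '' ball 0 1 = U) (hsph : ∀ z, ‖z‖ = 1 → G z ∈ Y)
    {ζ₁ ζ₂ : ℂ} (h₁ : ‖ζ₁‖ = 1) (h₂ : ‖ζ₂‖ = 1) (h : G ζ₁ = G ζ₂) : ζ₁ = ζ₂ := by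
  by_contra hne
  set σ := chordSide ζ₁ ζ₂
  have hσ : Continuous σ := continuous_chordSide _ _
  set C := G '' (closedBall 0 1 ∩ {z | σ z = 0}) with hC
  have hCc : IsCompact C := ((isCompact_closedBall _ _).inter_right
    (isClosed_eq hσ continuous_const)).image_of_continuousOn (hG.mono inter_subset_left)
  have hCY : C ∩ Y ⊆ {G ζ₁} := by
    rintro _ ⟨⟨z, ⟨hz, hz0⟩, rfl⟩, hzY⟩
    have hz1 : ‖z‖ = 1 := by
      refine le_antisymm (by simpa using hz) ?_
      by_contra! hlt
      exact disjoint_left.1 hUY (him ▸ mem_image_of_mem G (by simpa using hlt)) hzY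
    rcases eq_or_eq_of_chordSide_eq_zero h₁ h₂ hne hz1 hz0 with rfl | rfl
    · rfl
    · exact h.symm
  obtain ⟨y₁, hy₁, hy₁c⟩ := exists_mem_closure_chordSide hUY hG hd him hsph h₁ h₂ hne (hsph ζ₁ h₁)
  obtain ⟨y₂, hy₂, hy₂c⟩ := exists_mem_closure_chordSide hUY hG hd him hsph h₂ h₁ (Ne.symm hne)
    (hsph ζ₁ h₁)
  simp only [chordSide_swap ζ₁ ζ₂, Left.neg_pos_iff] at hy₂c
  change y₁ ∈ closure (G '' (ball 0 1 ∩ {z | 0 < σ z})) at hy₁c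
  change y₂ ∈ closure (G '' (ball 0 1 ∩ {z | σ z < 0})) at hy₂c
  have hYC : Y \ {G ζ₁} ⊆ Cᶜ := fun y hy hyC => hy.2 (hCY ⟨hyC, hy.1⟩)
  have hO := hCc.isClosed.isOpen_compl.connectedComponentIn (x := y₁)
  have hYO := (hcut _ (hsph ζ₁ h₁)).subset_connectedComponentIn hy₁ hYC
  obtain ⟨w₁, hw₁O, hw₁⟩ := mem_closure_iff.1 hy₁c _ hO (hYO hy₁)
  obtain ⟨w₂, hw₂O, hw₂⟩ := mem_closure_iff.1 hy₂c _ hO (hYO hy₂)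
  have ho₁ : IsOpen {z | 0 < σ z} := isOpen_lt continuous_const hσ
  have ho₂ : IsOpen {z | σ z < 0} := isOpen_lt hσ continuous_const
  have hsub : ∀ O : Set ℂ, G '' (ball 0 1 ∩ O) ⊆ U := fun O => him ▸ image_mono inter_subset_left
  refine not_hasLog_frontier (hUb.subset (hsub {z | 0 < σ z})) hw₁ (w₀ := w₂) ?_ ?_
  · intro hcl
    obtain ⟨_, ⟨x, hx, rfl⟩, ⟨x', hx', hxx'⟩⟩ := mem_closure_iff.1 hcl _
      (isOpen_image_of_injOn isOpen_ball (isOpen_ball.inter ho₂) inter_subset_left hd hi) hw₂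
    have hlt : 0 < σ x := hi hx'.1 hx.1 hxx' ▸ hx'.2
    exact lt_asymm hlt hx.2
  · refine HasLog.mono (S := C ∪ Y) ?_ ?_
    · refine HasLog.union hCc.isClosed hY ?_ ?_ ?_
      · exact (subsingleton_singleton.anti hCY).isPreconnected
      · exact hasLog_div_of_mem_open hO isPreconnected_connectedComponentIn hw₁O hw₂O hCc.isClosed
          (disjoint_right.2 fun z hz => connectedComponentIn_subset _ _ hz)
      · exact hasLog_div_of_mem_open hUo hUc.isPreconnected (hsub _ hw₁) (hsub _ hw₂) hY hUY.symm
    · refine (frontier_image_subset isOpen_ball ho₁ hd hi).trans ?_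
      rw [him, union_comm]
      refine union_subset_union ?_ hfr
      refine image_mono (inter_subset_inter ball_subset_closedBall ?_)
      exact (frontier_lt_subset_eq continuous_const hσ).trans fun z hz => (Eq.symm hz : σ z = 0)

/-- A weak form of Torhorst's theorem: a simply connected bounded complementary domain of a
uniformly locally connected closed set without cut points is a closed disk. -/
theorem nonempty_homeomorph_closure_closedBall {U Y : Set ℂ} (hUo : IsOpen U)
    (hUc : IsConnected U) (hUb : Bornology.IsBounded U) (hcompl : IsPreconnected Uᶜ)
    (hY : IsClosed Y) (hUY : Disjoint U Y) (hfr : closure U \ U ⊆ Y)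
    (hYl : UniformlyLocallyConnected Y) (hcut : ∀ x ∈ Y, IsPreconnected (Y \ {x})) :
    Nonempty (closure U ≃ₜ closedBall (0 : ℂ) 1) := by
  obtain ⟨g, hd, hi, him⟩ := exists_riemann_map hUo hUc hUb hcompl
  set G := extendFrom (ball (0 : ℂ) 1) g
  have hcl : closure (ball (0 : ℂ) 1) = closedBall 0 1 := closure_ball _ one_ne_zero
  have hGg : EqOn G g (ball 0 1) := fun z hz =>
    extendFrom_eq (subset_closure hz) (hd.continuousOn z hz)
  have hlim : ∀ z ∈ closedBall (0 : ℂ) 1, ∃ y, Tendsto g (𝓝[ball 0 1] z) (𝓝 y) := by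
    intro z hz
    rcases (mem_closedBall_zero_iff.1 hz).lt_or_eq with hlt | heq
    · exact ⟨g z, hd.continuousOn z (by simpa using hlt)⟩
    · exact exists_tendsto_of_norm_eq_one hUo hUc hUb hY hUY hfr hYl hd hi him heq
  have hG : ContinuousOn G (closedBall 0 1) := continuousOn_extendFrom hcl.ge hlim
  have hGd : DifferentiableOn ℂ G (ball 0 1) := hd.congr hGg
  have hGi : InjOn G (ball 0 1) := hi.congr hGg.symm
  have hGim : G '' ball 0 1 = U := by rw [hGg.image_eq, him]
  have hGcl : G '' closedBall 0 1 = closure U := by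
    apply Subset.antisymm
    · rw [← hcl, ← hGim]
      rw [← hcl] at hG
      exact hG.image_closure
    · refine closure_minimal (hGim ▸ image_mono ball_subset_closedBall) ?_
      exact ((isCompact_closedBall _ _).image_of_continuousOn hG).isClosed
  have hsph : ∀ z, ‖z‖ = 1 → G z ∈ Y := by
    intro z hz
    have hzc : z ∈ closedBall (0 : ℂ) 1 := by simp [hz]
    refine hfr ⟨hGcl ▸ mem_image_of_mem G hzc, ?_⟩
    rw [← hGim]
    have : (𝓝[ball (0 : ℂ) 1] z).NeBot := mem_closure_iff_nhdsWithin_neBot.1 (hcl ▸ hzc)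
    exact notMem_image_of_tendsto (l := 𝓝[ball 0 1] z) isOpen_ball hGd hGi self_mem_nhdsWithin
      (ζ := z) (by simp [hz]) (tendsto_id.mono_left nhdsWithin_le_nhds)
      ((hG z hzc).mono ball_subset_closedBall)
  have hinj : InjOn G (closedBall 0 1) := by
    intro z hz w hw hzw
    have hdis : ∀ z w : ℂ, ‖z‖ < 1 → ‖w‖ = 1 → G z ≠ G w := fun z w hz hw h =>
      disjoint_left.1 hUY (hGim ▸ mem_image_of_mem G (by simpa using hz)) (h ▸ hsph w hw)
    rcases (mem_closedBall_zero_iff.1 hz).lt_or_eq with h1 | h1 <;>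
      rcases (mem_closedBall_zero_iff.1 hw).lt_or_eq with h2 | h2
    · exact hGi (by simpa using h1) (by simpa using h2) hzw
    · exact (hdis _ _ h1 h2 hzw).elim
    · exact (hdis _ _ h2 h1 hzw.symm).elim
    · exact injOn_sphere_of_isPreconnected_diff hUo hUc hUb hY hUY hfr hcut hG hGd hGi hGim hsph
        h1 h2 hzw
  have hbij : BijOn G (closedBall 0 1) (closure U) :=
    ⟨fun z hz => hGcl ▸ mem_image_of_mem G hz, hinj, hGcl.ge⟩
  have : CompactSpace (closedBall (0 : ℂ) 1) := isCompact_iff_compactSpace.1 (isCompact_closedBall _ _)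
  refine ⟨(Continuous.homeoOfEquivCompactToT2 (f := hbij.equiv G) ?_).symm⟩
  exact (hG.domRestrict).subtype_mk _

theorem two_mul_sub_three_ne_zero (A : ℤ) : (2 * A - 3 : ℝ) ≠ 0 := by
  have : (2 * A - 3 : ℤ) ≠ 0 := by omega
  exact_mod_cast this

/-- The expanding map `[[0, -B], [1, -A]]` with `B = 2A - 3` on the complex plane. -/
def tileMap (A : ℤ) : ℂ ≃L[ℝ] ℂ :=
  LinearEquiv.toContinuousLinearEquiv
    { toFun := fun z => ⟨-(2 * A - 3) * z.im, z.re - A * z.im⟩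
      invFun := fun z => ⟨z.im - A * z.re / (2 * A - 3), -z.re / (2 * A - 3)⟩
      map_add' := fun z w => by apply Complex.ext <;> simp <;> ring
      map_smul' := fun c z => by apply Complex.ext <;> simp <;> ring
      left_inv := fun z => by
        have := two_mul_sub_three_ne_zero A
        apply Complex.ext <;> dsimp only <;> generalize (2 * A - 3 : ℝ) = b at * <;> field_simp
        ring
      right_inv := fun z => by
        have := two_mul_sub_three_ne_zero A
        apply Complex.ext <;> dsimp only <;> generalize (2 * A - 3 : ℝ) = b at * <;> field_simp
        ring }

@[simp] theorem tileMap_re (A : ℤ) (z : ℂ) : (tileMap A z).re = -(2 * A - 3) * z.im := rfl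

@[simp] theorem tileMap_im (A : ℤ) (z : ℂ) : (tileMap A z).im = z.re - A * z.im := rfl

/-- The lattice point with integer coordinates `k`. -/
def latPt (k : ℤ × ℤ) : ℂ := ⟨k.1, k.2⟩

@[simp] theorem latPt_re (k : ℤ × ℤ) : (latPt k).re = k.1 := rfl

@[simp] theorem latPt_im (k : ℤ × ℤ) : (latPt k).im = k.2 := rfl

theorem latPt_add (k l : ℤ × ℤ) : latPt (k + l) = latPt k + latPt l := by
  apply Complex.ext <;> simp

theorem latPt_sub (k l : ℤ × ℤ) : latPt (k - l) = latPt k - latPt l := by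
  apply Complex.ext <;> simp

theorem latPt_neg (k : ℤ × ℤ) : latPt (-k) = -latPt k := by
  apply Complex.ext <;> simp

@[simp] theorem latPt_zero : latPt 0 = 0 := by
  apply Complex.ext <;> simp

/-- The index of the `i`-th subtile of the tile with index `k`. -/
def subIdx (A : ℤ) (k : ℤ × ℤ) (i : ℤ) : ℤ × ℤ := (-(2 * A - 3) * k.2 + i, k.1 - A * k.2)

theorem tileMap_latPt_add (A : ℤ) (k : ℤ × ℤ) (i : ℤ) :
    tileMap A (latPt k) + i = latPt (subIdx A k i) := by
  apply Complex.ext <;> simp [subIdx]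

/-- The translate of `T` by the lattice point `k`. -/
def tl (T : Set ℂ) (k : ℤ × ℤ) : Set ℂ := {z | z - latPt k ∈ T}

theorem mem_tl {T : Set ℂ} {k : ℤ × ℤ} {z : ℂ} : z ∈ tl T k ↔ z - latPt k ∈ T := Iff.rfl

@[simp] theorem tl_zero (T : Set ℂ) : tl T 0 = T := by simp [tl]

theorem mem_tl_add {T : Set ℂ} {k l : ℤ × ℤ} {z : ℂ} :
    z + latPt l ∈ tl T (k + l) ↔ z ∈ tl T k := by
  rw [mem_tl, mem_tl, latPt_add, add_sub_add_right_eq_sub]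

theorem mem_tl_sub {T : Set ℂ} {k l : ℤ × ℤ} {z : ℂ} :
    z - latPt l ∈ tl T (k - l) ↔ z ∈ tl T k := by
  rw [mem_tl, mem_tl, latPt_sub, sub_sub_sub_cancel_right]

/-- `T` is the tile of `tileMap A` with digits `0, …, 2A - 4`. -/
structure IsTile (A : ℤ) (T : Set ℂ) : Prop where
  four_le : 4 ≤ A
  nonempty : T.Nonempty
  isCompact : IsCompact T
  mem_iff : ∀ z, z ∈ T ↔ ∃ i : ℤ, 0 ≤ i ∧ i ≤ 2 * A - 4 ∧ tileMap A z - i ∈ T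

/-- An adapted norm, contracted by the inverse of the second iterate of `tileMap A`. -/
def tileNorm (z : ℂ) : ℝ := |z.re| + 2 * |z.im|

theorem tileNorm_le {A : ℤ} (hA : 4 ≤ A) (z : ℂ) :
    tileNorm z ≤ 19 / 25 * tileNorm (tileMap A (tileMap A z)) := by
  obtain ⟨x, y⟩ := z
  simp only [tileNorm, tileMap_re, tileMap_im]
  have hA' : (4 : ℝ) ≤ A := by exact_mod_cast hA
  generalize (A : ℝ) = a at *
  obtain ⟨u, hu⟩ : ∃ u, u = -(2 * a - 3) * (x - a * y) := ⟨_, rfl⟩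
  obtain ⟨v, hv⟩ : ∃ v, v = -(2 * a - 3) * y - a * (x - a * y) := ⟨_, rfl⟩
  rw [← hu, ← hv]
  have hb : 0 < 2 * a - 3 := by linarith
  have hb0 : 2 * a - 3 ≠ 0 := hb.ne'
  have habs : ∀ c d : ℝ, 0 ≤ c → 0 ≤ d → |c * u - d * v| ≤ c * |u| + d * |v| := by
    intro c d hc hd
    refine (abs_sub _ _).trans ?_
    rw [abs_mul, abs_mul, abs_of_nonneg hc, abs_of_nonneg hd]
  have hx : x = (a ^ 2 - (2 * a - 3)) / (2 * a - 3) ^ 2 * u - a / (2 * a - 3) * v := by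
    rw [hu, hv]
    generalize hbb : 2 * a - 3 = b at *
    field_simp
    ring
  have hy : y = a / (2 * a - 3) ^ 2 * u - 1 / (2 * a - 3) * v := by
    rw [hu, hv]
    generalize hbb : 2 * a - 3 = b at *
    field_simp
    ring
  have h1 : |x| ≤ (a ^ 2 - (2 * a - 3)) / (2 * a - 3) ^ 2 * |u| + a / (2 * a - 3) * |v| := by
    rw [hx]
    exact habs _ _ (div_nonneg (by nlinarith) (by positivity)) (by positivity)
  have h2 : |y| ≤ a / (2 * a - 3) ^ 2 * |u| + 1 / (2 * a - 3) * |v| := by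
    rw [hy]
    exact habs _ _ (by positivity) (by positivity)
  have h3 : (a ^ 2 - (2 * a - 3)) / (2 * a - 3) ^ 2 + 2 * (a / (2 * a - 3) ^ 2) ≤ 19 / 25 := by
    rw [← mul_div_assoc, ← add_div, div_le_div_iff₀ (by positivity) (by norm_num)]
    nlinarith
  have h4 : a / (2 * a - 3) + 2 * (1 / (2 * a - 3)) ≤ 19 / 25 * 2 := by
    rw [← mul_div_assoc, ← add_div, div_le_iff₀ hb]
    nlinarith
  nlinarith [abs_nonneg u, abs_nonneg v, mul_le_mul_of_nonneg_right h3 (abs_nonneg u),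
    mul_le_mul_of_nonneg_right h4 (abs_nonneg v)]

theorem norm_le_tileNorm (z : ℂ) : ‖z‖ ≤ tileNorm z :=
  (norm_le_abs_re_add_abs_im z).trans (by unfold tileNorm; linarith [abs_nonneg z.im])

theorem tileNorm_le_norm (z : ℂ) : tileNorm z ≤ 3 * ‖z‖ := by
  unfold tileNorm
  linarith [abs_re_le_norm z, abs_im_le_norm z]

theorem norm_le_of_norm_iterate_le {A : ℤ} (hA : 4 ≤ A) {R : ℝ} (n : ℕ) {z : ℂ}
    (h : ‖(tileMap A)^[2 * n] z‖ ≤ R) : ‖z‖ ≤ (19 / 25) ^ n * (3 * R) := by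
  refine (norm_le_tileNorm z).trans ?_
  have : tileNorm z ≤ (19 / 25) ^ n * tileNorm ((tileMap A)^[2 * n] z) := by
    clear h
    induction n generalizing z with
    | zero => simp
    | succ n ih =>
      refine (tileNorm_le hA z).trans ?_
      have h1 := ih (z := tileMap A (tileMap A z))
      rw [show 2 * (n + 1) = 2 * n + 1 + 1 by ring, Function.iterate_succ_apply,
        Function.iterate_succ_apply, pow_succ]
      linarith
  refine this.trans ?_
  gcongr
  exact (tileNorm_le_norm _).trans (by linarith)

/-- Points whose images under high iterates of `tileMap` stay close are close. -/
theorem exists_forall_norm_lt {A : ℤ} (hA : 4 ≤ A) (R : ℝ) {ε : ℝ} (hε : 0 < ε) :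
    ∃ n, ∀ z : ℂ, ‖(tileMap A)^[n] z‖ ≤ R → ‖z‖ < ε := by
  have h1 : Tendsto (fun n : ℕ => (19 / 25 : ℝ) ^ n * (3 * R)) atTop (𝓝 (0 * (3 * R))) :=
    (tendsto_pow_atTop_nhds_zero_of_lt_one (by norm_num) (by norm_num)).mul_const _
  rw [zero_mul] at h1
  obtain ⟨n, hn⟩ := (h1.eventually_lt_const hε).exists
  exact ⟨2 * n, fun z hz => (norm_le_of_norm_iterate_le hA n hz).trans_lt hn⟩

namespace IsTile

variable {A : ℤ} {T : Set ℂ}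

theorem subset_of_forall (hT : IsTile A T) {S : Set ℂ} (hSb : Bornology.IsBounded S)
    (hS : ∀ z ∈ S, ∃ i : ℤ, 0 ≤ i ∧ i ≤ 2 * A - 4 ∧ tileMap A z - i ∈ S) : S ⊆ T := by
  have key : ∀ n : ℕ, ∀ z ∈ S, ∃ t ∈ T, ∃ s ∈ S, ∃ t₀ ∈ T,
      (tileMap A)^[n] (z - t) = s - t₀ := by
    intro n
    induction n with
    | zero =>
      intro z hz
      obtain ⟨t, ht⟩ := hT.nonempty
      exact ⟨t, ht, z, hz, t, ht, rfl⟩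
    | succ n ih =>
      intro z hz
      obtain ⟨i, hi, hi', hzS⟩ := hS z hz
      obtain ⟨t, ht, s, hs, t₀, ht₀, h⟩ := ih _ hzS
      refine ⟨(tileMap A).symm (t + i), (hT.mem_iff _).2 ⟨i, hi, hi', by simpa using ht⟩, s, hs, t₀,
        ht₀, ?_⟩
      rw [Function.iterate_succ_apply, map_sub, ContinuousLinearEquiv.apply_symm_apply, ← h]
      congr 1
      ring
  obtain ⟨R, hR⟩ := hSb.exists_norm_le
  obtain ⟨R', hR'⟩ := hT.isCompact.isBounded.exists_norm_le
  intro z hz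
  refine hT.isCompact.isClosed.closure_subset_iff.2 Subset.rfl (Metric.mem_closure_iff.2 ?_)
  intro ε hε
  obtain ⟨n, hn⟩ := exists_forall_norm_lt hT.four_le (R + R') hε
  obtain ⟨t, ht, s, hs, t₀, ht₀, h⟩ := key n z hz
  refine ⟨t, ht, ?_⟩
  rw [dist_eq_norm]
  refine hn _ ?_
  rw [h]
  exact (norm_sub_le _ _).trans (add_le_add (hR s hs) (hR' t₀ ht₀))

theorem zero_mem (hT : IsTile A T) : (0 : ℂ) ∈ T := by
  refine hT.subset_of_forall (S := {0}) Bornology.isBounded_singleton ?_ rfl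
  rintro _ rfl
  exact ⟨0, le_rfl, by linarith [hT.four_le], by simp⟩

theorem mem_tl_iff (hT : IsTile A T) {k : ℤ × ℤ} {z : ℂ} :
    z ∈ tl T k ↔ ∃ i : ℤ, 0 ≤ i ∧ i ≤ 2 * A - 4 ∧ tileMap A z ∈ tl T (subIdx A k i) := by
  rw [mem_tl, hT.mem_iff]
  simp only [mem_tl, ← tileMap_latPt_add, map_sub, sub_sub]

theorem latPt_mem_tl (hT : IsTile A T) (k : ℤ × ℤ) : latPt k ∈ tl T k := by
  rw [mem_tl, sub_self]
  exact hT.zero_mem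

theorem isCompact_tl (hT : IsTile A T) (k : ℤ × ℤ) : IsCompact (tl T k) := by
  have : tl T k = (Homeomorph.subRight (latPt k)) ⁻¹' T := rfl
  rw [this, Homeomorph.isCompact_preimage]
  exact hT.isCompact

end IsTile

/-- The candidates for translations `(x, y)` by which the tile meets itself. -/
def IsNbr (A x y : ℤ) : Prop :=
  (y = 0 ∧ -1 ≤ x ∧ x ≤ 1) ∨ (y = 1 ∧ A - 2 ≤ x ∧ x ≤ A) ∨ (y = -1 ∧ -A ≤ x ∧ x ≤ 2 - A) ∨
    (y = 2 ∧ x = 2 * A - 2) ∨ (y = -2 ∧ x = 2 - 2 * A)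

theorem false_of_extremal {A m y₁ y₂ y₃ : ℤ} (hA : 4 ≤ A) (hm : 3 ≤ m) (h₁ : |y₁| ≤ m)
    (h₂ : |y₂| ≤ m) (h₃ : |y₃| ≤ m) (h : |(2 * A - 3) * m + A * y₁ + y₂| ≤ 2 * A - 4)
    (h' : |(2 * A - 3) * y₁ + A * y₂ + y₃| ≤ 2 * A - 4) : False := by
  rw [abs_le] at *
  have hp : -y₁ = m ∨ -y₁ = m - 1 := by
    have : ¬ -y₁ ≤ m - 2 := by
      intro h0
      nlinarith
    omega
  rcases hp with hp | hp
  · obtain rfl : y₁ = -m := by omega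
    have h2 : y₂ ≤ 1 := by nlinarith
    nlinarith
  · obtain rfl : y₁ = -(m - 1) := by omega
    have h2 : y₂ ≤ -1 := by nlinarith
    nlinarith

theorem isNbr_of_bounded {A : ℤ} (hA : 4 ≤ A) {S : Set (ℤ × ℤ)} (hneg : ∀ g ∈ S, -g ∈ S)
    (hstep : ∀ g ∈ S, ∃ d : ℤ, |d| ≤ 2 * A - 4 ∧ subIdx A g d ∈ S)
    (hb : ∃ n : ℕ, ∀ g ∈ S, |g.2| ≤ n) : ∀ g ∈ S, IsNbr A g.1 g.2 := by
  have hseq : ∀ g ∈ S, ∃ y₂ y₃ : ℤ, |(2 * A - 3) * g.2 + A * (g.1 - A * g.2) + y₂| ≤ 2 * A - 4 ∧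
      |(2 * A - 3) * (g.1 - A * g.2) + A * y₂ + y₃| ≤ 2 * A - 4 ∧
      (∃ g' ∈ S, g'.2 = g.1 - A * g.2) ∧ (∃ g' ∈ S, g'.2 = y₂) ∧ ∃ g' ∈ S, g'.2 = y₃ := by
    intro g hg
    obtain ⟨d, hd, hg1⟩ := hstep g hg
    obtain ⟨d', hd', hg2⟩ := hstep _ hg1
    obtain ⟨d'', hd'', hg3⟩ := hstep _ hg2
    refine ⟨_, _, ?_, ?_, ⟨_, hg1, rfl⟩, ⟨_, hg2, rfl⟩, ⟨_, hg3, rfl⟩⟩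
    · convert hd using 2
      simp only [subIdx]
      ring
    · convert hd' using 2
      simp only [subIdx]
      ring
  have h2 : ∀ g ∈ S, |g.2| ≤ 2 := by
    obtain ⟨n, hn⟩ := hb
    induction n with
    | zero => intro g hg; exact (hn g hg).trans (by norm_num)
    | succ n ih =>
      by_cases hn2 : n + 1 ≤ 2
      · intro g hg
        exact (hn g hg).trans (by exact_mod_cast hn2)
      refine ih ?_
      have key : ∀ g ∈ S, g.2 ≠ ((n + 1 : ℕ) : ℤ) := by
        intro g hg h
        obtain ⟨y₂, y₃, h₁, h₂, ⟨g', hg', he'⟩, ⟨g'', hg'', rfl⟩, ⟨g₃, hg₃, rfl⟩⟩ := hseq g hg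
        rw [← he', h] at h₁
        rw [← he'] at h₂
        exact false_of_extremal hA (by omega) (hn _ hg') (hn _ hg'') (hn _ hg₃) h₁ h₂
      intro g hg
      have h1 := hn g hg
      have h2 := key g hg
      have h3 := key _ (hneg g hg)
      simp only [Prod.snd_neg] at h3
      rw [abs_le] at *
      push_cast at *
      omega
  intro g hg
  obtain ⟨y₂, y₃, h₁, h₂, ⟨g', hg', he'⟩, ⟨g'', hg'', rfl⟩, ⟨g₃, hg₃, rfl⟩⟩ := hseq g hg
  have a0 := h2 _ hg
  have a1 := h2 _ hg'
  have a2 := h2 _ hg''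
  have a3 := h2 _ hg₃
  rw [he'] at a1
  obtain ⟨x, y⟩ := g
  dsimp only at *
  obtain ⟨y₁, hy₁⟩ : ∃ y₁, y₁ = x - A * y := ⟨_, rfl⟩
  obtain rfl : x = y₁ + A * y := by omega
  rw [add_sub_cancel_right] at *
  generalize g''.2 = y₂ at *
  generalize g₃.2 = y₃ at *
  clear hy₁ he' hseq hstep hneg
  rw [abs_le] at *
  unfold IsNbr
  obtain ⟨l0, u0⟩ := a0
  obtain ⟨l1, u1⟩ := a1
  obtain ⟨l2, u2⟩ := a2
  interval_cases y <;> interval_cases y₁ <;> first | omega | (interval_cases y₂ <;> omega)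

namespace IsTile

variable {A : ℤ} {T : Set ℂ}

theorem isNbr (hT : IsTile A T) {k l : ℤ × ℤ} {z : ℂ} (hk : z ∈ tl T k) (hl : z ∈ tl T l) :
    IsNbr A (l.1 - k.1) (l.2 - k.2) := by
  refine isNbr_of_bounded hT.four_le (S := {g | ∃ k l : ℤ × ℤ, l - k = g ∧ (tl T k ∩ tl T l).Nonempty})
    ?_ ?_ ?_ (l - k) ⟨k, l, rfl, z, hk, hl⟩
  · rintro g ⟨k, l, rfl, z, hz⟩
    exact ⟨l, k, by abel, z, hz.2, hz.1⟩
  · rintro g ⟨k, l, rfl, z, hz, hz'⟩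
    obtain ⟨i, hi, hi', hzi⟩ := hT.mem_tl_iff.1 hz
    obtain ⟨j, hj, hj', hzj⟩ := hT.mem_tl_iff.1 hz'
    refine ⟨j - i, abs_le.2 ⟨by omega, by omega⟩, _, _, ?_, _, hzi, hzj⟩
    simp only [subIdx, Prod.ext_iff, Prod.fst_sub, Prod.snd_sub]
    constructor <;> ring
  · obtain ⟨R, hR⟩ := hT.isCompact.isBounded.exists_norm_le
    refine ⟨⌈2 * R⌉₊, ?_⟩
    rintro g ⟨k, l, rfl, z, hz, hz'⟩
    have h1 := hR _ hz
    have h2 := hR _ hz'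
    have h3 : ‖latPt (l - k)‖ ≤ 2 * R := by
      rw [latPt_sub, ← sub_sub_sub_cancel_left _ _ z]
      exact (norm_sub_le _ _).trans (by linarith)
    have h4 := (abs_im_le_norm _).trans (h3.trans (Nat.le_ceil _))
    rw [latPt_im] at h4
    exact_mod_cast h4

end IsTile

/-- The `k`-th and `l`-th tile have at least two common points. -/
def Adj₂ (T : Set ℂ) (k l : ℤ × ℤ) : Prop := (tl T k ∩ tl T l).Nontrivial

theorem tl_inter_image {T : Set ℂ} {k l k' l' : ℤ × ℤ} (h : l - k = l' - k') :
    tl T k' ∩ tl T l' = (fun z => z + latPt (k' - k)) '' (tl T k ∩ tl T l) := by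
  ext z
  have h1 : k + (k' - k) = k' := by abel
  have h2 : l + (k' - k) = l' := by
    calc l + (k' - k) = (l - k) + k' := by abel
      _ = l' := by rw [h]; abel
  constructor
  · rintro ⟨hz, hz'⟩
    refine ⟨z - latPt (k' - k), ⟨?_, ?_⟩, by simp⟩
    · rwa [← mem_tl_add (l := k' - k), h1, sub_add_cancel]
    · rwa [← mem_tl_add (l := k' - k), h2, sub_add_cancel]
  · rintro ⟨w, ⟨hw, hw'⟩, rfl⟩
    rw [← mem_tl_add (l := k' - k), h1] at hw
    rw [← mem_tl_add (l := k' - k), h2] at hw'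
    exact ⟨hw, hw'⟩

theorem nonempty_tl_inter_congr {T : Set ℂ} {k l k' l' : ℤ × ℤ} (h : l - k = l' - k') :
    (tl T k' ∩ tl T l').Nonempty ↔ (tl T k ∩ tl T l).Nonempty := by
  rw [tl_inter_image h, image_nonempty]

theorem Adj₂.symm {T : Set ℂ} {k l : ℤ × ℤ} (h : Adj₂ T k l) : Adj₂ T l k := by
  unfold Adj₂ at *
  rwa [inter_comm]

theorem eq_of_subIdx_eq {A : ℤ} {k l : ℤ × ℤ} {i j : ℤ} (hi : 0 ≤ i) (hi' : i ≤ 2 * A - 4)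
    (hj : 0 ≤ j) (hj' : j ≤ 2 * A - 4) (h : subIdx A k i = subIdx A l j) : k = l ∧ i = j := by
  obtain ⟨k1, k2⟩ := k
  obtain ⟨l1, l2⟩ := l
  simp only [subIdx, Prod.mk.injEq] at h
  obtain ⟨h1, h2⟩ := h
  have h3 : k2 = l2 := by
    have hlt : |(2 * A - 3) * (k2 - l2)| < 2 * A - 3 := by
      rw [abs_lt]
      constructor <;> linarith
    rw [abs_mul, abs_of_pos (by omega : 0 < 2 * A - 3)] at hlt
    have : |k2 - l2| < 1 := by
      by_contra hc
      push Not at hc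
      nlinarith
    rw [Int.abs_lt_one_iff] at this
    omega
  subst h3
  exact ⟨by rw [Prod.mk.injEq]; constructor <;> linarith, by linarith⟩

theorem exists_subIdx_eq {A : ℤ} (hA : 4 ≤ A) (l : ℤ × ℤ) :
    ∃ k i, 0 ≤ i ∧ i ≤ 2 * A - 4 ∧ subIdx A k i = l := by
  have hB : 0 < 2 * A - 3 := by omega
  refine ⟨(l.2 + A * -(l.1 / (2 * A - 3)), -(l.1 / (2 * A - 3))), l.1 % (2 * A - 3),
    Int.emod_nonneg _ hB.ne', ?_, ?_⟩
  · have := Int.emod_lt_of_pos l.1 hB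
    omega
  · simp only [subIdx]
    ext1
    · have := Int.emod_add_mul_ediv l.1 (2 * A - 3)
      dsimp only
      linarith
    · dsimp only
      ring

/-- The indices of the descendants of order `n` of the `k`-th tile. -/
def desc (A : ℤ) : ℕ → ℤ × ℤ → Set (ℤ × ℤ)
  | 0, k => {k}
  | n + 1, k => {l | ∃ j ∈ desc A n k, ∃ i : ℤ, 0 ≤ i ∧ i ≤ 2 * A - 4 ∧ subIdx A j i = l}

theorem eq_of_mem_desc {A : ℤ} {n : ℕ} {k k' l : ℤ × ℤ} (h : l ∈ desc A n k)
    (h' : l ∈ desc A n k') : k = k' := by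
  induction n generalizing l with
  | zero => exact (mem_singleton_iff.1 h).symm.trans (mem_singleton_iff.1 h')
  | succ n ih =>
    obtain ⟨j, hj, i, hi, hi', rfl⟩ := h
    obtain ⟨j', hj', i', hi0, hi0', he⟩ := h'
    rw [(eq_of_subIdx_eq hi hi' hi0 hi0' he.symm).1] at hj
    exact ih hj hj'

theorem finite_desc (A : ℤ) (n : ℕ) (k : ℤ × ℤ) : (desc A n k).Finite := by
  induction n with
  | zero => exact finite_singleton k
  | succ n ih =>
    refine ((ih.prod (finite_Icc (0 : ℤ) (2 * A - 4))).image (fun p => subIdx A p.1 p.2)).subset ?_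
    rintro _ ⟨j, hj, i, hi, hi', rfl⟩
    exact ⟨(j, i), ⟨hj, hi, hi'⟩, rfl⟩

theorem exists_norm_sub_latPt_le (z : ℂ) : ∃ k, ‖z - latPt k‖ ≤ 2 := by
  refine ⟨(⌊z.re⌋, ⌊z.im⌋), (norm_le_abs_re_add_abs_im _).trans ?_⟩
  have h1 := Int.abs_fract (a := z.re)
  have h2 := Int.abs_fract (a := z.im)
  have h3 := (Int.fract_lt_one z.re).le
  have h4 := (Int.fract_lt_one z.im).le
  simp only [sub_re, sub_im, latPt_re, latPt_im]
  change |Int.fract z.re| + |Int.fract z.im| ≤ 2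
  linarith

theorem finite_setOf_dist_latPt_le (z : ℂ) (r : ℝ) : {k | dist z (latPt k) ≤ r}.Finite := by
  obtain ⟨N, hN⟩ := exists_nat_ge (‖z‖ + r)
  refine (finite_Icc ((-N, -N) : ℤ × ℤ) (N, N)).subset ?_
  intro k hk
  have h1 : ‖latPt k‖ ≤ N := by
    rw [mem_ofPred_eq, dist_eq_norm] at hk
    calc ‖latPt k‖ = ‖z - (z - latPt k)‖ := by rw [sub_sub_cancel]
      _ ≤ ‖z‖ + ‖z - latPt k‖ := norm_sub_le _ _
      _ ≤ N := by linarith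
  have h2 := abs_le.1 ((abs_re_le_norm _).trans h1)
  have h3 := abs_le.1 ((abs_im_le_norm _).trans h1)
  rw [latPt_re] at h2
  rw [latPt_im] at h3
  exact ⟨⟨by exact_mod_cast h2.1, by exact_mod_cast h3.1⟩,
    ⟨by exact_mod_cast h2.2, by exact_mod_cast h3.2⟩⟩

namespace IsTile

variable {A : ℤ} {T : Set ℂ}

theorem nonempty_of_subIdx (hT : IsTile A T) {k l : ℤ × ℤ} {i j : ℤ} (hi : 0 ≤ i)
    (hi' : i ≤ 2 * A - 4) (hj : 0 ≤ j) (hj' : j ≤ 2 * A - 4)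
    (h : (tl T (subIdx A k i) ∩ tl T (subIdx A l j)).Nonempty) : (tl T k ∩ tl T l).Nonempty := by
  obtain ⟨z, hz, hz'⟩ := h
  refine ⟨(tileMap A).symm z, hT.mem_tl_iff.2 ⟨i, hi, hi', ?_⟩, hT.mem_tl_iff.2 ⟨j, hj, hj', ?_⟩⟩
  all_goals rwa [ContinuousLinearEquiv.apply_symm_apply]

theorem nonempty_inter_tl_tip (hT : IsTile A T) : (tl T 0 ∩ tl T (2 * A - 2, 2)).Nonempty := by
  have hA : (4 : ℝ) ≤ A := by exact_mod_cast hT.four_le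
  obtain ⟨t, ht⟩ : ∃ t : ℝ, t * (3 * A - 2) = 1 := ⟨_, inv_mul_cancel₀ (by linarith)⟩
  obtain ⟨q, hq⟩ : ∃ q : ℂ, q = ⟨t * (2 * A ^ 2 - 4 * A + 4), t * (2 * A)⟩ := ⟨_, rfl⟩
  have h1 : tileMap A q = q - latPt (2 * A - 2, 2) := by
    rw [hq]
    apply Complex.ext <;> simp
    · linear_combination (-(2 * A - 2) : ℝ) * ht
    · linear_combination (-2 : ℝ) * ht
  have h2 : tileMap A (q - latPt (2 * A - 2, 2)) - (2 * A - 4 : ℤ) = q := by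
    rw [hq]
    apply Complex.ext <;> simp
    · linear_combination (-(2 * A - 2) : ℝ) * ht
    · linear_combination (-2 : ℝ) * ht
  have key : ({q, q - latPt (2 * A - 2, 2)} : Set ℂ) ⊆ T := by
    refine hT.subset_of_forall (toFinite _).isBounded ?_
    have := hT.four_le
    rintro _ (rfl | rfl)
    · exact ⟨0, le_rfl, by omega, Or.inr (by simp [h1])⟩
    · exact ⟨2 * A - 4, by omega, le_rfl, Or.inl h2⟩
  exact ⟨q, by simpa using key (Or.inl rfl), key (Or.inr rfl)⟩

theorem nonempty_inter_tl_edge (hT : IsTile A T) : (tl T 0 ∩ tl T (A - 2, 1)).Nonempty := by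
  have := hT.four_le
  refine hT.nonempty_of_subIdx (i := 1) (j := 0) (by omega) (by omega) le_rfl (by omega) ?_
  rw [inter_comm]
  refine (nonempty_tl_inter_congr ?_).2 hT.nonempty_inter_tl_tip
  ext <;> simp [subIdx] <;> ring

theorem adj₂_of_nonempty (hT : IsTile A T) {k l : ℤ × ℤ} {i j : ℤ} (hi : 0 ≤ i)
    (hi' : i + 1 ≤ 2 * A - 4) (hj : 0 ≤ j) (hj' : j + 1 ≤ 2 * A - 4)
    (h : (tl T (subIdx A k i) ∩ tl T (subIdx A l j)).Nonempty) : Adj₂ T k l := by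
  obtain ⟨z, hz, hz'⟩ := h
  refine ⟨(tileMap A).symm z, ⟨hT.mem_tl_iff.2 ⟨i, hi, by omega, ?_⟩,
    hT.mem_tl_iff.2 ⟨j, hj, by omega, ?_⟩⟩, (tileMap A).symm (z + latPt (1, 0)),
    ⟨hT.mem_tl_iff.2 ⟨i + 1, by omega, hi', ?_⟩, hT.mem_tl_iff.2 ⟨j + 1, by omega, hj', ?_⟩⟩, ?_⟩
  any_goals rw [ContinuousLinearEquiv.apply_symm_apply]
  · exact hz
  · exact hz'
  · convert mem_tl_add.2 hz using 2
    ext <;> simp [subIdx]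
    ring
  · convert mem_tl_add.2 hz' using 2
    ext <;> simp [subIdx]
    ring
  · intro h
    have := congrArg Complex.re ((tileMap A).symm.injective h)
    simp at this

theorem adj₂_add_right (hT : IsTile A T) {k l : ℤ × ℤ} (h : l = k + (1, 0)) : Adj₂ T k l := by
  have := hT.four_le
  refine hT.adj₂_of_nonempty (i := 0) (j := A - 2) le_rfl (by omega) (by omega) (by omega) ?_
  refine (nonempty_tl_inter_congr ?_).2 hT.nonempty_inter_tl_edge
  subst h
  ext <;> simp [subIdx]

theorem adj₂_add_up (hT : IsTile A T) {k l : ℤ × ℤ} (h : l = k + (A - 1, 1)) : Adj₂ T k l := by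
  have := hT.four_le
  refine hT.adj₂_of_nonempty (i := 0) (j := A - 1) le_rfl (by omega) (by omega) (by omega) ?_
  rw [inter_comm]
  refine (nonempty_tl_inter_congr ?_).2 hT.nonempty_inter_tl_edge
  subst h
  ext <;> simp [subIdx] <;> ring

theorem mem_tl_iff_desc (hT : IsTile A T) (n : ℕ) {k : ℤ × ℤ} {z : ℂ} :
    z ∈ tl T k ↔ ∃ l ∈ desc A n k, (tileMap A)^[n] z ∈ tl T l := by
  induction n with
  | zero => simp [desc]
  | succ n ih =>
    rw [ih]
    simp only [Function.iterate_succ_apply']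
    constructor
    · rintro ⟨l, hl, h⟩
      obtain ⟨i, hi, hi', h'⟩ := hT.mem_tl_iff.1 h
      exact ⟨_, ⟨l, hl, i, hi, hi', rfl⟩, h'⟩
    · rintro ⟨_, ⟨l, hl, i, hi, hi', rfl⟩, h⟩
      exact ⟨l, hl, hT.mem_tl_iff.2 ⟨i, hi, hi', h⟩⟩

theorem locallyFinite_tl (hT : IsTile A T) : LocallyFinite (tl T) := by
  intro z
  obtain ⟨R, hR⟩ := hT.isCompact.isBounded.exists_norm_le
  refine ⟨ball z 1, ball_mem_nhds z one_pos, (finite_setOf_dist_latPt_le z (1 + R)).subset ?_⟩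
  rintro k ⟨w, hw, hw'⟩
  rw [mem_ball, dist_comm] at hw'
  have h1 := hR _ hw
  rw [← dist_eq_norm] at h1
  exact (dist_triangle _ _ _).trans (add_le_add hw'.le h1)

theorem isClosed_biUnion_tl (hT : IsTile A T) (K : Set (ℤ × ℤ)) : IsClosed (⋃ k ∈ K, tl T k) := by
  rw [biUnion_eq_iUnion]
  exact (hT.locallyFinite_tl.comp_injective Subtype.val_injective).isClosed_iUnion
    fun k => (hT.isCompact_tl k).isClosed

theorem iUnion_tl (hT : IsTile A T) : ⋃ k, tl T k = univ := by
  have hcl : IsClosed (⋃ k, tl T k) :=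
    hT.locallyFinite_tl.isClosed_iUnion fun k => (hT.isCompact_tl k).isClosed
  have hstep : ∀ n z, (tileMap A)^[n] z ∈ ⋃ k, tl T k → z ∈ ⋃ k, tl T k := by
    intro n
    induction n with
    | zero => exact fun z hz => hz
    | succ n ih =>
      intro z hz
      refine ih z ?_
      rw [Function.iterate_succ_apply', mem_iUnion] at hz
      obtain ⟨l, hl⟩ := hz
      obtain ⟨k, i, hi, hi', rfl⟩ := exists_subIdx_eq hT.four_le l
      exact mem_iUnion.2 ⟨k, hT.mem_tl_iff.2 ⟨i, hi, hi', hl⟩⟩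
  refine eq_univ_of_forall fun z => hcl.closure_subset_iff.2 Subset.rfl
    (Metric.mem_closure_iff.2 fun ε hε => ?_)
  obtain ⟨n, hn⟩ := exists_forall_norm_lt hT.four_le 2 hε
  obtain ⟨k, hk⟩ := exists_norm_sub_latPt_le ((tileMap A)^[n] z)
  have h1 : (tileMap A)^[n] ((tileMap A).symm^[n] (latPt k)) = latPt k :=
    Function.LeftInverse.iterate (tileMap A).apply_symm_apply n _
  refine ⟨(tileMap A).symm^[n] (latPt k), hstep n _ ?_, ?_⟩
  · rw [h1]
    exact mem_iUnion.2 ⟨k, hT.latPt_mem_tl k⟩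
  · rw [dist_eq_norm]
    refine hn _ ?_
    rwa [iterate_map_sub, h1]

theorem eq_zero_of_latPt_mem (hT : IsTile A T) {k : ℤ × ℤ} (hk : latPt k ∈ T) : k = 0 := by
  have hA := hT.four_le
  have h0 : ∀ u v : ℤ, latPt (v + A * u, u) ∈ T → IsNbr A (v + A * u) u := by
    intro u v h
    simpa using hT.isNbr (k := 0) (by simpa using h) (hT.latPt_mem_tl (v + A * u, u))
  have hstep : ∀ u v : ℤ, latPt (v + A * u, u) ∈ T → ∃ w : ℤ, latPt (w + A * v, v) ∈ T ∧
      (2 * A - 3) * u + A * v + w ≤ 0 ∧ -(2 * A - 4) ≤ (2 * A - 3) * u + A * v + w := by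
    intro u v h
    obtain ⟨i, hi, hi', h'⟩ := (hT.mem_iff _).1 h
    refine ⟨-(2 * A - 3) * u - i - A * v, ?_, by linarith, by linarith⟩
    convert h' using 1
    apply Complex.ext <;> simp
  have h1 : ∀ u v : ℤ, latPt (v + A * u, u) ∈ T → u = 0 ∧ v = 0 ∨ u = 0 ∧ v = -1 ∨
      u = -1 ∧ v = 1 ∨ u = -1 ∧ v = 0 ∨ u = 1 ∧ v = -2 ∨ u = -2 ∧ v = 2 := by
    intro u v h
    obtain ⟨w, hw, h1, h2⟩ := hstep u v h
    have h3 := h0 _ _ h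
    have h4 := h0 _ _ hw
    unfold IsNbr at h3 h4
    rcases h3 with ⟨rfl, h3⟩ | ⟨rfl, h3⟩ | ⟨rfl, h3⟩ | ⟨rfl, h3⟩ | ⟨rfl, h3⟩ <;>
    rcases h4 with ⟨rfl, h4⟩ | ⟨rfl, h4⟩ | ⟨rfl, h4⟩ | ⟨rfl, h4⟩ | ⟨rfl, h4⟩ <;> omega
  have h2 : ∀ u v : ℤ, latPt (v + A * u, u) ∈ T → u = 0 ∧ v = 0 ∨ u = 0 ∧ v = -1 ∨
      u = -1 ∧ v = 1 ∨ u = 1 ∧ v = -2 := by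
    intro u v h
    obtain ⟨w, hw, h2, h3⟩ := hstep u v h
    have h4 := h1 _ _ hw
    rcases h1 _ _ h with ⟨rfl, rfl⟩ | ⟨rfl, rfl⟩ | ⟨rfl, rfl⟩ | ⟨rfl, rfl⟩ | ⟨rfl, rfl⟩ |
      ⟨rfl, rfl⟩ <;> omega
  have h3 : ∀ u v : ℤ, latPt (v + A * u, u) ∈ T → u = 0 ∧ v = 0 ∨ u = 0 ∧ v = -1 := by
    intro u v h
    obtain ⟨w, hw, h3, h4⟩ := hstep u v h
    obtain ⟨w', hw', h3', h4'⟩ := hstep v w hw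
    have h5 := h2 _ _ hw
    have h6 := h2 _ _ hw'
    rcases h2 _ _ h with ⟨rfl, rfl⟩ | ⟨rfl, rfl⟩ | ⟨rfl, rfl⟩ | ⟨rfl, rfl⟩ <;>
    rcases h5 with ⟨_, rfl⟩ | ⟨_, rfl⟩ | ⟨_, rfl⟩ | ⟨_, rfl⟩ <;> omega
  obtain ⟨x, y⟩ := k
  obtain ⟨v, rfl⟩ : ∃ v, x = v + A * y := ⟨x - A * y, by ring⟩
  obtain ⟨w, hw, -, -⟩ := hstep _ _ hk
  have h4 := h3 _ _ hw
  rcases h3 _ _ hk with ⟨rfl, rfl⟩ | ⟨rfl, rfl⟩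
  · simp
  · omega

theorem eq_zero_of_mem_interior (hT : IsTile A T) {k : ℤ × ℤ} {z : ℂ} (hz : z ∈ interior T)
    (hk : z ∈ tl T k) : k = 0 := by
  obtain ⟨ε, hε, hball⟩ := Metric.isOpen_iff.1 isOpen_interior z hz
  obtain ⟨R, hR⟩ := hT.isCompact.isBounded.exists_norm_le
  obtain ⟨n, hn⟩ := exists_forall_norm_lt hT.four_le R hε
  obtain ⟨l, hl, hlz⟩ := (hT.mem_tl_iff_desc n).1 hk
  have h1 : (tileMap A)^[n] ((tileMap A).symm^[n] (latPt l)) = latPt l :=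
    Function.LeftInverse.iterate (tileMap A).apply_symm_apply n _
  have h2 : (tileMap A).symm^[n] (latPt l) ∈ T := by
    refine interior_subset (hball ?_)
    rw [mem_ball, dist_comm, dist_eq_norm]
    refine hn _ ?_
    rw [iterate_map_sub, h1]
    exact hR _ hlz
  rw [← tl_zero T, hT.mem_tl_iff_desc n, h1] at h2
  obtain ⟨l', hl', h⟩ := h2
  rw [mem_tl, ← latPt_sub] at h
  have h3 := hT.eq_zero_of_latPt_mem h
  rw [sub_eq_zero] at h3
  subst h3
  exact eq_of_mem_desc hl hl'

theorem interior_eq (hT : IsTile A T) : interior T = (⋃ k ∈ ({0}ᶜ : Set (ℤ × ℤ)), tl T k)ᶜ := by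
  refine Subset.antisymm ?_ (interior_maximal ?_ (hT.isClosed_biUnion_tl _).isOpen_compl)
  · intro z hz hz'
    obtain ⟨k, hk, hzk⟩ := mem_iUnion₂.1 hz'
    exact hk (hT.eq_zero_of_mem_interior hz hzk)
  · intro z hz
    obtain ⟨k, hk⟩ := mem_iUnion.1 (hT.iUnion_tl.ge (mem_univ z))
    by_cases h : k = 0
    · simpa [h] using hk
    · exact (hz (mem_biUnion h hk)).elim

theorem nonempty_interior (hT : IsTile A T) : (interior T).Nonempty := by
  obtain ⟨k, z, hz⟩ := nonempty_interior_of_iUnion_of_closed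
    (fun k => (hT.isCompact_tl k).isClosed) hT.iUnion_tl
  have h : tl T k = (Homeomorph.subRight (latPt k)) ⁻¹' T := rfl
  rw [h, ← Homeomorph.preimage_interior] at hz
  exact ⟨_, hz⟩

end IsTile

/-- Some preconnected subset of `F` contains both `s` and `t`. -/
def Linked (F s t : Set ℂ) : Prop := ∃ K ⊆ F, IsPreconnected K ∧ s ⊆ K ∧ t ⊆ K

theorem Linked.symm {F s t : Set ℂ} (h : Linked F s t) : Linked F t s := by
  obtain ⟨K, h1, h2, h3, h4⟩ := h
  exact ⟨K, h1, h2, h4, h3⟩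

theorem Linked.trans {F s t u : Set ℂ} (h : Linked F s t) (h' : Linked F t u)
    (ht : t.Nonempty) : Linked F s u := by
  obtain ⟨K, h1, h2, h3, h4⟩ := h
  obtain ⟨L, h1', h2', h3', h4'⟩ := h'
  exact ⟨K ∪ L, union_subset h1 h1', h2.union' (ht.mono (subset_inter h4 h3')) h2',
    h3.trans subset_union_left, h4'.trans subset_union_right⟩

theorem Linked.of_inter {F s t : Set ℂ} (hs : s ⊆ F) (ht : t ⊆ F) (hs' : IsPreconnected s)
    (ht' : IsPreconnected t) (h : (s ∩ t).Nonempty) : Linked F s t :=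
  ⟨s ∪ t, union_subset hs ht, hs'.union' h ht', subset_union_left, subset_union_right⟩

theorem exists_of_linked {s : Set ℂ} (F : Set ℂ) (hs : s.Nonempty) :
    ∃ D ⊆ F, IsPreconnected D ∧ ∀ t, Linked F s t → t ⊆ D := by
  obtain ⟨p, hp⟩ := hs
  refine ⟨⋃₀ {K | K ⊆ F ∧ IsPreconnected K ∧ s ⊆ K}, sUnion_subset fun K hK => hK.1,
    isPreconnected_sUnion p _ (fun K hK => hK.2.2 hp) fun K hK => hK.2.1, ?_⟩
  rintro t ⟨K, h1, h2, h3, h4⟩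
  exact h4.trans (subset_sUnion_of_mem ⟨h1, h2, h3⟩)

/-- Adjacency of lattice points in the directions `(1, 0)` and `(A - 1, 1)`. -/
def GAdj (A : ℤ) (k l : ℤ × ℤ) : Prop :=
  l = k + (1, 0) ∨ k = l + (1, 0) ∨ l = k + (A - 1, 1) ∨ k = l + (A - 1, 1)

theorem GAdj.symm {A : ℤ} {k l : ℤ × ℤ} (h : GAdj A k l) : GAdj A l k := by
  unfold GAdj at *
  tauto

/-- The set `K` of lattice points is connected with respect to `GAdj`. -/
def GConn (A : ℤ) (K : Set (ℤ × ℤ)) : Prop :=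
  ∀ k ∈ K, ∀ l ∈ K, Relation.ReflTransGen (fun k l => GAdj A k l ∧ k ∈ K ∧ l ∈ K) k l

theorem GConn.isPreconnected_biUnion {A : ℤ} {K : Set (ℤ × ℤ)} (hK : GConn A K)
    {s : ℤ × ℤ → Set ℂ} (hs : ∀ k ∈ K, IsPreconnected (s k))
    (h : ∀ k ∈ K, ∀ l ∈ K, GAdj A k l → (s k ∩ s l).Nonempty) :
    IsPreconnected (⋃ k ∈ K, s k) :=
  IsPreconnected.biUnion_of_reflTransGen hs fun k hk l hl =>
    Relation.ReflTransGen.mono (fun k l h' => ⟨h k h'.2.1 l h'.2.2 h'.1, h'.2.1⟩) _ _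
      (hK k hk l hl)

theorem reflTransGen_row {A : ℤ} {K : Set (ℤ × ℤ)} {x x' y : ℤ}
    (h : ∀ z, (x ≤ z ∧ z ≤ x' ∨ x' ≤ z ∧ z ≤ x) → (z, y) ∈ K) :
    Relation.ReflTransGen (fun k l => GAdj A k l ∧ k ∈ K ∧ l ∈ K) (x, y) (x', y) := by
  rcases le_total x x' with hx | hx
  · induction x', hx using Int.leInduction with
    | base => exact .refl
    | succ z hz ih =>
      refine (ih fun w hw => h w (by omega)).tail ⟨Or.inl (by ext <;> simp), h _ (by omega),
        h _ (by omega)⟩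
  · induction x', hx using Int.leInductionDown with
    | base => exact .refl
    | pred z hz ih =>
      refine (ih fun w hw => h w (by omega)).tail ⟨Or.inr (Or.inl (by ext <;> simp)),
        h _ (by omega), h _ (by omega)⟩

theorem gConn_desc {A : ℤ} (hA : 4 ≤ A) (n : ℕ) (k : ℤ × ℤ) : GConn A (desc A n k) := by
  induction n with
  | zero =>
    rintro _ rfl _ rfl
    exact .refl
  | succ n ih =>
    have hrow : ∀ j ∈ desc A n k, ∀ i, 0 ≤ i → i ≤ 2 * A - 4 → ∀ i', 0 ≤ i' → i' ≤ 2 * A - 4 →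
        Relation.ReflTransGen
          (fun k' l => GAdj A k' l ∧ k' ∈ desc A (n + 1) k ∧ l ∈ desc A (n + 1) k)
          (subIdx A j i) (subIdx A j i') := by
      intro j hj i hi hi' i' hi0 hi0'
      refine reflTransGen_row fun z hz => ⟨j, hj, z + (2 * A - 3) * j.2, ?_, ?_, ?_⟩
      · rcases hz with hz | hz <;> linarith
      · rcases hz with hz | hz <;> linarith
      · simp only [subIdx]
        ext <;> dsimp only
        ring
    have hadj : ∀ j j', GAdj A j j' → ∃ i i', 0 ≤ i ∧ i ≤ 2 * A - 4 ∧ 0 ≤ i' ∧ i' ≤ 2 * A - 4 ∧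
        GAdj A (subIdx A j i) (subIdx A j' i') := by
      rintro j j' (rfl | rfl | rfl | rfl)
      · refine ⟨0, A - 1, by omega, by omega, by omega, by omega, Or.inr (Or.inr (Or.inl ?_))⟩
        ext <;> simp [subIdx] <;> ring
      · refine ⟨A - 1, 0, by omega, by omega, by omega, by omega, Or.inr (Or.inr (Or.inr ?_))⟩
        ext <;> simp [subIdx] <;> ring
      · refine ⟨0, A - 2, by omega, by omega, by omega, by omega, Or.inr (Or.inr (Or.inr ?_))⟩
        ext <;> simp [subIdx] <;> ring
      · refine ⟨A - 2, 0, by omega, by omega, by omega, by omega, Or.inr (Or.inr (Or.inl ?_))⟩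
        ext <;> simp [subIdx] <;> ring
    rintro _ ⟨j, hj, i, hi, hi', rfl⟩ _ ⟨j', hj', i', hi0, hi0', rfl⟩
    have hp := ih j hj j' hj'
    induction hp generalizing i' with
    | refl => exact hrow j hj i hi hi' i' hi0 hi0'
    | @tail u v _ huv ih' =>
      obtain ⟨p, q, hp, hp', hq, hq', h⟩ := hadj u v huv.1
      exact ((ih' huv.2.1 p hp hp').tail ⟨h, ⟨u, huv.2.1, p, hp, hp', rfl⟩,
        ⟨v, hj', q, hq, hq', rfl⟩⟩).trans (hrow v hj' q hq hq' i' hi0 hi0')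

theorem gConn_compl_zero (A : ℤ) : GConn A {0}ᶜ := by
  have hcol : ∀ p q : ℤ, p ≠ 0 → ∀ q' : ℤ, Relation.ReflTransGen
      (fun k l => GAdj A k l ∧ k ∈ ({0}ᶜ : Set (ℤ × ℤ)) ∧ l ∈ ({0}ᶜ : Set (ℤ × ℤ)))
      (p + (A - 1) * q, q) (p + (A - 1) * q', q') := by
    intro p q hp
    have hne : ∀ q : ℤ, (p + (A - 1) * q, q) ∈ ({0}ᶜ : Set (ℤ × ℤ)) := by
      intro q h
      simp only [mem_singleton_iff, Prod.mk_eq_zero] at h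
      obtain ⟨h1, rfl⟩ := h
      omega
    intro q'
    rcases le_total q q' with h | h
    · induction q', h using Int.leInduction with
      | base => exact .refl
      | succ z hz ih =>
        exact ih.tail ⟨Or.inr (Or.inr (Or.inl (by ext <;> simp; ring))), hne _, hne _⟩
    · induction q', h using Int.leInductionDown with
      | base => exact .refl
      | pred z hz ih =>
        exact ih.tail ⟨Or.inr (Or.inr (Or.inr (by ext <;> simp; ring))), hne _, hne _⟩
  have hto : ∀ k ∈ ({0}ᶜ : Set (ℤ × ℤ)), Relation.ReflTransGen
      (fun k l => GAdj A k l ∧ k ∈ ({0}ᶜ : Set (ℤ × ℤ)) ∧ l ∈ ({0}ᶜ : Set (ℤ × ℤ))) k (1, 0) := by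
    rintro ⟨x, y⟩ hk
    have h1 : ∀ x y : ℤ, y ≠ 0 → Relation.ReflTransGen
        (fun k l => GAdj A k l ∧ k ∈ ({0}ᶜ : Set (ℤ × ℤ)) ∧ l ∈ ({0}ᶜ : Set (ℤ × ℤ)))
        (x, y) (1, 0) := by
      intro x y hy
      refine (reflTransGen_row (x' := 1 + (A - 1) * y) fun z _ => ?_).trans ?_
      · simp [hy]
      · simpa using hcol 1 y one_ne_zero 0
    by_cases hy : y = 0
    · subst hy
      have hx : x ≠ 0 := by simpa using hk
      have h2 := hcol x 0 hx 1
      rw [mul_zero, add_zero] at h2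
      exact h2.trans (h1 _ 1 one_ne_zero)
    · exact h1 x y hy
  intro k hk l hl
  refine (hto k hk).trans ?_
  have : Std.Symm
      (fun k l => GAdj A k l ∧ k ∈ ({0}ᶜ : Set (ℤ × ℤ)) ∧ l ∈ ({0}ᶜ : Set (ℤ × ℤ))) :=
    ⟨fun u v ⟨h1, h2, h3⟩ => ⟨h1.symm, h3, h2⟩⟩
  exact symm_of _ (hto l hl)

theorem desc_subIdx_subset {A : ℤ} {n : ℕ} {k : ℤ × ℤ} {i : ℤ} (hi : 0 ≤ i)
    (hi' : i ≤ 2 * A - 4) : desc A n (subIdx A k i) ⊆ desc A (n + 1) k := by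
  induction n with
  | zero =>
    rintro _ rfl
    exact ⟨k, rfl, i, hi, hi', rfl⟩
  | succ n ih =>
    rintro _ ⟨j, hj, i', h1, h2, rfl⟩
    exact ⟨j, ih hj, i', h1, h2, rfl⟩

namespace IsTile

variable {A : ℤ} {T : Set ℂ}

theorem adj₂_of_gAdj (hT : IsTile A T) {k l : ℤ × ℤ} (h : GAdj A k l) : Adj₂ T k l := by
  rcases h with h | h | h | h
  · exact hT.adj₂_add_right h
  · exact (hT.adj₂_add_right h).symm
  · exact hT.adj₂_add_up h
  · exact (hT.adj₂_add_up h).symm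

theorem subset_or_subset (hT : IsTile A T) (n : ℕ) {u v : Set ℂ} {k : ℤ × ℤ}
    (h : tl T k ∩ (u ∩ v) = ∅)
    (h' : ∀ l ∈ desc A n k, (tileMap A)^[n] ⁻¹' tl T l ⊆ u ∨ (tileMap A)^[n] ⁻¹' tl T l ⊆ v) :
    tl T k ⊆ u ∨ tl T k ⊆ v := by
  have hA := hT.four_le
  induction n generalizing u v k with
  | zero => exact h' k rfl
  | succ n ih =>
    have hsub : ∀ i, 0 ≤ i → i ≤ 2 * A - 4 → tl T (subIdx A k i) ⊆ tileMap A '' u ∨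
        tl T (subIdx A k i) ⊆ tileMap A '' v := by
      intro i hi hi'
      refine ih ?_ fun l hl => ?_
      · rw [← not_nonempty_iff_eq_empty]
        rintro ⟨_, hz, ⟨w, hw, rfl⟩, w', hw', he⟩
        obtain rfl := (tileMap A).injective he
        exact notMem_empty w' (h ▸ ⟨hT.mem_tl_iff.2 ⟨i, hi, hi', hz⟩, hw, hw'⟩)
      · refine (h' l (desc_subIdx_subset hi hi' hl)).imp ?_ ?_
        all_goals
          intro hs z hz
          refine ⟨(tileMap A).symm z, hs ?_, by simp⟩
          rw [mem_preimage, Function.iterate_succ_apply, ContinuousLinearEquiv.apply_symm_apply]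
          exact hz
    have hall : ∀ (u v : Set ℂ), tl T k ∩ (u ∩ v) = ∅ → (∀ i, 0 ≤ i → i ≤ 2 * A - 4 →
        tl T (subIdx A k i) ⊆ tileMap A '' u ∨ tl T (subIdx A k i) ⊆ tileMap A '' v) →
        tl T (subIdx A k 0) ⊆ tileMap A '' u → tl T k ⊆ u := by
      intro u v h hsub h0
      have : ∀ i, 0 ≤ i → i ≤ 2 * A - 4 → tl T (subIdx A k i) ⊆ tileMap A '' u := by
        intro i hi
        induction i, hi using Int.leInduction with
        | base => exact fun _ => h0
        | succ i hi ih =>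
          intro hi'
          refine (hsub (i + 1) (by omega) hi').resolve_right fun hc => ?_
          obtain ⟨z, hz, hz'⟩ := (hT.adj₂_add_right (k := subIdx A k i) (l := subIdx A k (i + 1))
            (by ext <;> simp [subIdx]; ring)).nonempty
          obtain ⟨w, hw, rfl⟩ := ih (by omega) hz
          obtain ⟨w', hw', he⟩ := hc hz'
          obtain rfl := (tileMap A).injective he
          exact notMem_empty w' (h ▸ ⟨hT.mem_tl_iff.2 ⟨i, hi, by omega, hz⟩, hw, hw'⟩)
      intro z hz
      obtain ⟨i, hi, hi', hzi⟩ := hT.mem_tl_iff.1 hz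
      obtain ⟨w, hw, he⟩ := this i hi hi' hzi
      rwa [← (tileMap A).injective he]
    rcases hsub 0 le_rfl (by omega) with h0 | h0
    · exact Or.inl (hall u v h hsub h0)
    · exact Or.inr (hall v u (by rwa [inter_comm v u]) (fun i hi hi' => (hsub i hi hi').symm) h0)

theorem dist_lt_of_mem_piece (hT : IsTile A T) {ε : ℝ} (hε : 0 < ε) :
    ∃ n, ∀ l z w, (tileMap A)^[n] z ∈ tl T l → (tileMap A)^[n] w ∈ tl T l → dist z w < ε := by
  obtain ⟨R, hR⟩ := hT.isCompact.isBounded.exists_norm_le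
  obtain ⟨n, hn⟩ := exists_forall_norm_lt hT.four_le (R + R) hε
  refine ⟨n, fun l z w hz hw => ?_⟩
  rw [dist_eq_norm]
  refine hn _ ?_
  rw [iterate_map_sub, ← sub_sub_sub_cancel_right _ _ (latPt l)]
  exact (norm_sub_le _ _).trans (add_le_add (hR _ hz) (hR _ hw))

theorem isPreconnected (hT : IsTile A T) : IsPreconnected T := by
  rw [isPreconnected_closed_iff]
  intro u v hu hv huv hTu hTv
  by_contra hne
  rw [not_nonempty_iff_eq_empty] at hne
  have hd : Disjoint (T ∩ u) (T ∩ v) := by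
    rw [disjoint_iff_inter_eq_empty, ← hne]
    ext; simp; tauto
  obtain ⟨ε, hε, h⟩ := Metric.exists_pos_forall_lt_edist (hT.isCompact.inter_right hu)
    (hT.isCompact.isClosed.inter hv) hd
  obtain ⟨n, hn⟩ := hT.dist_lt_of_mem_piece (ε := ε) (by exact_mod_cast hε)
  have key := hT.subset_or_subset n (k := 0) (u := u) (v := v) (by simpa using hne) ?_
  · rw [tl_zero] at key
    rcases key with h1 | h1
    · obtain ⟨z, hz, hz'⟩ := hTv
      exact notMem_empty z (hne ▸ ⟨hz, h1 hz, hz'⟩)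
    · obtain ⟨z, hz, hz'⟩ := hTu
      exact notMem_empty z (hne ▸ ⟨hz, hz', h1 hz⟩)
  · intro l hl
    by_contra hc
    simp only [not_or, not_subset] at hc
    obtain ⟨⟨z, hz, hzu⟩, w, hw, hwv⟩ := hc
    have hzT : z ∈ T := by
      rw [← tl_zero T]
      exact (hT.mem_tl_iff_desc n).2 ⟨l, hl, hz⟩
    have hwT : w ∈ T := by
      rw [← tl_zero T]
      exact (hT.mem_tl_iff_desc n).2 ⟨l, hl, hw⟩
    have h1 := h w ⟨hwT, (huv hwT).resolve_right hwv⟩ z ⟨hzT, (huv hzT).resolve_left hzu⟩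
    have h2 := hn l w z hw hz
    rw [edist_dist, ← ENNReal.ofReal_coe_nnreal, ENNReal.ofReal_lt_ofReal_iff_of_nonneg (by positivity)] at h1
    exact lt_asymm h1 h2

theorem isPreconnected_tl (hT : IsTile A T) (k : ℤ × ℤ) : IsPreconnected (tl T k) := by
  have h : tl T k = (Homeomorph.subRight (latPt k)) ⁻¹' T := rfl
  rw [h, Homeomorph.isPreconnected_preimage]
  exact hT.isPreconnected

end IsTile

/-- Every point of an invariant subset of `T` containing `y` has only one first digit. -/
def UniqueDigits (A : ℤ) (T : Set ℂ) (y : ℂ) : Prop :=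
  ∃ S ⊆ T, y ∈ S ∧ ∀ z ∈ S, ∃ i : ℤ, 0 ≤ i ∧ i ≤ 2 * A - 4 ∧ tileMap A z - i ∈ S ∧
    ∀ i' : ℤ, 0 ≤ i' → i' ≤ 2 * A - 4 → tileMap A z - i' ∈ T → i' = i

theorem UniqueDigits.mem {A : ℤ} {T : Set ℂ} {y : ℂ} (h : UniqueDigits A T y) : y ∈ T := by
  obtain ⟨S, hS, hy, -⟩ := h
  exact hS hy

theorem UniqueDigits.exists_digit {A : ℤ} {T : Set ℂ} {y : ℂ} (h : UniqueDigits A T y) :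
    ∃ i : ℤ, 0 ≤ i ∧ i ≤ 2 * A - 4 ∧ UniqueDigits A T (tileMap A y - i) ∧
      ∀ i' : ℤ, 0 ≤ i' → i' ≤ 2 * A - 4 → tileMap A y - i' ∈ T → i' = i := by
  obtain ⟨S, hS, hy, h⟩ := h
  obtain ⟨i, hi, hi', h1, h2⟩ := h y hy
  exact ⟨i, hi, hi', ⟨S, hS, h1, h⟩, h2⟩

/-- The contraction with digit `i` applied to `s`. -/
def ch (A i : ℤ) (s : Set ℂ) : Set ℂ := {z | tileMap A z - i ∈ s}

theorem mem_ch {A i : ℤ} {s : Set ℂ} {z : ℂ} : z ∈ ch A i s ↔ tileMap A z - i ∈ s := Iff.rfl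

theorem ch_mono (A i : ℤ) {s t : Set ℂ} (h : s ⊆ t) : ch A i s ⊆ ch A i t := fun _ hz => h hz

theorem isPreconnected_ch {A i : ℤ} {s : Set ℂ} (hs : IsPreconnected s) :
    IsPreconnected (ch A i s) := by
  have h : ch A i s = ((tileMap A).toHomeomorph.trans (Homeomorph.subRight (i : ℂ))) ⁻¹' s := rfl
  rwa [h, Homeomorph.isPreconnected_preimage]

theorem symm_mem_ch {A i : ℤ} {s : Set ℂ} {w : ℂ} (hw : w ∈ s) :
    (tileMap A).symm (w + i) ∈ ch A i s := by
  rw [mem_ch, ContinuousLinearEquiv.apply_symm_apply, add_sub_cancel_right]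
  exact hw

theorem Linked.ch {A i : ℤ} {F F' s t : Set ℂ} (h : Linked F s t) (hF : ch A i F ⊆ F') :
    Linked F' (ch A i s) (ch A i t) := by
  obtain ⟨K, h1, h2, h3, h4⟩ := h
  exact ⟨_, (ch_mono A i h1).trans hF, isPreconnected_ch h2, ch_mono A i h3, ch_mono A i h4⟩

theorem ch_inter_right {A i : ℤ} {s T : Set ℂ} (h : (s ∩ tl T (1, 0)).Nonempty) :
    (ch A i s ∩ ch A (i + 1) T).Nonempty := by
  obtain ⟨w, hw, hw'⟩ := h
  refine ⟨_, symm_mem_ch hw, ?_⟩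
  rw [mem_ch, ContinuousLinearEquiv.apply_symm_apply]
  rw [mem_tl] at hw'
  convert hw' using 1
  apply Complex.ext <;> simp
  ring

theorem ch_inter_left {A i : ℤ} {s T : Set ℂ} (h : (s ∩ tl T (-1, 0)).Nonempty) :
    (ch A i s ∩ ch A (i - 1) T).Nonempty := by
  obtain ⟨w, hw, hw'⟩ := h
  refine ⟨_, symm_mem_ch hw, ?_⟩
  rw [mem_ch, ContinuousLinearEquiv.apply_symm_apply]
  rw [mem_tl] at hw'
  convert hw' using 1
  apply Complex.ext <;> simp
  ring

theorem mem_ch_iff_tl {A i : ℤ} {T : Set ℂ} {z : ℂ} :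
    z ∈ ch A i T ↔ tileMap A z ∈ tl T (subIdx A 0 i) := by
  rw [mem_ch, mem_tl, ← tileMap_latPt_add, latPt_zero, map_zero, zero_add]

theorem mem_ch_ch_iff_tl {A i j : ℤ} {T : Set ℂ} {z : ℂ} :
    z ∈ ch A i (ch A j T) ↔ tileMap A (tileMap A z) ∈ tl T (subIdx A (subIdx A 0 i) j) := by
  rw [mem_ch, mem_ch, mem_tl, ← tileMap_latPt_add, ← tileMap_latPt_add, latPt_zero, map_zero,
    zero_add, map_sub, sub_sub]

namespace IsTile

variable {A : ℤ} {T : Set ℂ}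

theorem ch_subset (hT : IsTile A T) {i : ℤ} (hi : 0 ≤ i) (hi' : i ≤ 2 * A - 4) :
    ch A i T ⊆ T := fun z hz => (hT.mem_iff z).2 ⟨i, hi, hi', hz⟩

theorem ch_inter_one (hT : IsTile A T) {j : ℤ} (hj : 0 ≤ j) (hj' : j ≤ A - 2) :
    (ch A j T ∩ tl T (1, 0)).Nonempty := by
  have hA := hT.four_le
  obtain ⟨z, hz, hz'⟩ := (nonempty_tl_inter_congr (T := T) (k := 0) (l := (A - 2, 1))
    (k' := subIdx A 0 j) (l' := subIdx A (1, 0) (j + A - 2))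
    (by ext <;> simp [subIdx]; ring)).2 hT.nonempty_inter_tl_edge
  refine ⟨(tileMap A).symm z, ?_, hT.mem_tl_iff.2 ⟨j + A - 2, by omega, by omega, ?_⟩⟩
  · rwa [mem_ch_iff_tl, ContinuousLinearEquiv.apply_symm_apply]
  · rwa [ContinuousLinearEquiv.apply_symm_apply]

theorem ch_inter_neg_one (hT : IsTile A T) {j : ℤ} (hj : A - 2 ≤ j) (hj' : j ≤ 2 * A - 4) :
    (ch A j T ∩ tl T (-1, 0)).Nonempty := by
  have hA := hT.four_le
  obtain ⟨z, hz', hz⟩ := (nonempty_tl_inter_congr (T := T) (k := 0) (l := (A - 2, 1))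
    (l' := subIdx A 0 j) (k' := subIdx A (-1, 0) (j - (A - 2)))
    (by ext <;> simp [subIdx])).2 hT.nonempty_inter_tl_edge
  refine ⟨(tileMap A).symm z, ?_, hT.mem_tl_iff.2 ⟨j - (A - 2), by omega, by omega, ?_⟩⟩
  · rwa [mem_ch_iff_tl, ContinuousLinearEquiv.apply_symm_apply]
  · rwa [ContinuousLinearEquiv.apply_symm_apply]

theorem ch_ch_inter_one (hT : IsTile A T) {l : ℤ} (hl : 1 ≤ l) (hl' : l ≤ 2 * A - 4) :
    (ch A (A - 2) (ch A l T) ∩ tl T (1, 0)).Nonempty := by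
  have hA := hT.four_le
  obtain ⟨z, hz', hz⟩ := (nonempty_tl_inter_congr (T := T) (k := 0) (l := (2 * A - 2, 2))
    (l' := subIdx A (subIdx A 0 (A - 2)) l)
    (k' := subIdx A (subIdx A (1, 0) (2 * A - 4)) (l - 1))
    (by ext <;> simp [subIdx] <;> ring)).2 hT.nonempty_inter_tl_tip
  refine ⟨(tileMap A).symm ((tileMap A).symm z), ?_,
    hT.mem_tl_iff.2 ⟨2 * A - 4, by omega, by omega,
    hT.mem_tl_iff.2 ⟨l - 1, by omega, by omega, ?_⟩⟩⟩
  · rwa [mem_ch_ch_iff_tl, ContinuousLinearEquiv.apply_symm_apply,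
      ContinuousLinearEquiv.apply_symm_apply]
  · rwa [ContinuousLinearEquiv.apply_symm_apply, ContinuousLinearEquiv.apply_symm_apply]

theorem ch_ch_inter_neg_one (hT : IsTile A T) {l : ℤ} (hl : 0 ≤ l) (hl' : l + 1 ≤ 2 * A - 4) :
    (ch A (A - 2) (ch A l T) ∩ tl T (-1, 0)).Nonempty := by
  have hA := hT.four_le
  obtain ⟨z, hz, hz'⟩ := (nonempty_tl_inter_congr (T := T) (k := 0) (l := (2 * A - 2, 2))
    (k' := subIdx A (subIdx A 0 (A - 2)) l)
    (l' := subIdx A (subIdx A (-1, 0) 0) (l + 1))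
    (by ext <;> simp [subIdx] <;> ring)).2 hT.nonempty_inter_tl_tip
  refine ⟨(tileMap A).symm ((tileMap A).symm z), ?_,
    hT.mem_tl_iff.2 ⟨0, by omega, by omega,
    hT.mem_tl_iff.2 ⟨l + 1, by omega, by omega, ?_⟩⟩⟩
  · rwa [mem_ch_ch_iff_tl, ContinuousLinearEquiv.apply_symm_apply,
      ContinuousLinearEquiv.apply_symm_apply]
  · rwa [ContinuousLinearEquiv.apply_symm_apply, ContinuousLinearEquiv.apply_symm_apply]

theorem nonempty_one (hT : IsTile A T) : (T ∩ tl T (1, 0)).Nonempty := by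
  simpa using (hT.adj₂_add_right (k := 0) (l := (1, 0)) (by simp)).nonempty

theorem ch_subset_compl (hT : IsTile A T) {y : ℂ} {i i' : ℤ}
    (hu : ∀ i' : ℤ, 0 ≤ i' → i' ≤ 2 * A - 4 → tileMap A y - i' ∈ T → i' = i) (hi : 0 ≤ i')
    (hi' : i' ≤ 2 * A - 4) (hne : i' ≠ i) : ch A i' T ⊆ T \ {y} := by
  intro z hz
  refine ⟨hT.ch_subset hi hi' hz, ?_⟩
  rintro rfl
  exact hne (hu i' hi hi' hz)

theorem ch_compl_subset (hT : IsTile A T) {y : ℂ} {i : ℤ} (hi : 0 ≤ i) (hi' : i ≤ 2 * A - 4) :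
    ch A i (T \ {tileMap A y - i}) ⊆ T \ {y} := by
  rintro z ⟨hz, hz'⟩
  refine ⟨hT.ch_subset hi hi' hz, ?_⟩
  rintro rfl
  exact hz' rfl

theorem linked_ch (hT : IsTile A T) {y : ℂ} (hy : UniqueDigits A T y) {p q : ℤ}
    (hp : 0 ≤ p) (hp' : p ≤ 2 * A - 4) (hpy : tileMap A y - p ∉ T) (hq : 0 ≤ q)
    (hq' : q ≤ 2 * A - 4) (hqy : tileMap A y - q ∉ T) :
    Linked (T \ {y}) (ch A p T) (ch A q T) := by
  have hA := hT.four_le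
  wlog hpq : p ≤ q generalizing p q
  · exact (this hq hq' hqy hp hp' hpy (by omega)).symm
  obtain ⟨i, hi, hi', hyi, hu⟩ := hy.exists_digit
  have hpi : p ≠ i := by
    rintro rfl
    exact hpy hyi.mem
  have hqi : q ≠ i := by
    rintro rfl
    exact hqy hyi.mem
  have hne : ∀ j, (ch A j T).Nonempty := fun j => hT.nonempty.elim fun w hw =>
    ⟨_, symm_mem_ch hw⟩
  have hrow : ∀ p q, 0 ≤ p → p ≤ q → q ≤ 2 * A - 4 → (q < i ∨ i < p) →
      Linked (T \ {y}) (ch A p T) (ch A q T) := by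
    intro p q hp hpq
    induction q, hpq using Int.leInduction with
    | base =>
      intro hq hpi
      have h := hT.ch_subset_compl hu hp hq (by omega)
      exact .of_inter h h (isPreconnected_ch hT.isPreconnected) (isPreconnected_ch hT.isPreconnected)
        (by simpa using hne p)
    | succ q hpq ih =>
      intro hq hpi
      exact (ih (by omega) (by omega)).trans (.of_inter
        (hT.ch_subset_compl hu (by omega) (by omega) (by omega))
        (hT.ch_subset_compl hu (by omega) (by omega) (by omega))
        (isPreconnected_ch hT.isPreconnected) (isPreconnected_ch hT.isPreconnected)
        (ch_inter_right hT.nonempty_one)) (hne q)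
  by_cases hcase : q < i ∨ i < p
  · exact hrow p q hp hpq hq' hcase
  have hjump : Linked (T \ {y}) (ch A (i - 1) T) (ch A (i + 1) T) := by
    have h1 := hT.ch_subset_compl (i' := i - 1) hu (by omega) (by omega) (by omega)
    have h2 := hT.ch_subset_compl (i' := i + 1) hu (by omega) (by omega) (by omega)
    have key : ∀ s ⊆ T \ {tileMap A y - i}, IsPreconnected s → (s ∩ tl T (1, 0)).Nonempty →
        (s ∩ tl T (-1, 0)).Nonempty → Linked (T \ {y}) (ch A (i - 1) T) (ch A (i + 1) T) := by
      intro s hs hsc hs1 hs2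
      have h3 := (ch_mono A i hs).trans (hT.ch_compl_subset hi hi')
      have h4 := ch_inter_left (A := A) (i := i) hs2
      refine (Linked.of_inter h3 h1 (isPreconnected_ch hsc)
        (isPreconnected_ch hT.isPreconnected) h4).symm.trans (.of_inter h3 h2 (isPreconnected_ch hsc)
        (isPreconnected_ch hT.isPreconnected) (ch_inter_right hs1)) h4.left
    obtain ⟨j, hj, hj', hyj, huj⟩ := hyi.exists_digit
    by_cases hjA : j = A - 2
    · obtain ⟨l, hl, hl', hyl, hul⟩ := hyj.exists_digit
      obtain ⟨m, hm, hm', hml⟩ : ∃ m, 1 ≤ m ∧ m ≤ 2 ∧ m ≠ l := by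
        by_cases h : l = 1
        · exact ⟨2, by omega, by omega, by omega⟩
        · exact ⟨1, by omega, by omega, by omega⟩
      subst hjA
      refine key (ch A (A - 2) (ch A m T)) ?_ (isPreconnected_ch (isPreconnected_ch
        hT.isPreconnected)) (hT.ch_ch_inter_one (by omega) (by omega))
        (hT.ch_ch_inter_neg_one (by omega) (by omega))
      exact (ch_mono _ _ (hT.ch_subset_compl hul (by omega) (by omega) hml)).trans
        (hT.ch_compl_subset hj hj')
    · exact key (ch A (A - 2) T) (hT.ch_subset_compl huj (by omega) (by omega) (by omega))
        (isPreconnected_ch hT.isPreconnected) (hT.ch_inter_one (by omega) le_rfl)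
        (hT.ch_inter_neg_one le_rfl (by omega))
  exact ((hrow p (i - 1) hp (by omega) (by omega) (by omega)).trans hjump (hne _)).trans
    (hrow (i + 1) q (by omega) (by omega) hq' (by omega)) (hne _)

theorem exists_isPreconnected_of_uniqueDigits (hT : IsTile A T) {y : ℂ}
    (hy : UniqueDigits A T y) {i : ℤ} (hi : 0 ≤ i) (hi' : i ≤ 2 * A - 4)
    (hyi : UniqueDigits A T (tileMap A y - i))
    (hu : ∀ i' : ℤ, 0 ≤ i' → i' ≤ 2 * A - 4 → tileMap A y - i' ∈ T → i' = i) :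
    ∃ D ⊆ T \ {y}, IsPreconnected D ∧
      (∀ p, 0 ≤ p → p ≤ 2 * A - 4 → tileMap A y - p ∉ T → ch A p T ⊆ D) ∧
      ∀ q, 0 ≤ q → q ≤ 2 * A - 4 → tileMap A (tileMap A y - i) - q ∉ T →
        ch A i (ch A q T) ⊆ D := by
  have hA := hT.four_le
  obtain ⟨j, hj, hj', hyj, huj⟩ := hyi.exists_digit
  have hconn : ∀ p, IsPreconnected (ch A p T) := fun p => isPreconnected_ch hT.isPreconnected
  have hnot : ∀ p, 0 ≤ p → p ≤ 2 * A - 4 → p ≠ i → tileMap A y - p ∉ T :=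
    fun p hp hp' hne h => hne (hu p hp hp' h)
  have hnot' : ∀ p, 0 ≤ p → p ≤ 2 * A - 4 → p ≠ j → tileMap A (tileMap A y - i) - p ∉ T :=
    fun p hp hp' hne h => hne (huj p hp hp' h)
  obtain ⟨a, b, ha, ha', hai, hb, hb', hbj, hab⟩ : ∃ a b, 0 ≤ a ∧ a ≤ 2 * A - 4 ∧ a ≠ i ∧
      0 ≤ b ∧ b ≤ 2 * A - 4 ∧ b ≠ j ∧ (ch A i (ch A b T) ∩ ch A a T).Nonempty := by
    by_cases h : i = 2 * A - 4
    · obtain ⟨b, hb, hb', hbj⟩ : ∃ b, A - 2 ≤ b ∧ b ≤ A - 1 ∧ b ≠ j := by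
        by_cases h : j = A - 2
        · exact ⟨A - 1, by omega, by omega, by omega⟩
        · exact ⟨A - 2, by omega, by omega, by omega⟩
      exact ⟨i - 1, b, by omega, by omega, by omega, by omega, by omega, hbj,
        ch_inter_left (hT.ch_inter_neg_one hb (by omega))⟩
    · obtain ⟨b, hb, hb', hbj⟩ : ∃ b, 0 ≤ b ∧ b ≤ 1 ∧ b ≠ j := by
        by_cases h : j = 0
        · exact ⟨1, by omega, by omega, by omega⟩
        · exact ⟨0, by omega, by omega, by omega⟩
      exact ⟨i + 1, b, by omega, by omega, by omega, by omega, by omega, hbj,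
        ch_inter_right (hT.ch_inter_one hb (by omega))⟩
  obtain ⟨D, hDF, hD, h⟩ := exists_of_linked (T \ {y}) hab.right
  refine ⟨D, hDF, hD, fun p hp hp' hpy => h _ ?_, fun q hq hq' hqy => h _ ?_⟩
  · exact hT.linked_ch hy ha ha' (hnot a ha ha' hai) hp hp' hpy
  · have h1 := (hT.linked_ch hyi hb hb' (hnot' b hb hb' hbj) hq hq' hqy).ch
      (hT.ch_compl_subset hi hi')
    refine Linked.trans (Linked.symm (.of_inter ?_ (hT.ch_subset_compl hu ha ha' hai)
      (isPreconnected_ch (hconn b)) (hconn a) hab)) h1 hab.left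
    exact (ch_mono _ _ (hT.ch_subset_compl huj hb hb' hbj)).trans (hT.ch_compl_subset hi hi')

theorem isPreconnected_diff_of_uniqueDigits (hT : IsTile A T) {y : ℂ}
    (hy : UniqueDigits A T y) : IsPreconnected (T \ {y}) := by
  have hA := hT.four_le
  obtain ⟨R, hR⟩ := hT.isCompact.isBounded.exists_norm_le
  have hex : ∀ i : ℤ, ∃ p, 0 ≤ p ∧ p ≤ 2 * A - 4 ∧ p ≠ i := by
    intro i
    by_cases h : i = 0
    · exact ⟨1, by omega, by omega, by omega⟩
    · exact ⟨0, by omega, by omega, by omega⟩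
  have key : ∀ n : ℕ, ∀ y, UniqueDigits A T y → ∃ E ⊆ T \ {y}, IsPreconnected E ∧
      (∀ p : ℤ, 0 ≤ p → p ≤ 2 * A - 4 → tileMap A y - p ∉ T → ch A p T ⊆ E) ∧
      ∀ z ∈ T, R + R < ‖(tileMap A)^[n] (z - y)‖ → z ∈ E := by
    intro n
    induction n with
    | zero =>
      intro y hy
      obtain ⟨i, hi, hi', hyi, hu⟩ := hy.exists_digit
      obtain ⟨D, h1, h2, h3, -⟩ := hT.exists_isPreconnected_of_uniqueDigits hy hi hi' hyi hu
      refine ⟨D, h1, h2, h3, fun z hz h => absurd h (not_lt.2 ?_)⟩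
      exact (norm_sub_le _ _).trans (add_le_add (hR _ hz) (hR _ hy.mem))
    | succ n ih =>
      intro y hy
      obtain ⟨i, hi, hi', hyi, hu⟩ := hy.exists_digit
      obtain ⟨D, h1, h2, h3, h4⟩ := hT.exists_isPreconnected_of_uniqueDigits hy hi hi' hyi hu
      obtain ⟨E, g1, g2, g3, g4⟩ := ih _ hyi
      obtain ⟨j, hj, hj', hyj, huj⟩ := hyi.exists_digit
      obtain ⟨q, hq, hq', hqj⟩ := hex j
      have hqy : tileMap A (tileMap A y - i) - q ∉ T := fun h => hqj (huj q hq hq' h)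
      have hq0 : (ch A i (ch A q T)).Nonempty := by
        obtain ⟨w, hw⟩ := hT.nonempty
        exact ⟨_, symm_mem_ch (symm_mem_ch hw)⟩
      refine ⟨D ∪ ch A i E, union_subset h1 ((ch_mono _ _ g1).trans (hT.ch_compl_subset hi hi')),
        h2.union' (hq0.mono (subset_inter (h4 q hq hq' hqy) (ch_mono _ _ (g3 q hq hq' hqy))))
          (isPreconnected_ch g2), fun p hp hp' hpy => (h3 p hp hp' hpy).trans subset_union_left, ?_⟩
      intro z hz hlt
      obtain ⟨p, hp, hp', hzp⟩ := (hT.mem_iff z).1 hz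
      by_cases hpy : tileMap A y - p ∈ T
      · obtain rfl := hu p hp hp' hpy
        refine Or.inr (g4 _ hzp ?_)
        rwa [sub_sub_sub_cancel_right, ← map_sub, ← Function.iterate_succ_apply]
      · exact Or.inl (h3 p hp hp' hpy hzp)
  choose E h1 h2 h3 h4 using fun n => key n y hy
  have hE : T \ {y} = ⋃ n, E n := by
    refine Subset.antisymm ?_ (iUnion_subset h1)
    rintro z ⟨hz, hzy⟩
    have hpos : 0 < ‖z - y‖ := norm_pos_iff.2 (sub_ne_zero.2 hzy)
    obtain ⟨n, hn⟩ := exists_forall_norm_lt hA (R + R) hpos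
    refine mem_iUnion.2 ⟨n, h4 n z hz (not_le.1 fun h => ?_)⟩
    exact lt_irrefl _ (hn _ h)
  obtain ⟨i, hi, hi', hyi, hu⟩ := hy.exists_digit
  obtain ⟨p, hp, hp', hpi⟩ := hex i
  obtain ⟨w, hw⟩ := hT.nonempty
  rw [hE]
  exact isPreconnected_iUnion ⟨_, mem_iInter.2 fun n => h3 n p hp hp' (fun h => hpi (hu p hp hp' h))
    (symm_mem_ch hw)⟩ h2

end IsTile

theorem exists_forall_natCast_le {f : ℕ → ℕ} {N : ℕ} (h : ∀ n, f n ≤ N) : ∃ n, ∀ m, f m ≤ f n := by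
  have hb : BddAbove (range f) := ⟨N, forall_mem_range.2 h⟩
  obtain ⟨n, hn⟩ := Nat.sSup_mem (range_nonempty f) hb
  exact ⟨n, fun m => hn ▸ le_csSup hb (mem_range_self m)⟩

theorem finite_setOf_isNbr (A : ℤ) : {g : ℤ × ℤ | IsNbr A g.1 g.2}.Finite := by
  refine (finite_Icc ((-(2 * |A| + 2), -2) : ℤ × ℤ) (2 * |A| + 2, 2)).subset ?_
  rintro ⟨x, y⟩ h
  simp only [mem_ofPred_eq, IsNbr] at h
  rw [← Icc_prod_Icc]
  simp only [mem_prod, mem_Icc]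
  have := abs_cases A
  omega

namespace IsTile

variable {A : ℤ} {T : Set ℂ}

theorem exists_forall_uniqueDigits (hT : IsTile A T) (x : ℂ) :
    ∃ n, ∀ k ∈ desc A n 0, (tileMap A)^[n] x ∈ tl T k →
      UniqueDigits A T ((tileMap A)^[n] x - latPt k) := by
  let C : ℕ → Set (ℤ × ℤ) := fun n => {k | k ∈ desc A n 0 ∧ (tileMap A)^[n] x ∈ tl T k}
  have hfin : ∀ n, (C n).Finite := fun n => (finite_desc A n 0).subset fun k hk => hk.1
  have hchild : ∀ n, ∀ k ∈ C n, ∃ i : ℤ, 0 ≤ i ∧ i ≤ 2 * A - 4 ∧ subIdx A k i ∈ C (n + 1) := by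
    rintro n k ⟨hk, hkx⟩
    obtain ⟨i, hi, hi', h⟩ := hT.mem_tl_iff.1 hkx
    refine ⟨i, hi, hi', ⟨k, hk, i, hi, hi', rfl⟩, ?_⟩
    rwa [Function.iterate_succ_apply']
  have hbound : ∀ n, (C n).ncard ≤ {g : ℤ × ℤ | IsNbr A g.1 g.2}.ncard := by
    intro n
    rcases (C n).eq_empty_or_nonempty with h | ⟨k₀, hk₀⟩
    · simp [h]
    refine ncard_le_ncard_of_injOn (fun k => k - k₀) ?_ (sub_left_injective.injOn)
      (finite_setOf_isNbr A)
    intro k hk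
    exact hT.isNbr hk₀.2 hk.2
  obtain ⟨n, hn⟩ := exists_forall_natCast_le hbound
  have hmono : ∀ m, (C m).ncard ≤ (C (m + 1)).ncard := by
    intro m
    choose! i hi hi' hC using hchild m
    refine ncard_le_ncard_of_injOn (fun k => subIdx A k (i k)) hC ?_ (hfin _)
    intro k hk l hl h
    exact (eq_of_subIdx_eq (hi k hk) (hi' k hk) (hi l hl) (hi' l hl) h).1
  have heq : ∀ m, n ≤ m → (C (m + 1)).ncard ≤ (C m).ncard := by
    intro m hm
    exact (hn _).trans (monotone_nat_of_le_succ hmono hm)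
  have huniq : ∀ m, n ≤ m → ∀ k ∈ C m, ∀ i : ℤ, 0 ≤ i → i ≤ 2 * A - 4 →
      subIdx A k i ∈ C (m + 1) → ∀ i' : ℤ, 0 ≤ i' → i' ≤ 2 * A - 4 →
      subIdx A k i' ∈ C (m + 1) → i' = i := by
    intro m hm k hk i hi hi' hki i' hi0 hi0' hki'
    by_contra hne
    choose! d hd hd' hC using hchild m
    obtain ⟨e, he, he', heC, hed⟩ : ∃ e : ℤ, 0 ≤ e ∧ e ≤ 2 * A - 4 ∧ subIdx A k e ∈ C (m + 1) ∧
        e ≠ d k := by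
      by_cases h : i = d k
      · exact ⟨i', hi0, hi0', hki', h ▸ hne⟩
      · exact ⟨i, hi, hi', hki, h⟩
    have h1 : ((fun k => subIdx A k (d k)) '' C m) ⊂ C (m + 1) := by
      have h0 : (fun k => subIdx A k (d k)) '' C m ⊆ C (m + 1) := by
        rintro _ ⟨l, hl, rfl⟩
        exact hC l hl
      refine (ssubset_iff_of_subset h0).2 ⟨_, heC, ?_⟩
      rintro ⟨l, hl, hle⟩
      obtain ⟨rfl, h2⟩ := eq_of_subIdx_eq (hd l hl) (hd' l hl) he he' hle
      exact hed h2.symm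
    have h2 := ncard_lt_ncard h1 (hfin _)
    rw [Set.InjOn.ncard_image] at h2
    · exact absurd (heq m hm) (not_le.2 h2)
    · intro k hk l hl h
      exact (eq_of_subIdx_eq (hd k hk) (hd' k hk) (hd l hl) (hd' l hl) h).1
  refine ⟨n, fun k hk hkx => ⟨{z | ∃ m, n ≤ m ∧ ∃ l ∈ C m, z = (tileMap A)^[m] x - latPt l}, ?_,
    ⟨n, le_rfl, k, ⟨hk, hkx⟩, rfl⟩, ?_⟩⟩
  · rintro _ ⟨m, -, l, hl, rfl⟩
    exact hl.2
  · rintro _ ⟨m, hm, l, hl, rfl⟩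
    have h1 : ∀ i : ℤ, tileMap A ((tileMap A)^[m] x - latPt l) - i =
        (tileMap A)^[m + 1] x - latPt (subIdx A l i) := by
      intro i
      rw [Function.iterate_succ_apply', map_sub, sub_sub, tileMap_latPt_add]
    obtain ⟨i, hi, hi', hC⟩ := hchild m l hl
    refine ⟨i, hi, hi', ⟨m + 1, by omega, _, hC, h1 i⟩, fun i' hi0 hi0' h => ?_⟩
    rw [h1] at h
    exact huniq m hm l hl i hi hi' hC i' hi0 hi0' ⟨⟨l, hl.1, i', hi0, hi0', rfl⟩, h⟩

theorem isPreconnected_tl_diff {k : ℤ × ℤ} {x : ℂ}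
    (h : IsPreconnected (T \ {x - latPt k})) : IsPreconnected (tl T k \ {x}) := by
  have h1 : tl T k \ {x} = (Homeomorph.subRight (latPt k)) ⁻¹' (T \ {x - latPt k}) := by
    ext z
    simp [mem_tl]
  rwa [h1, Homeomorph.isPreconnected_preimage]

/-- The homeomorphism given by the `n`-th iterate of `tileMap A`. -/
def iterHomeo (A : ℤ) : ℕ → (ℂ ≃ₜ ℂ)
  | 0 => Homeomorph.refl ℂ
  | n + 1 => (tileMap A).toHomeomorph.trans (iterHomeo A n)

theorem iterHomeo_apply (A : ℤ) (n : ℕ) (z : ℂ) : iterHomeo A n z = (tileMap A)^[n] z := by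
  induction n generalizing z with
  | zero => rfl
  | succ n ih => exact ih _

theorem uniformContinuous_iterate (A : ℤ) (n : ℕ) : UniformContinuous ((tileMap A)^[n]) := by
  induction n with
  | zero => exact uniformContinuous_id
  | succ n ih => exact ih.comp (tileMap A : ℂ →L[ℝ] ℂ).uniformContinuous

theorem isPreconnected_diff (hT : IsTile A T) (x : ℂ) :
    IsPreconnected (T \ {x}) := by
  obtain ⟨n, hn⟩ := hT.exists_forall_uniqueDigits x
  have h1 : T \ {x} = ⋃ k ∈ desc A n 0, iterHomeo A n ⁻¹' (tl T k \ {(tileMap A)^[n] x}) := by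
    ext z
    have h2 := hT.mem_tl_iff_desc n (k := 0) (z := z)
    rw [tl_zero] at h2
    rw [Set.mem_sdiff, h2]
    simp only [mem_iUnion, mem_preimage, Set.mem_sdiff, iterHomeo_apply, mem_singleton_iff]
    have h3 : (tileMap A)^[n] z = (tileMap A)^[n] x ↔ z = x :=
      ((tileMap A).injective.iterate n).eq_iff
    rw [h3]
    tauto
  rw [h1]
  refine (gConn_desc hT.four_le n 0).isPreconnected_biUnion ?_ ?_
  · intro k hk
    rw [Homeomorph.isPreconnected_preimage]
    by_cases h : (tileMap A)^[n] x ∈ tl T k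
    · exact isPreconnected_tl_diff (hT.isPreconnected_diff_of_uniqueDigits (hn k hk h))
    · rw [sdiff_singleton_eq_self h]
      exact hT.isPreconnected_tl k
  · intro k _ l _ hkl
    rw [← preimage_inter]
    refine Nonempty.preimage ?_ (iterHomeo A n).surjective
    obtain ⟨z, hz, hne⟩ := (hT.adj₂_of_gAdj hkl).exists_ne ((tileMap A)^[n] x)
    exact ⟨z, ⟨hz.1, hne⟩, hz.2, hne⟩

theorem isPreconnected_tl_diff_singleton (hT : IsTile A T) (k : ℤ × ℤ) (x : ℂ) :
    IsPreconnected (tl T k \ {x}) := by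
  by_cases h : x ∈ tl T k
  · exact isPreconnected_tl_diff (hT.isPreconnected_diff _)
  · rw [sdiff_singleton_eq_self h]
    exact hT.isPreconnected_tl k

theorem exists_pos_forall_dist_lt (hT : IsTile A T) : ∃ δ > 0, ∀ k l : ℤ × ℤ, ∀ z ∈ tl T k,
    ∀ w ∈ tl T l, dist z w < δ → (tl T k ∩ tl T l).Nonempty := by
  obtain ⟨δ, hδ, h⟩ := lebesgue_number_lemma_of_metric (s := T)
    (c := fun z : T => (⋃ l ∈ {l | (z : ℂ) ∉ tl T l}, tl T l)ᶜ) hT.isCompact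
    (fun z => (hT.isClosed_biUnion_tl _).isOpen_compl) (fun z hz => mem_iUnion.2 ⟨⟨z, hz⟩, by simp⟩)
  refine ⟨δ, hδ, fun k l z hz w hw hzw => ?_⟩
  refine (nonempty_tl_inter_congr (k := 0) (l := l - k) (by simp)).2 ?_
  obtain ⟨⟨z', hz'⟩, h'⟩ := h _ hz
  have h1 : w - latPt k ∈ ball (z - latPt k) δ := by
    rwa [mem_ball, dist_sub_right, dist_comm]
  have h2 := h' h1
  simp only [mem_compl_iff, mem_iUnion, not_exists] at h2
  have h3 := h2 (l - k)
  simp only [mem_ofPred_eq] at h3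
  refine ⟨z', by simpa using hz', ?_⟩
  by_contra hc
  exact h3 hc (mem_tl_sub.2 hw)

theorem isPreconnected_outer_diff (hT : IsTile A T) (x : ℂ) :
    IsPreconnected ((⋃ k ∈ ({0}ᶜ : Set (ℤ × ℤ)), tl T k) \ {x}) := by
  have h1 : (⋃ k ∈ ({0}ᶜ : Set (ℤ × ℤ)), tl T k) \ {x} =
      ⋃ k ∈ ({0}ᶜ : Set (ℤ × ℤ)), (tl T k \ {x}) := by
    ext z
    simp only [Set.mem_sdiff, mem_iUnion]
    tauto
  rw [h1]
  refine (gConn_compl_zero A).isPreconnected_biUnion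
    (fun k _ => hT.isPreconnected_tl_diff_singleton k x) ?_
  intro k _ l _ hkl
  obtain ⟨z, hz, hne⟩ := (hT.adj₂_of_gAdj hkl).exists_ne x
  exact ⟨z, ⟨hz.1, hne⟩, hz.2, hne⟩

theorem isConnected_outer (hT : IsTile A T) :
    IsConnected (⋃ k ∈ ({0}ᶜ : Set (ℤ × ℤ)), tl T k) := by
  constructor
  · exact ⟨latPt (1, 0), mem_biUnion (by simp) (hT.latPt_mem_tl _)⟩
  · refine (gConn_compl_zero A).isPreconnected_biUnion (fun k _ => hT.isPreconnected_tl k) ?_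
    intro k _ l _ hkl
    exact (hT.adj₂_of_gAdj hkl).nonempty

theorem uniformlyLocallyConnected_outer (hT : IsTile A T) :
    UniformlyLocallyConnected (⋃ k ∈ ({0}ᶜ : Set (ℤ × ℤ)), tl T k) := by
  intro ε hε
  obtain ⟨n, hn⟩ := hT.dist_lt_of_mem_piece (half_pos hε)
  obtain ⟨δ', hδ', hmeet⟩ := hT.exists_pos_forall_dist_lt
  have hcont : UniformContinuous ((tileMap A)^[n]) := uniformContinuous_iterate A n
  obtain ⟨δ, hδ, hδδ⟩ := Metric.uniformContinuous_iff.1 hcont δ' hδ'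
  refine ⟨δ, hδ, fun p hp q hq hpq => ?_⟩
  obtain ⟨k, hk, hpk⟩ := mem_iUnion₂.1 hp
  obtain ⟨k', hk', hqk⟩ := mem_iUnion₂.1 hq
  obtain ⟨l, hl, hpl⟩ := (hT.mem_tl_iff_desc n).1 hpk
  obtain ⟨l', hl', hql⟩ := (hT.mem_tl_iff_desc n).1 hqk
  obtain ⟨w, hw, hw'⟩ := (hmeet l l' _ hpl _ hql (hδδ hpq)).preimage (iterHomeo A n).surjective
  refine ⟨iterHomeo A n ⁻¹' tl T l ∪ iterHomeo A n ⁻¹' tl T l', ?_, ?_, Or.inl ?_, Or.inr ?_, ?_⟩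
  · refine union_subset (fun z hz => mem_biUnion hk ?_) (fun z hz => mem_biUnion hk' ?_)
    · exact (hT.mem_tl_iff_desc n).2 ⟨l, hl, by rwa [mem_preimage, iterHomeo_apply] at hz⟩
    · exact (hT.mem_tl_iff_desc n).2 ⟨l', hl', by rwa [mem_preimage, iterHomeo_apply] at hz⟩
  · refine IsPreconnected.union' ⟨w, hw, hw'⟩ ?_ ?_
    · exact (iterHomeo A n).isPreconnected_preimage.2 (hT.isPreconnected_tl l)
    · exact (iterHomeo A n).isPreconnected_preimage.2 (hT.isPreconnected_tl l')
  · rwa [mem_preimage, iterHomeo_apply]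
  · rwa [mem_preimage, iterHomeo_apply]
  · rw [iterHomeo_apply] at hw hw'
    refine union_subset (fun z hz => ?_) (fun z hz => ?_)
    · rw [mem_preimage, iterHomeo_apply] at hz
      have := hn l z p hz hpl
      rw [mem_closedBall]
      linarith
    · rw [mem_preimage, iterHomeo_apply] at hz
      have h1 := hn l' z w hz hw'
      have h2 := hn l w p hw hpl
      rw [mem_closedBall]
      linarith [dist_triangle z w p]

theorem nonempty_homeomorph_component (hT : IsTile A T) {x : ℂ} (hx : x ∈ interior T) :
    Nonempty (closure (connectedComponentIn (interior T) x) ≃ₜ closedBall (0 : ℂ) 1) := by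
  have hcl := hT.isClosed_biUnion_tl ({0}ᶜ : Set (ℤ × ℤ))
  have hsub := connectedComponentIn_subset (interior T) x
  refine nonempty_homeomorph_closure_closedBall isOpen_interior.connectedComponentIn
    (isConnected_connectedComponentIn_iff.2 hx)
    (hT.isCompact.isBounded.subset (hsub.trans interior_subset)) ?_ hcl ?_ ?_
    hT.uniformlyLocallyConnected_outer fun y _ => hT.isPreconnected_outer_diff y
  · rw [hT.interior_eq]
    exact isPreconnected_compl_connectedComponentIn_compl hcl hT.isConnected_outer x
  · rw [← subset_compl_iff_disjoint_right, ← hT.interior_eq]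
    exact hsub
  · have := closure_connectedComponentIn_diff_subset hx
    rwa [hT.interior_eq, compl_compl, ← hT.interior_eq] at this

end IsTile

/-- Approximations of `halfTile`. -/
def halfApprox (A : ℤ) (T : Set ℂ) : ℕ → ℤ → Set ℂ
  | 0, _ => T
  | n + 1, s => (⋃ i ∈ {i : ℤ | 0 ≤ i ∧ i ≤ 2 * A - 4 ∧ s * (i - (A - 2)) < 0}, ch A i T) ∪
      ch A (A - 2) (halfApprox A T n (-s))

/-- For `s = 1`, the part of the tile `T` whose first digit different from the middle digit `A - 2`
is smaller than `A - 2` at an odd position and larger than `A - 2` at an even position;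
for `s = -1`, the part in which it is the other way round. -/
def halfTile (A : ℤ) (T : Set ℂ) (s : ℤ) : Set ℂ := ⋂ n, halfApprox A T n s

namespace IsTile

variable {A : ℤ} {T : Set ℂ}

theorem isClosed_halfApprox (hT : IsTile A T) (n : ℕ) (s : ℤ) : IsClosed (halfApprox A T n s) := by
  have hch : ∀ i {t : Set ℂ}, IsClosed t → IsClosed (ch A i t) := fun i t ht =>
    ht.preimage ((tileMap A).continuous.sub continuous_const)
  induction n generalizing s with
  | zero => exact hT.isCompact.isClosed
  | succ n ih =>
    refine IsClosed.union (Finite.isClosed_biUnion ?_ fun i _ => hch i hT.isCompact.isClosed)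
      (hch _ (ih _))
    exact (finite_Icc 0 (2 * A - 4)).subset fun i hi => ⟨hi.1, hi.2.1⟩

theorem isClosed_halfTile (hT : IsTile A T) (s : ℤ) : IsClosed (halfTile A T s) :=
  isClosed_iInter fun n => hT.isClosed_halfApprox n s

theorem halfApprox_succ_subset (hT : IsTile A T) (n : ℕ) (s : ℤ) :
    halfApprox A T (n + 1) s ⊆ halfApprox A T n s := by
  induction n generalizing s with
  | zero =>
    refine union_subset (iUnion₂_subset fun i hi => hT.ch_subset hi.1 hi.2.1) (hT.ch_subset ?_ ?_)
    all_goals linarith [hT.four_le]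
  | succ n ih => exact union_subset_union_right _ (ch_mono _ _ (ih _))

theorem halfApprox_antitone (hT : IsTile A T) (s : ℤ) : Antitone fun n => halfApprox A T n s :=
  antitone_nat_of_succ_le fun n => hT.halfApprox_succ_subset n s

theorem subset_halfApprox_union (hT : IsTile A T) (n : ℕ) {s : ℤ} (hs : s = 1 ∨ s = -1) :
    T ⊆ halfApprox A T n s ∪ halfApprox A T n (-s) := by
  induction n generalizing s with
  | zero => exact subset_union_left
  | succ n ih =>
    intro z hz
    obtain ⟨i, hi, hi', h⟩ := (hT.mem_iff z).1 hz
    have hs' : i = A - 2 ∨ s * (i - (A - 2)) < 0 ∨ -s * (i - (A - 2)) < 0 := by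
      rcases hs with rfl | rfl <;> omega
    rcases hs' with rfl | h1 | h1
    · rcases ih (s := -s) (by omega) h with h2 | h2
      · exact Or.inl (Or.inr h2)
      · exact Or.inr (Or.inr h2)
    · exact Or.inl (Or.inl (mem_biUnion ⟨hi, hi', h1⟩ h))
    · exact Or.inr (Or.inl (mem_biUnion ⟨hi, hi', h1⟩ h))

theorem subset_halfTile_union (hT : IsTile A T) : T ⊆ halfTile A T 1 ∪ halfTile A T (-1) := by
  intro z hz
  by_contra hc
  simp only [halfTile, mem_union, mem_iInter, not_or, not_forall] at hc
  obtain ⟨⟨m, hm⟩, n, hn⟩ := hc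
  rcases hT.subset_halfApprox_union (max m n) (Or.inl rfl) hz with h | h
  · exact hm (hT.halfApprox_antitone 1 (le_max_left m n) h)
  · exact hn (hT.halfApprox_antitone (-1) (le_max_right m n) h)

theorem halfTile_eq (s : ℤ) : halfTile A T s =
    T ∩ ((⋃ i ∈ {i : ℤ | 0 ≤ i ∧ i ≤ 2 * A - 4 ∧ s * (i - (A - 2)) < 0}, ch A i T) ∪
      ch A (A - 2) (halfTile A T (-s))) := by
  ext z
  have h : z ∈ halfTile A T s ↔ z ∈ T ∧ ∀ n, z ∈ halfApprox A T (n + 1) s := by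
    rw [halfTile, mem_iInter]
    exact ⟨fun h => ⟨h 0, fun n => h _⟩, fun h n => by cases n with
      | zero => exact h.1
      | succ n => exact h.2 n⟩
  rw [h]
  simp only [halfApprox, mem_inter_iff, mem_union, forall_or_left, mem_ch, halfTile, mem_iInter]

theorem halfTile_subset (s : ℤ) : halfTile A T s ⊆ T := by
  rw [halfTile_eq]
  exact inter_subset_left

theorem mem_halfTile {s : ℤ} {z : ℂ} (hz : z ∈ halfTile A T s) :
    (∃ i : ℤ, 0 ≤ i ∧ i ≤ 2 * A - 4 ∧ s * (i - (A - 2)) < 0 ∧ tileMap A z - i ∈ T) ∨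
      tileMap A z - (A - 2 : ℤ) ∈ halfTile A T (-s) := by
  rw [halfTile_eq] at hz
  rcases hz.2 with h | h
  · obtain ⟨i, hi, h⟩ := mem_iUnion₂.1 h
    exact Or.inl ⟨i, hi.1, hi.2.1, hi.2.2, h⟩
  · exact Or.inr h

theorem mem_tl_iff_sub (hT : IsTile A T) {k : ℤ × ℤ} {z : ℂ} (i : ℤ) :
    z ∈ tl T k ↔ ∃ d : ℤ, 0 ≤ d ∧ d ≤ 2 * A - 4 ∧
      tileMap A z - i ∈ tl T (-(2 * A - 3) * k.2 + d - i, k.1 - A * k.2) := by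
  rw [hT.mem_tl_iff]
  refine exists_congr fun d => and_congr_right fun _ => and_congr_right fun _ => ?_
  rw [← mem_tl_sub (l := (i, 0))]
  have h1 : latPt (i, 0) = (i : ℂ) := by apply Complex.ext <;> simp
  have h2 : subIdx A k d - (i, 0) = (-(2 * A - 3) * k.2 + d - i, k.1 - A * k.2) := by
    simp [subIdx]
  rw [h1, h2]

theorem isNbr_of_mem (hT : IsTile A T) {k : ℤ × ℤ} {z : ℂ} (hz : z ∈ T) (hk : z ∈ tl T k) :
    IsNbr A k.1 k.2 := by
  have := hT.isNbr (k := 0) (by rwa [tl_zero]) hk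
  simpa using this

theorem subset_tl_of_alternating (hT : IsTile A T) {Y : ℤ → Set ℂ} (hY : ∀ s, Y s ⊆ T)
    (h : ∀ s : ℤ, s = 1 ∨ s = -1 → ∀ z ∈ Y s, ∃ i : ℤ, 0 ≤ i + s * (A - 2) ∧
      i + s * (A - 2) ≤ 2 * A - 4 ∧ tileMap A z - i ∈ Y (-s)) {s : ℤ} (hs : s = 1 ∨ s = -1) :
    Y s ⊆ tl T (s * (A - 1), s) := by
  have h1 : {w | ∃ s : ℤ, (s = 1 ∨ s = -1) ∧ w + latPt (s * (A - 1), s) ∈ Y s} ⊆ T := by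
    refine hT.subset_of_forall ?_ ?_
    · refine ((hT.isCompact_tl (-(1 * (A - 1), 1))).isBounded.union
        (hT.isCompact_tl (-(-1 * (A - 1), -1))).isBounded).subset ?_
      rintro w ⟨s, rfl | rfl, hw⟩
      · refine Or.inl ?_
        rw [mem_tl, latPt_neg, sub_neg_eq_add]
        exact hY _ hw
      · refine Or.inr ?_
        rw [mem_tl, latPt_neg, sub_neg_eq_add]
        exact hY _ hw
    · rintro w ⟨s, hs, hw⟩
      obtain ⟨i, hi, hi', hz⟩ := h s hs _ hw
      refine ⟨_, hi, hi', -s, by omega, ?_⟩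
      convert hz using 1
      apply Complex.ext <;> simp <;> ring
  intro z hz
  exact h1 ⟨s, hs, by rwa [sub_add_cancel]⟩

theorem mem_tl_of_mem_tl_tip (hT : IsTile A T) {s : ℤ} (hs : s = 1 ∨ s = -1) {z : ℂ} (hz : z ∈ T)
    (hz' : z ∈ tl T (s * (2 * A - 2), s * 2)) : z ∈ tl T (s * (A - 1), s) := by
  refine hT.subset_tl_of_alternating (Y := fun s => T ∩ tl T (s * (2 * A - 2), s * 2))
    (fun s => inter_subset_left) ?_ hs ⟨hz, hz'⟩
  rintro s hs z ⟨hz, hz'⟩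
  obtain ⟨i, hi, hi', h⟩ := (hT.mem_iff z).1 hz
  obtain ⟨d, hd, hd', h'⟩ := (hT.mem_tl_iff_sub i).1 hz'
  have hn := hT.isNbr_of_mem h h'
  have h4 := hT.four_le
  refine ⟨i, ?_, ?_, h, ?_⟩
  · rcases hs with rfl | rfl <;> simp only [IsNbr] at hn <;> omega
  · rcases hs with rfl | rfl <;> simp only [IsNbr] at hn <;> omega
  · convert h' using 2
    rcases hs with rfl | rfl <;> simp only [IsNbr] at hn <;> ext <;> simp only <;> omega

theorem mem_tl_of_mem_ch (hT : IsTile A T) {s : ℤ} (hs : s = 1 ∨ s = -1) {z : ℂ} {i : ℤ}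
    (hi : s * (i - (A - 2)) < 0) (hz : tileMap A z - i ∈ T)
    (hz' : tileMap A z - (A - 2 : ℤ) ∈ halfTile A T s) : z ∈ tl T (s * (1 - A), -s) := by
  have h4 := hT.four_le
  set u := tileMap A z - (A - 2 : ℤ) with hu
  have huT := halfTile_subset s hz'
  have hui : u ∈ tl T (i - (A - 2), 0) := by
    rw [mem_tl]
    convert hz using 1
    rw [hu]
    apply Complex.ext <;> simp
  have hi1 : i = A - 2 - s := by
    have := hT.isNbr_of_mem huT hui
    simp only [IsNbr] at this
    rcases hs with rfl | rfl <;> omega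
  subst hi1
  have hv : tileMap A u - (A - 2 : ℤ) ∈ halfTile A T (-s) ∧
      tileMap A u - (A - 2 : ℤ) ∈ tl T (s * (2 - A), -s) := by
    rcases mem_halfTile hz' with ⟨j, hj, hj', hjs, hv⟩ | hv
    · obtain ⟨m, hm, hm', h⟩ := (hT.mem_tl_iff_sub j).1 hui
      have := hT.isNbr_of_mem hv h
      simp only [IsNbr] at this
      rcases hs with rfl | rfl <;> omega
    · refine ⟨hv, ?_⟩
      obtain ⟨m, hm, hm', h⟩ := (hT.mem_tl_iff_sub (A - 2)).1 hui
      have := hT.isNbr_of_mem (halfTile_subset _ hv) h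
      simp only [IsNbr] at this
      convert h using 2
      rcases hs with rfl | rfl <;> ext <;> simp only <;> omega
  set v := tileMap A u - (A - 2 : ℤ) with hv0
  obtain ⟨hv, hve⟩ := hv
  obtain ⟨l, hl, hl', hls, ht⟩ : ∃ l : ℤ, 0 ≤ l ∧ l ≤ 2 * A - 4 ∧ 0 ≤ s * (l - (A - 2)) ∧
      tileMap A v - l ∈ T := by
    rcases mem_halfTile hv with ⟨l, hl, hl', hls, h⟩ | h
    · exact ⟨l, hl, hl', by linarith, h⟩
    · exact ⟨A - 2, by omega, by omega, by simp, halfTile_subset _ h⟩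
  obtain ⟨r, hr, hr', htf⟩ := (hT.mem_tl_iff_sub l).1 hve
  have hn := hT.isNbr_of_mem ht htf
  have htb := hT.mem_tl_of_mem_tl_tip hs ht (by
    convert htf using 2
    simp only [IsNbr] at hn
    rcases hs with rfl | rfl <;> ext <;> simp only <;> omega)
  rw [hT.mem_tl_iff_sub (A - 2)]
  refine ⟨(1 - s) * (A - 2), ?_, ?_, ?_⟩
  · rcases hs with rfl | rfl <;> omega
  · rcases hs with rfl | rfl <;> omega
  rw [hT.mem_tl_iff_sub (A - 2)]
  refine ⟨(1 + s) * (A - 2), ?_, ?_, ?_⟩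
  · rcases hs with rfl | rfl <;> omega
  · rcases hs with rfl | rfl <;> omega
  rw [hT.mem_tl_iff_sub l]
  refine ⟨l - s * (A - 2), ?_, ?_, ?_⟩
  · rcases hs with rfl | rfl <;> omega
  · rcases hs with rfl | rfl <;> omega
  convert htb using 2
  rcases hs with rfl | rfl <;> ext <;> simp only <;> ring

theorem inter_halfTile_subset (hT : IsTile A T) :
    halfTile A T 1 ∩ halfTile A T (-1) ⊆ tl T (A - 1, 1) ∪ tl T (1 - A, -1) := by
  intro z hz
  by_contra hc
  have hstep : ∀ z ∈ (halfTile A T 1 ∩ halfTile A T (-1)) \ (tl T (A - 1, 1) ∪ tl T (1 - A, -1)),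
      tileMap A z - (A - 2 : ℤ) ∈
        (halfTile A T 1 ∩ halfTile A T (-1)) \ (tl T (A - 1, 1) ∪ tl T (1 - A, -1)) := by
    rintro z ⟨⟨h1, h2⟩, hz⟩
    have h4 := hT.four_le
    rcases mem_halfTile h1 with ⟨i, hi, hi', his, h1'⟩ | h1'
    · exfalso
      rcases mem_halfTile h2 with ⟨j, hj, hj', hjs, h2'⟩ | h2'
      · have := hT.isNbr (k := (i, 0)) (l := (j, 0)) (z := tileMap A z) (by
          rw [mem_tl]; convert h1' using 1; apply Complex.ext <;> simp) (by
          rw [mem_tl]; convert h2' using 1; apply Complex.ext <;> simp)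
        simp only [IsNbr] at this
        omega
      · refine hz (Or.inr ?_)
        have := hT.mem_tl_of_mem_ch (Or.inl rfl) his h1' (by simpa using h2')
        simpa using this
    · rcases mem_halfTile h2 with ⟨j, hj, hj', hjs, h2'⟩ | h2'
      · exfalso
        refine hz (Or.inl ?_)
        have := hT.mem_tl_of_mem_ch (Or.inr rfl) hjs h2' (by simpa using h1')
        simpa using this
      · refine ⟨⟨by simpa using h2', h1'⟩, fun hc => hz ?_⟩
        rcases hc with hc | hc
        · refine Or.inr ((hT.mem_tl_iff_sub (A - 2)).2 ⟨0, le_rfl, by omega, ?_⟩)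
          convert hc using 2
          ext <;> simp only <;> ring
        · refine Or.inl ((hT.mem_tl_iff_sub (A - 2)).2 ⟨2 * A - 4, by omega, le_rfl, ?_⟩)
          convert hc using 2
          ext <;> simp only <;> ring
  have h4 := hT.four_le
  have h := hT.subset_tl_of_alternating (Y := fun _ =>
    (halfTile A T 1 ∩ halfTile A T (-1)) \ (tl T (A - 1, 1) ∪ tl T (1 - A, -1)))
    (fun _ w hw => halfTile_subset _ hw.1.1) ?_ (Or.inl rfl) ⟨hz, hc⟩
  · exact hc (Or.inl (by simpa using h))
  · rintro s hs w hw
    refine ⟨A - 2, ?_, ?_, hstep w hw⟩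
    · rcases hs with rfl | rfl <;> omega
    · rcases hs with rfl | rfl <;> omega

theorem nonempty_interior_inter_halfTile (hT : IsTile A T) {s : ℤ} (hs : s = 1 ∨ s = -1) :
    (interior T ∩ halfTile A T s).Nonempty := by
  have h4 := hT.four_le
  have h0 : 0 ≤ A - 2 - s := by omega
  have h1 : A - 2 - s ≤ 2 * A - 4 := by omega
  obtain ⟨w, hw⟩ := hT.nonempty_interior
  have hmem := symm_mem_ch (A := A) (i := A - 2 - s) hw
  have hsub := ch_mono A (A - 2 - s) (interior_subset (s := T))
  refine ⟨_, mem_interior.2 ⟨_, hsub.trans (hT.ch_subset h0 h1), ?_, hmem⟩, ?_⟩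
  · exact isOpen_interior.preimage ((tileMap A).continuous.sub continuous_const)
  · rw [halfTile_eq]
    refine ⟨hT.ch_subset h0 h1 (hsub hmem), Or.inl (mem_biUnion ⟨h0, h1, ?_⟩ (hsub hmem))⟩
    rcases hs with rfl | rfl <;> omega

theorem not_isPreconnected_interior (hT : IsTile A T) : ¬ IsPreconnected (interior T) := by
  intro h
  obtain ⟨z, hz, hz'⟩ := isPreconnected_closed_iff.1 h _ _ (hT.isClosed_halfTile 1)
    (hT.isClosed_halfTile (-1)) (interior_subset.trans hT.subset_halfTile_union)
    (hT.nonempty_interior_inter_halfTile (Or.inl rfl))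
    (hT.nonempty_interior_inter_halfTile (Or.inr rfl))
  rcases hT.inter_halfTile_subset hz' with h1 | h1 <;>
    simpa using hT.eq_zero_of_mem_interior hz h1

end IsTile

/-- The plane as the complex numbers. -/
def planeHomeo : (Fin 2 → ℝ) ≃ₜ ℂ :=
  Complex.basisOneI.equivFunL.symm.toHomeomorph

@[simp] theorem planeHomeo_re (x : Fin 2 → ℝ) : (planeHomeo x).re = x 0 := by
  change (Complex.basisOneI.equivFun.symm x).re = x 0
  rw [Module.Basis.equivFun_symm_apply]
  simp [Fin.sum_univ_two]

@[simp] theorem planeHomeo_im (x : Fin 2 → ℝ) : (planeHomeo x).im = x 1 := by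
  change (Complex.basisOneI.equivFun.symm x).im = x 1
  rw [Module.Basis.equivFun_symm_apply]
  simp [Fin.sum_univ_two]

theorem isTile_image_planeHomeo {A B : ℤ} (hA : 4 ≤ A) (h3 : 2 * A - B = 3)
    {T : Set (Fin 2 → ℝ)} (hTne : T.Nonempty) (hTcp : IsCompact T)
    (hT : (M' A B).mulVec '' T = ⋃ j ∈ Icc (0 : ℤ) (B - 1), (fun x => x + (j : ℝ) • e1) '' T) :
    IsTile A (planeHomeo '' T) := by
  obtain rfl : B = 2 * A - 3 := by omega
  have hM : ∀ x, planeHomeo ((M' A (2 * A - 3)).mulVec x) = tileMap A (planeHomeo x) := by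
    intro x
    apply Complex.ext <;> simp [M', dotProduct, Fin.sum_univ_two] <;> ring
  have he : ∀ x (j : ℤ), planeHomeo (x + (j : ℝ) • e1) = planeHomeo x + j := by
    intro x j
    apply Complex.ext <;> simp [e1, Matrix.vecHead, Matrix.vecTail]
  refine ⟨hA, hTne.image _, hTcp.image planeHomeo.continuous, fun z => ?_⟩
  obtain ⟨x, rfl⟩ := planeHomeo.surjective z
  rw [planeHomeo.injective.mem_set_image]
  have hinj : Function.Injective (M' A (2 * A - 3)).mulVec := fun x y h => by
    apply planeHomeo.injective
    apply (tileMap A).injective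
    rw [← hM, ← hM, h]
  rw [← hinj.mem_set_image (s := T), hT]
  simp only [mem_iUnion, mem_image, exists_prop]
  constructor
  · rintro ⟨j, hj, y, hy, hyx⟩
    refine ⟨j, hj.1, by linarith [hj.2], y, hy, ?_⟩
    rw [← hM, ← hyx, he, add_sub_cancel_right]
  · rintro ⟨j, hj, hj', y, hy, hyx⟩
    refine ⟨j, ⟨hj, by omega⟩, y, hy, planeHomeo.injective ?_⟩
    rw [he, hM, hyx, sub_add_cancel]

/-- A homeomorphism of the ambient spaces restricts to closures of interior components. -/
theorem nonempty_homeomorph_closure_component {X Y : Type*} [TopologicalSpace X]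
    [TopologicalSpace Y] (φ : X ≃ₜ Y) (T : Set X) {x : X} (hx : x ∈ interior T) :
    Nonempty (closure (connectedComponentIn (interior T) x) ≃ₜ
      closure (connectedComponentIn (interior (φ '' T)) (φ x))) := by
  rw [← φ.image_interior, ← φ.image_connectedComponentIn hx, ← φ.image_closure]
  exact ⟨φ.image _⟩

end TileAuxiliary

/-- For `0 < A ≤ B`, `B ≥ 2`, `2A - B = 3`, `A ≠ B`, the tile `T`
of `M = [[0,-B],[1,-A]]` with digits `{0,…,B-1}·e₁` is connected, has no cut
point, its interior is disconnected, and the closure of each connected component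
of its interior is homeomorphic to the closed unit disk. -/
theorem tile_no_cutPoint_of_three
    (A B : ℤ) (hA : 0 < A) (hAB : A ≤ B) (hB : 2 ≤ B)
    (h3 : 2 * A - B = 3) (hne : A ≠ B)
    (T : Set (Fin 2 → ℝ)) (hTne : T.Nonempty) (hTcp : IsCompact T)
    (hT : (M' A B).mulVec '' T =
      ⋃ j ∈ Set.Icc (0 : ℤ) (B - 1), (fun x => x + (j : ℝ) • e1) '' T) :
    IsConnected T ∧ (∀ x ∈ T, IsPreconnected (T \ {x})) ∧
      ¬ IsPreconnected (interior T) ∧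
      ∀ x ∈ interior T,
        Nonempty (↥(closure (connectedComponentIn (interior T) x)) ≃ₜ
          ↥(Metric.closedBall (0 : EuclideanSpace ℝ (Fin 2)) 1)) := by
  have hI := isTile_image_planeHomeo (by omega) h3 hTne hTcp hT
  refine ⟨⟨hTne, ?_⟩, fun x _ => ?_, ?_, fun x hx => ?_⟩
  · rw [← planeHomeo.isPreconnected_image]
    exact hI.isPreconnected
  · rw [← planeHomeo.isPreconnected_image, Set.image_sdiff planeHomeo.injective, Set.image_singleton]
    exact hI.isPreconnected_diff _
  · rw [← planeHomeo.isPreconnected_image, planeHomeo.image_interior]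
    exact hI.not_isPreconnected_interior
  · obtain ⟨φ⟩ := nonempty_homeomorph_closure_component planeHomeo T hx
    have hx' : planeHomeo x ∈ interior (planeHomeo '' T) := by
      rw [← planeHomeo.image_interior]
      exact Set.mem_image_of_mem _ hx
    obtain ⟨ψ⟩ := hI.nonempty_homeomorph_component hx'
    let e := Complex.orthonormalBasisOneI.repr
    have he : e '' Metric.closedBall 0 1 = Metric.closedBall 0 1 := by
      rw [e.image_closedBall, map_zero]
    exact ⟨φ.trans <| ψ.trans <| (e.toHomeomorph.image _).trans <| Homeomorph.setCongr he⟩
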